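/- arXiv:1812.08992 — 3 statements merged into one kernel-verified Lean document; each statement's English description precedes it below -/
import Mathlib

section
/- Let P(∂) be an ℓ×k matrix with entries in A = ℂ[∂₁,…,∂ₙ] whose rows generate the submodule P ⊆ A^k, and suppose the ideal 𝔦_ℓ ⊆ A generated by the ℓ×ℓ minors of P(∂) is nonzero (so in particular ℓ ≤ k). Then the distributed system ℬ(P) is controllable if and only if the height of the ideal 𝔦_ℓ is at least 2 (equivalently, the codimension of the variety of 𝔦_ℓ in ℂⁿ is at least 2; by convention the unit ideal has height ⊤). -/
noncomputable section

/-- The space of smooth (infinitely differentiable) functions `ℝⁿ → ℂ`,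
as a `ℂ`-submodule of the space of all functions `ℝⁿ → ℂ`. -/
def Cinf (n : ℕ) : Submodule ℂ ((Fin n → ℝ) → ℂ) where
  carrier := {f | ContDiff ℝ (⊤ : ℕ∞) f}
  add_mem' := fun {f g} hf hg => by
    simp only [Set.mem_setOf_eq] at *
    exact hf.add hg
  zero_mem' := by
    simp only [Set.mem_setOf_eq]
    exact contDiff_const
  smul_mem' := fun c f hf => by
    simp only [Set.mem_setOf_eq] at *
    exact hf.const_smul c

/-- The distributed system `ℬ(P)` defined by an `ℓ × k` matrix `M` of elements of
`A = ℂ[∂₁, …, ∂ₙ]`: the kernel `{f ∈ (C^∞)^k : M f = 0}` of the operator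
`(C^∞)^k → (C^∞)^ℓ` given by `M`, where `A` acts on `C^∞` via a given module structure. -/
def system {n ℓ k : ℕ} [Module (MvPolynomial (Fin n) ℂ) (Cinf n)]
    (M : Matrix (Fin ℓ) (Fin k) (MvPolynomial (Fin n) ℂ)) : Set (Fin k → Cinf n) :=
  {f | ∀ i : Fin ℓ, ∑ j, M i j • f j = 0}

/-- A behaviour `B ⊆ (C^∞)^k` is controllable if for any two subsets `U₁, U₂` of `ℝⁿ`
whose closures do not intersect, and any `f₁, f₂ ∈ B`, there is an `f ∈ B` agreeing with
`f₁` on a neighbourhood of `U₁` and with `f₂` on a neighbourhood of `U₂`. -/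
def IsControllable {n k : ℕ} (B : Set (Fin k → Cinf n)) : Prop :=
  ∀ U₁ U₂ : Set (Fin n → ℝ), closure U₁ ∩ closure U₂ = ∅ →
    ∀ f₁ ∈ B, ∀ f₂ ∈ B, ∃ f ∈ B, ∃ V₁ V₂ : Set (Fin n → ℝ),
      IsOpen V₁ ∧ IsOpen V₂ ∧ U₁ ⊆ V₁ ∧ U₂ ⊆ V₂ ∧
      (∀ x ∈ V₁, ∀ j, (f j : (Fin n → ℝ) → ℂ) x = (f₁ j : (Fin n → ℝ) → ℂ) x) ∧
      (∀ x ∈ V₂, ∀ j, (f j : (Fin n → ℝ) → ℂ) x = (f₂ j : (Fin n → ℝ) → ℂ) x)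

/-- The height of an ideal `I`: the infimum of the heights of the prime ideals minimal
over `I` (so the unit ideal, having no minimal primes, has height `⊤`). -/
noncomputable def idealHeight {R : Type*} [CommRing R] (I : Ideal R) : ℕ∞ :=
  ⨅ p : {q : PrimeSpectrum R // q.asIdeal ∈ I.minimalPrimes}, Order.height p.1

/-- The ideal generated by the `ℓ × ℓ` minors of an `ℓ × k` matrix. -/
def minorsIdeal {R : Type*} [CommRing R] {ℓ k : ℕ}
    (M : Matrix (Fin ℓ) (Fin k) R) : Ideal R :=
  Ideal.span {x | ∃ g : Fin ℓ ↪ Fin k, x = (M.submatrix id g).det}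


set_option linter.unusedSectionVars false
set_option linter.unusedSimpArgs false
set_option linter.unusedVariables false

namespace CMH

open MvPolynomial

/-- The module structure is given by partial derivatives. -/
class DAct (n : ℕ) [Module (MvPolynomial (Fin n) ℂ) (Cinf n)] : Prop where
  hX : ∀ (i : Fin n) (f : Cinf n),
      (((MvPolynomial.X i : MvPolynomial (Fin n) ℂ) • f : Cinf n) : (Fin n → ℝ) → ℂ) =
        fun x => fderiv ℝ (f : (Fin n → ℝ) → ℂ) x (Pi.single i 1)
  hC : ∀ (c : ℂ) (f : Cinf n),
      ((MvPolynomial.C c : MvPolynomial (Fin n) ℂ) • f : Cinf n) = c • f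

section basic

variable {n : ℕ}

theorem cd (f : Cinf n) : ContDiff ℝ (⊤ : ℕ∞) f.1 := f.2

theorem cdiff (f : Cinf n) : Differentiable ℝ f.1 := (cd f).differentiable (by simp)

theorem ccont (f : Cinf n) : Continuous f.1 := (cd f).continuous

/-- Constructor. -/
def mk (f : (Fin n → ℝ) → ℂ) (hf : ContDiff ℝ (⊤ : ℕ∞) f) : Cinf n := ⟨f, hf⟩

@[simp] theorem mk_val (f : (Fin n → ℝ) → ℂ) (hf) : (mk f hf).1 = f := rfl

@[simp] theorem add_val (f g : Cinf n) (x) : (f + g).1 x = f.1 x + g.1 x := rfl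
@[simp] theorem sub_val (f g : Cinf n) (x) : (f - g).1 x = f.1 x - g.1 x := rfl
@[simp] theorem zero_val (x) : (0 : Cinf n).1 x = 0 := rfl
@[simp] theorem smul_val (c : ℂ) (f : Cinf n) (x) : (c • f).1 x = c * f.1 x := rfl
@[simp] theorem sum_val {ι : Type*} (s : Finset ι) (f : ι → Cinf n) (x) :
    (∑ i ∈ s, f i).1 x = ∑ i ∈ s, (f i).1 x := by
  classical
  induction s using Finset.induction_on with
  | empty => simp
  | insert a s ha ih => rw [Finset.sum_insert ha, Finset.sum_insert ha, add_val, ih]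

theorem ext' {f g : Cinf n} (h : ∀ x, f.1 x = g.1 x) : f = g := Subtype.ext (funext h)

/-- Product of smooth functions. -/
def cmul (φ f : Cinf n) : Cinf n := mk (fun x => φ.1 x * f.1 x) ((cd φ).mul (cd f))

@[simp] theorem cmul_val (φ f : Cinf n) (x) : (cmul φ f).1 x = φ.1 x * f.1 x := rfl

/-- Translation. -/
def transl (a : Fin n → ℝ) (f : Cinf n) : Cinf n :=
  mk (fun x => f.1 (x + a)) ((cd f).comp (contDiff_id.add contDiff_const))

@[simp] theorem transl_val (a : Fin n → ℝ) (f : Cinf n) (x) : (transl a f).1 x = f.1 (x + a) := rfl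

/-- dot product -/
def dotc (z : Fin n → ℂ) (x : Fin n → ℝ) : ℂ := ∑ i, z i * (x i : ℂ)

theorem dotc_contDiff (z : Fin n → ℂ) : ContDiff ℝ (⊤ : ℕ∞) (dotc z) := by
  unfold dotc
  refine ContDiff.sum fun i _ => contDiff_const.mul ?_
  exact Complex.ofRealCLM.contDiff.comp (contDiff_apply ℝ ℝ i)

theorem dotc_add (z : Fin n → ℂ) (x y) : dotc z (x + y) = dotc z x + dotc z y := by
  simp [dotc, mul_add, Finset.sum_add_distrib]

theorem dotc_add' (z w : Fin n → ℂ) (x) : dotc (z + w) x = dotc z x + dotc w x := by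
  simp [dotc, add_mul, Finset.sum_add_distrib]

/-- Exponential. -/
def expo (z : Fin n → ℂ) : Cinf n :=
  mk (fun x => Complex.exp (dotc z x)) ((dotc_contDiff z).cexp)

@[simp] theorem expo_val (z : Fin n → ℂ) (x) : (expo z).1 x = Complex.exp (dotc z x) := rfl

theorem dotc_hasFDerivAt (z : Fin n → ℂ) (x) :
    fderiv ℝ (dotc z) x = ∑ i, (z i) • (Complex.ofRealCLM.comp (ContinuousLinearMap.proj (R := ℝ) i)) := by
  have : HasFDerivAt (dotc z) (∑ i, (z i) • (Complex.ofRealCLM.comp (ContinuousLinearMap.proj (R := ℝ) (φ := fun _ : Fin n => ℝ) i))) x := by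
    unfold dotc
    refine HasFDerivAt.fun_sum fun i _ => ?_
    refine HasFDerivAt.const_mul ?_ _
    exact ContinuousLinearMap.hasFDerivAt (Complex.ofRealCLM.comp (ContinuousLinearMap.proj (R := ℝ) (φ := fun _ : Fin n => ℝ) i))
  exact this.fderiv

variable [Module (MvPolynomial (Fin n) ℂ) (Cinf n)] [DAct n]

theorem X_apply (i : Fin n) (f : Cinf n) (x) :
    ((X i : MvPolynomial (Fin n) ℂ) • f : Cinf n).1 x = fderiv ℝ f.1 x (Pi.single i 1) := by
  rw [DAct.hX]

theorem C_smul (c : ℂ) (f : Cinf n) :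
    ((C c : MvPolynomial (Fin n) ℂ) • f : Cinf n) = c • f := DAct.hC c f

theorem psmul_smul (p : MvPolynomial (Fin n) ℂ) (c : ℂ) (f : Cinf n) :
    p • (c • f) = c • (p • f) := by
  rw [← C_smul, ← C_smul, smul_smul, smul_smul, mul_comm]

theorem locality (p : MvPolynomial (Fin n) ℂ) {V : Set (Fin n → ℝ)} (hV : IsOpen V) :
    ∀ {f g : Cinf n}, (∀ x ∈ V, f.1 x = g.1 x) → ∀ x ∈ V, (p • f).1 x = (p • g).1 x := by
  induction p using MvPolynomial.induction_on with
  | C a => intro f g h x hx; simp [C_smul, h x hx]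
  | add p q hp hq => intro f g h x hx; simp [add_smul, hp h x hx, hq h x hx]
  | mul_X p i hp =>
    intro f g h x hx
    rw [mul_smul, mul_smul]
    refine hp (fun y hy => ?_) x hx
    rw [X_apply, X_apply]
    have : f.1 =ᶠ[nhds y] g.1 := by
      filter_upwards [hV.mem_nhds hy] with w hw using h w hw
    rw [this.fderiv_eq]

theorem locality_zero (p : MvPolynomial (Fin n) ℂ) {V : Set (Fin n → ℝ)} (hV : IsOpen V)
    {f : Cinf n} (h : ∀ x ∈ V, f.1 x = 0) : ∀ x ∈ V, (p • f).1 x = 0 := by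
  intro x hx
  have := locality p hV (f := f) (g := 0) (fun x hx => by simp [h x hx]) x hx
  simpa using this

theorem smul_transl (p : MvPolynomial (Fin n) ℂ) (a : Fin n → ℝ) :
    ∀ f : Cinf n, p • transl a f = transl a (p • f) := by
  induction p using MvPolynomial.induction_on with
  | C c => intro f; rw [C_smul, C_smul]; rfl
  | add p q hp hq => intro f; rw [add_smul, add_smul, hp, hq]; rfl
  | mul_X p i hp =>
    intro f
    rw [mul_smul, mul_smul, ← hp]
    congr 1
    apply ext'
    intro x
    rw [X_apply, transl_val, X_apply]
    have := fderiv_comp_add_right (𝕜 := ℝ) (f := f.1) (x := x) a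
    rw [← this]; rfl

theorem smul_expo (p : MvPolynomial (Fin n) ℂ) (z : Fin n → ℂ) :
    p • expo z = (eval z p) • expo z := by
  induction p using MvPolynomial.induction_on with
  | C c => rw [C_smul]; simp
  | add p q hp hq => rw [add_smul, hp, hq, map_add, add_smul]
  | mul_X p i hp =>
    rw [mul_smul]
    have : (X i : MvPolynomial (Fin n) ℂ) • expo z = z i • expo z := by
      apply ext'
      intro x
      rw [X_apply]
      have h : HasFDerivAt (expo z).1 (Complex.exp (dotc z x) • fderiv ℝ (dotc z) x) x :=
        ((dotc_contDiff z).differentiable (by simp) x).hasFDerivAt.cexp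
      rw [h.fderiv, dotc_hasFDerivAt]
      simp only [Pi.single_apply, smul_apply, sum_apply, ContinuousLinearMap.comp_apply,
        ContinuousLinearMap.proj_apply, Complex.ofRealCLM_apply, smul_eq_mul, expo_val, smul_val]
      rw [Finset.sum_eq_single i (by intro b _ hb; simp [hb]) (by simp)]
      simp [mul_comm]
    rw [this, psmul_smul, hp, smul_smul, map_mul, eval_X, mul_comm]

theorem X_cmul (i : Fin n) (φ f : Cinf n) :
    (X i : MvPolynomial (Fin n) ℂ) • cmul φ f =
      cmul ((X i : MvPolynomial (Fin n) ℂ) • φ) f + cmul φ ((X i : MvPolynomial (Fin n) ℂ) • f) := by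
  apply ext'
  intro x
  rw [X_apply, add_val, cmul_val, cmul_val, X_apply, X_apply]
  have h := ((cdiff φ) x).hasFDerivAt.mul ((cdiff f) x).hasFDerivAt
  have h2 : fderiv ℝ (cmul φ f).1 x = _ := h.fderiv
  rw [h2]
  simp
  ring

theorem cmul_smul_c (φ f : Cinf n) (c : ℂ) : cmul φ (c • f) = c • cmul φ f := by
  apply ext'; intro x; simp; ring

theorem cmul_add (φ f g : Cinf n) : cmul φ (f + g) = cmul φ f + cmul φ g := by
  apply ext'; intro x; simp; ring

theorem free_cmul (i : Fin n) {b : MvPolynomial (Fin n) ℂ} (hb : b ∈ supported ℂ ({i}ᶜ : Set (Fin n)))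
    (φ : Cinf n) (hφ : ∀ j, j ≠ i → (X j : MvPolynomial (Fin n) ℂ) • φ = 0) (f : Cinf n) :
    b • cmul φ f = cmul φ (b • f) := by
  unfold supported at hb
  induction hb using Algebra.adjoin_induction generalizing f with
  | mem x hx =>
    obtain ⟨j, hj, rfl⟩ := hx
    rw [X_cmul, hφ j (by simpa using hj)]
    apply ext'; intro x; simp
  | algebraMap r =>
    rw [MvPolynomial.algebraMap_eq, C_smul, C_smul, cmul_smul_c]
  | add x y _ _ hx hy => rw [add_smul, add_smul, hx, hy, cmul_add]
  | mul x y _ _ hx hy => rw [mul_smul, mul_smul, hy, hx]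

/-- Matrix action. -/
def act {l k : ℕ} (M : Matrix (Fin l) (Fin k) (MvPolynomial (Fin n) ℂ)) (f : Fin k → Cinf n) :
    Fin l → Cinf n := fun i => ∑ j, M i j • f j

theorem mem_system {l k : ℕ} {M : Matrix (Fin l) (Fin k) (MvPolynomial (Fin n) ℂ)}
    {f : Fin k → Cinf n} : f ∈ system M ↔ act M f = 0 := by
  simp [system, act, funext_iff]

theorem act_act {l k m : ℕ} (M : Matrix (Fin l) (Fin k) (MvPolynomial (Fin n) ℂ))
    (N : Matrix (Fin k) (Fin m) (MvPolynomial (Fin n) ℂ)) (f : Fin m → Cinf n) :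
    act M (act N f) = act (M * N) f := by
  funext i
  simp only [act, Matrix.mul_apply, Finset.smul_sum, Finset.sum_smul, smul_smul]
  rw [Finset.sum_comm]

theorem act_add {l k : ℕ} (M : Matrix (Fin l) (Fin k) (MvPolynomial (Fin n) ℂ))
    (f g : Fin k → Cinf n) : act M (f + g) = act M f + act M g := by
  funext i; simp [act, smul_add, Finset.sum_add_distrib]

theorem act_sub {l k : ℕ} (M : Matrix (Fin l) (Fin k) (MvPolynomial (Fin n) ℂ))
    (f g : Fin k → Cinf n) : act M (f - g) = act M f - act M g := by
  funext i; simp [act, smul_sub, Finset.sum_sub_distrib]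

theorem act_psmul {l k : ℕ} (M : Matrix (Fin l) (Fin k) (MvPolynomial (Fin n) ℂ))
    (p : MvPolynomial (Fin n) ℂ) (f : Fin k → Cinf n) : act M (p • f) = p • act M f := by
  funext i; simp only [act, Pi.smul_apply, Finset.smul_sum, smul_smul, mul_comm]

theorem act_csmul {l k : ℕ} (M : Matrix (Fin l) (Fin k) (MvPolynomial (Fin n) ℂ))
    (c : ℂ) (f : Fin k → Cinf n) : act M (c • f) = c • act M f := by
  funext i; simp only [act, Pi.smul_apply, Finset.smul_sum, psmul_smul]

theorem act_zero {l k : ℕ} (M : Matrix (Fin l) (Fin k) (MvPolynomial (Fin n) ℂ)) :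
    act M (0 : Fin k → Cinf n) = 0 := by
  funext i; simp [act]

theorem act_scalar {l : ℕ} (b : MvPolynomial (Fin n) ℂ) (f : Fin l → Cinf n) :
    act (b • (1 : Matrix (Fin l) (Fin l) (MvPolynomial (Fin n) ℂ))) f = b • f := by
  funext i
  simp [act, Matrix.one_apply]

theorem act_local {l k : ℕ} (M : Matrix (Fin l) (Fin k) (MvPolynomial (Fin n) ℂ))
    {V : Set (Fin n → ℝ)} (hV : IsOpen V) {f g : Fin k → Cinf n}
    (h : ∀ x ∈ V, ∀ j, (f j).1 x = (g j).1 x) : ∀ x ∈ V, ∀ i, (act M f i).1 x = (act M g i).1 x := by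
  intro x hx i
  simp only [act, sum_val]
  exact Finset.sum_congr rfl fun j _ => locality _ hV (fun y hy => h y hy j) x hx

end basic

end CMH

namespace CMH

open MvPolynomial

/-- The polynomial ring. -/
abbrev PA (n : ℕ) := MvPolynomial (Fin n) ℂ

section sums

variable {n : ℕ}

/-- Coordinate functional. -/
def coordE (j : Fin n) : (Fin n → ℝ) →L[ℝ] ℂ :=
  Complex.ofRealCLM.comp (ContinuousLinearMap.proj (R := ℝ) (φ := fun _ : Fin n => ℝ) j)

theorem coordE_apply (j : Fin n) (x : Fin n → ℝ) : coordE j x = (x j : ℂ) := rfl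

theorem coordE_norm (j : Fin n) : ‖coordE j‖ ≤ 1 := by
  refine ContinuousLinearMap.opNorm_le_bound _ zero_le_one fun x => ?_
  rw [coordE_apply, one_mul, Complex.norm_real]
  exact norm_le_pi_norm x j

theorem clm_eq_sum (T : (Fin n → ℝ) →L[ℝ] ℂ) : T = ∑ j, T (Pi.single j 1) • coordE j := by
  ext x
  have hx : x = ∑ j, x j • (Pi.single j 1 : Fin n → ℝ) := by
    funext i
    simp [Finset.sum_apply, Pi.single_apply]
  conv_lhs => rw [hx]
  rw [map_sum]
  simp only [sum_apply, smul_apply, coordE_apply, smul_eq_mul]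
  refine Finset.sum_congr rfl fun j _ => ?_
  rw [map_smul, Complex.real_smul, mul_comm]

variable [Module (MvPolynomial (Fin n) ℂ) (Cinf n)] [DAct n]

theorem fderiv_eq_sum (f : Cinf n) (x) :
    fderiv ℝ f.1 x = ∑ j, ((X j : MvPolynomial (Fin n) ℂ) • f).1 x • coordE j := by
  rw [clm_eq_sum (fderiv ℝ f.1 x)]
  simp only [X_apply]

theorem sum_lemma {ι : Type*} (v : ι → Cinf n)
    (h : ∀ (p : MvPolynomial (Fin n) ℂ) (r : ℝ), ∃ β : ι → ℝ, Summable β ∧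
      ∀ i x, ‖x‖ < r → ‖(p • v i).1 x‖ ≤ β i) :
    ∃ U : Cinf n, ∀ (p : MvPolynomial (Fin n) ℂ) x,
      HasSum (fun i => (p • v i).1 x) ((p • U).1 x) := by
  let G : MvPolynomial (Fin n) ℂ → (Fin n → ℝ) → ℂ := fun p x => ∑' i, (p • v i).1 x
  have hs : ∀ (p : PA n) x, Summable fun i => (p • v i).1 x := by
    intro p x
    obtain ⟨β, hβ, hb⟩ := h p (‖x‖ + 1)
    exact Summable.of_norm_bounded hβ fun i => hb i x (by linarith)
  have hd : ∀ (p : PA n) x, HasFDerivAt (G p) (∑ j, G (X j * p) x • coordE j) x := by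
    intro p x
    choose β hβ hb using fun j : Fin n => h (X j * p) (‖x‖ + 1)
    have key := hasFDerivAt_tsum_of_isPreconnected (𝕜 := ℝ)
      (u := fun i => ∑ j, β j i) (f := fun i => (p • v i).1)
      (f' := fun i y => fderiv ℝ (p • v i).1 y)
      (s := Metric.ball (0 : Fin n → ℝ) (‖x‖ + 1)) (x₀ := x) (x := x)
      (summable_sum fun j _ => hβ j) Metric.isOpen_ball
      (convex_ball _ _).isPreconnected
      (fun i y _ => (cdiff (p • v i) y).hasFDerivAt)
      (by
        intro i y hy
        rw [fderiv_eq_sum]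
        refine (norm_sum_le _ _).trans (Finset.sum_le_sum fun j _ => ?_)
        rw [norm_smul, smul_smul]
        calc _ ≤ ‖((X j * p) • v i).1 y‖ * 1 := by
              gcongr; exact coordE_norm j
          _ ≤ β j i := by
              rw [mul_one]; exact hb j i y (by simpa using hy))
      (by simp) (hs p x) (by simp)
    suffices key2 : ∑' i, fderiv ℝ (p • v i).1 x = ∑ j, G (X j * p) x • coordE j by
      rw [← key2]; exact key
    have e : ∀ i, fderiv ℝ (p • v i).1 x = ∑ j, (((X j : PA n) * p) • v i).1 x • coordE j := by
      intro i; rw [fderiv_eq_sum]; simp only [mul_smul]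
    rw [tsum_congr e]
    rw [Summable.tsum_finsetSum]
    · refine Finset.sum_congr rfl fun j _ => ?_
      rw [Summable.tsum_smul_const (hs _ _)]
    · intro j _
      exact (hs _ _).smul_const _
  have hc : ∀ (m : ℕ) (p : PA n), ContDiff ℝ m (G p) := by
    intro m
    induction m with
    | zero =>
      intro p
      rw [Nat.cast_zero, contDiff_zero]
      exact continuous_iff_continuousAt.2 fun x => (hd p x).continuousAt
    | succ m ih =>
      intro p
      rw [Nat.cast_add, Nat.cast_one, contDiff_succ_iff_fderiv]
      refine ⟨fun x => (hd p x).differentiableAt, by simp, ?_⟩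
      have : fderiv ℝ (G p) = fun x => ∑ j, G (X j * p) x • coordE j := by
        funext x; exact (hd p x).fderiv
      rw [this]
      exact ContDiff.sum fun j _ => (ih _).smul contDiff_const
  have hc' : ∀ p : PA n, ContDiff ℝ (⊤ : ℕ∞) (G p) := fun p => contDiff_infty.2 fun m => hc m p
  have hG : ∀ p q : PA n, p • mk (G q) (hc' q) = mk (G (p * q)) (hc' _) := by
    intro p
    induction p using MvPolynomial.induction_on with
    | C c =>
      intro q; rw [C_smul]; apply ext'; intro x
      rw [smul_val, mk_val, mk_val]
      simp only [G, mul_smul, C_smul, smul_val]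
      rw [tsum_mul_left]
    | add p p' hp hp' =>
      intro q; rw [add_smul, hp, hp']; apply ext'; intro x
      rw [add_val, mk_val, mk_val, mk_val]
      simp only [G, add_mul, add_smul, add_val]
      rw [Summable.tsum_add (hs _ _) (hs _ _)]
    | mul_X p i hp =>
      intro q
      have : (X i : MvPolynomial (Fin n) ℂ) • mk (G q) (hc' q) = mk (G (X i * q)) (hc' _) := by
        apply ext'; intro x
        rw [X_apply, mk_val, mk_val, (hd q x).fderiv]
        simp only [sum_apply, smul_apply, coordE_apply, Pi.single_apply]
        rw [Finset.sum_eq_single i (by intro b _ hb; simp [hb]) (by simp)]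
        simp
      rw [mul_smul, this, hp, mul_assoc]
  refine ⟨mk (G 1) (hc' 1), fun p x => ?_⟩
  rw [hG, mul_one]
  exact (hs p x).hasSum

end sums

end CMH

namespace CMH

open MvPolynomial MeasureTheory

section fourier

theorem int_per {n : ℕ} (H : (Fin n → ℝ) → ℂ) (hH : ContDiff ℝ (⊤ : ℕ∞) H) (i : Fin n)
    (hp : ∀ y, H (y + Pi.single i 1) = H y) :
    ∫ y in Set.Icc (0 : Fin n → ℝ) 1, fderiv ℝ H y (Pi.single i 1) = 0 := by
  cases n with
  | zero => exact i.elim0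
  | succ n =>
    have hc : Continuous (fun y => fderiv ℝ H y (Pi.single i 1)) :=
      (hH.continuous_fderiv (by simp)).clm_apply continuous_const
    have key := integral_divergence_of_hasFDerivAt_off_countable' (E := ℂ) (n := n) 0 1
      (zero_le_one) (fun j => if j = i then H else fun _ => 0)
      (fun j y => if j = i then fderiv ℝ H y else 0) ∅ Set.countable_empty
      (by
        intro j
        split_ifs
        · exact hH.continuous.continuousOn
        · exact continuousOn_const)
      (by
        intro x _ j
        split_ifs
        · exact (hH.differentiable (by simp) x).hasFDerivAt
        · exact hasFDerivAt_const _ _)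
      (by
        have : (fun x => ∑ j, (if j = i then fderiv ℝ H x else 0) (Pi.single j 1)) =
            fun x => fderiv ℝ H x (Pi.single i 1) := by
          funext x
          rw [Finset.sum_eq_single i (by intro b _ hb; simp [hb]) (by simp)]
          simp
        rw [this]
        exact hc.continuousOn.integrableOn_compact isCompact_Icc)
    have e : ∀ x, (∑ j, (if j = i then fderiv ℝ H x else 0) (Pi.single j 1)) =
            fderiv ℝ H x (Pi.single i 1) := by
      intro x
      rw [Finset.sum_eq_single i (by intro b _ hb; simp [hb]) (by simp)]
      simp
    simp only [e] at key
    rw [key]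
    refine Finset.sum_eq_zero fun j _ => ?_
    by_cases hj : j = i
    · subst hj
      simp only [if_true]
      rw [sub_eq_zero]
      refine integral_congr_ae (Filter.Eventually.of_forall fun x => ?_)
      simp only
      rw [← hp (j.insertNth ((0 : Fin (n + 1) → ℝ) j) x)]
      congr 1
      funext l
      refine Fin.succAboveCases j ?_ (fun a => ?_) l <;> simp
    · simp [hj]

theorem torus_cont {n : ℕ} (h : (Fin n → ℝ) → ℂ) (hc : Continuous h)
    (hp : ∀ (m : Fin n → ℤ) y, h (y + fun i => (m i : ℝ)) = h y) :
    ∃ g : C(UnitAddTorus (Fin n), ℂ), ∀ y : Fin n → ℝ, g (fun i => (y i : UnitAddCircle)) = h y := by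
  have hq : IsOpenQuotientMap (Pi.map (fun (_ : Fin n) (x : ℝ) => (x : UnitAddCircle))) :=
    IsOpenQuotientMap.piMap fun i => QuotientAddGroup.isOpenQuotientMap_mk
  let φ : C(Fin n → ℝ, UnitAddTorus (Fin n)) := ⟨_, hq.continuous⟩
  have hφ : Topology.IsQuotientMap φ := hq.isQuotientMap
  have hf : Function.FactorsThrough (⟨h, hc⟩ : C(Fin n → ℝ, ℂ)) φ := by
    intro a b hab
    have : ∀ i, ∃ m : ℤ, a i = b i + m := by
      intro i
      have h1 : ((a i : ℝ) : UnitAddCircle) = (b i : ℝ) := congrFun hab i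
      have h2 : ((a i - b i : ℝ) : UnitAddCircle) = 0 := by
        rw [AddCircle.coe_sub, h1, sub_self]
      obtain ⟨m, hm⟩ := (AddCircle.coe_eq_zero_iff _).1 h2
      exact ⟨m, by simp at hm; linarith⟩
    choose m hm using this
    have : a = b + fun i => (m i : ℝ) := funext hm
    show h a = h b
    rw [this, hp]
  refine ⟨hφ.lift ⟨h, hc⟩ hf, ?_⟩
  intro y
  exact DFunLike.congr_fun (hφ.lift_comp ⟨h, hc⟩ hf) y

theorem mFourier_coe {n : ℕ} (k : Fin n → ℤ) (y : Fin n → ℝ) :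
    UnitAddTorus.mFourier k (fun i => (y i : UnitAddCircle)) =
      Complex.exp (∑ i, 2 * Real.pi * Complex.I * k i * y i) := by
  simp only [UnitAddTorus.mFourier, ContinuousMap.coe_mk, Complex.exp_sum]
  refine Finset.prod_congr rfl fun i _ => ?_
  rw [fourier_coe_apply]
  simp

theorem cube_eq {n : ℕ} : {x : Fin n → ℝ | ∀ i, x i ∈ Set.Ioc ((0 : Fin n → ℝ) i) ((0 : Fin n → ℝ) i + 1)} =ᵐ[volume]
    Set.Icc (0 : Fin n → ℝ) 1 := by
  have h := Measure.univ_pi_Ioc_ae_eq_Icc (μ := fun _ : Fin n => (volume : Measure ℝ))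
    (f := (0 : Fin n → ℝ)) (g := 1)
  rw [← volume_pi] at h
  have e : {x : Fin n → ℝ | ∀ i, x i ∈ Set.Ioc ((0 : Fin n → ℝ) i) ((0 : Fin n → ℝ) i + 1)} =
      Set.univ.pi fun i => Set.Ioc ((0 : Fin n → ℝ) i) ((1 : Fin n → ℝ) i) := by
    ext x
    simp
  rw [e]
  exact h

theorem fourier_inv {n : ℕ} (h : (Fin n → ℝ) → ℂ) (hc : Continuous h)
    (hp : ∀ (m : Fin n → ℤ) y, h (y + fun i => (m i : ℝ)) = h y)
    (hs : Summable fun k : Fin n → ℤ => ∫ y in Set.Icc (0 : Fin n → ℝ) 1,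
      Complex.exp (∑ i, 2 * Real.pi * Complex.I * ((-k) i : ℤ) * y i) * h y) (y : Fin n → ℝ) :
    HasSum (fun k : Fin n → ℤ => (∫ y in Set.Icc (0 : Fin n → ℝ) 1,
      Complex.exp (∑ i, 2 * Real.pi * Complex.I * ((-k) i : ℤ) * y i) * h y) *
        Complex.exp (∑ i, 2 * Real.pi * Complex.I * k i * y i)) (h y) := by
  obtain ⟨g, hg⟩ := torus_cont h hc hp
  have e : ∀ k, UnitAddTorus.mFourierCoeff g k = ∫ y in Set.Icc (0 : Fin n → ℝ) 1,
      Complex.exp (∑ i, 2 * Real.pi * Complex.I * ((-k) i : ℤ) * y i) * h y := by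
    intro k
    rw [UnitAddTorus.mFourierCoeff_eq_integral _ _ 0, setIntegral_congr_set cube_eq]
    refine integral_congr_ae (Filter.Eventually.of_forall fun x => ?_)
    simp only
    rw [mFourier_coe, hg, smul_eq_mul]
  have := UnitAddTorus.hasSum_mFourier_series_apply_of_summable (f := g)
    (by rw [show UnitAddTorus.mFourierCoeff g = _ from funext e]; exact hs)
    (fun i => (y i : UnitAddCircle))
  rw [hg] at this
  simpa only [e, mFourier_coe, smul_eq_mul] using this

end fourier

end CMH

namespace CMH

open MvPolynomial MeasureTheory

section quasi

variable {n : ℕ}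

/-- Lattice vector. -/
def lat (L : ℝ) (m : Fin n → ℤ) : Fin n → ℝ := fun i => L * m i

/-- Real dot product. -/
def rdot (μ x : Fin n → ℝ) : ℝ := ∑ i, μ i * x i

theorem rdot_add (μ x y : Fin n → ℝ) : rdot μ (x + y) = rdot μ x + rdot μ y := by
  simp [rdot, mul_add, Finset.sum_add_distrib]

theorem rdot_continuous (μ : Fin n → ℝ) : Continuous (rdot μ) := by
  unfold rdot; fun_prop

/-- Quasi-periodicity. -/
def QP (L : ℝ) (μ : Fin n → ℝ) (f : Cinf n) : Prop :=
  ∀ (m : Fin n → ℤ) x, f.1 (x + lat L m) = (Real.exp (rdot μ (lat L m)) : ℂ) * f.1 x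

theorem QP.add {L : ℝ} {μ : Fin n → ℝ} {f g : Cinf n} (hf : QP L μ f) (hg : QP L μ g) :
    QP L μ (f + g) := by
  intro m x; simp only [add_val, hf m x, hg m x, mul_add]

theorem QP.sub {L : ℝ} {μ : Fin n → ℝ} {f g : Cinf n} (hf : QP L μ f) (hg : QP L μ g) :
    QP L μ (f - g) := by
  intro m x; simp only [sub_val, hf m x, hg m x, mul_sub]

theorem QP.sum {L : ℝ} {μ : Fin n → ℝ} {ι : Type*} {s : Finset ι} {f : ι → Cinf n}
    (hf : ∀ i ∈ s, QP L μ (f i)) : QP L μ (∑ i ∈ s, f i) := by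
  intro m x; simp only [sum_val, Finset.mul_sum]
  exact Finset.sum_congr rfl fun i hi => hf i hi m x

theorem QP.csmul {L : ℝ} {μ : Fin n → ℝ} {f : Cinf n} (hf : QP L μ f) (c : ℂ) :
    QP L μ (c • f) := by
  intro m x; simp only [smul_val, hf m x]; ring

theorem QP.cmul {L : ℝ} {μ : Fin n → ℝ} {φ f : Cinf n} (hφ : ∀ m x, φ.1 (x + lat L m) = φ.1 x)
    (hf : QP L μ f) : QP L μ (cmul φ f) := by
  intro m x; simp only [cmul_val, hf m x, hφ m x]; ring

/-- Frequencies. -/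
def zk (L : ℝ) (μ : Fin n → ℝ) (k : Fin n → ℤ) : Fin n → ℂ :=
  fun i => 2 * Real.pi * Complex.I * k i / L + μ i

theorem dotc_zk (L : ℝ) (hL : L ≠ 0) (μ : Fin n → ℝ) (k : Fin n → ℤ) (y : Fin n → ℝ) :
    dotc (zk L μ k) (L • y) = (∑ i, 2 * Real.pi * Complex.I * k i * y i) + rdot μ (L • y) := by
  have hL' : (L : ℂ) ≠ 0 := by exact_mod_cast hL
  simp only [dotc, zk, rdot, Complex.ofReal_sum, ← Finset.sum_add_distrib]
  refine Finset.sum_congr rfl fun i _ => ?_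
  simp only [Pi.smul_apply, smul_eq_mul, Complex.ofReal_mul]
  field_simp

theorem norm_expo_zk (L : ℝ) (μ : Fin n → ℝ) (k : Fin n → ℤ) (x : Fin n → ℝ) :
    ‖Complex.exp (dotc (zk L μ k) x)‖ = Real.exp (rdot μ x) := by
  rw [Complex.norm_exp]
  congr 1
  simp only [dotc, zk, rdot, Complex.re_sum]
  refine Finset.sum_congr rfl fun i _ => ?_
  have : (2 * Real.pi * Complex.I * k i / L : ℂ) = ((2 * Real.pi * k i / L : ℝ) : ℂ) * Complex.I := by
    push_cast; ring
  rw [this]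
  simp

theorem dotc_neg (z : Fin n → ℂ) (x) : dotc (-z) x = - dotc z x := by
  simp [dotc]

/-- Fourier coefficients. -/
def cf (L : ℝ) (μ : Fin n → ℝ) (f : Cinf n) (k : Fin n → ℤ) : ℂ :=
  ∫ y in Set.Icc (0 : Fin n → ℝ) 1, f.1 (L • y) * Complex.exp (-dotc (zk L μ k) (L • y))

theorem cf_integrable (L : ℝ) (μ : Fin n → ℝ) (f : Cinf n) (k : Fin n → ℤ) :
    IntegrableOn (fun y : Fin n → ℝ => f.1 (L • y) * Complex.exp (-dotc (zk L μ k) (L • y)))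
      (Set.Icc (0 : Fin n → ℝ) 1) := by
  refine ContinuousOn.integrableOn_compact isCompact_Icc (Continuous.continuousOn ?_)
  have h1 := ccont f
  have h2 := (dotc_contDiff (zk L μ k)).continuous
  fun_prop

theorem cf_bound (L : ℝ) (μ : Fin n → ℝ) (f : Cinf n) (k : Fin n → ℤ) (B : ℝ)
    (hB : ∀ x, ‖f.1 x‖ ≤ B * Real.exp (rdot μ x)) : ‖cf L μ f k‖ ≤ B := by
  have hv : volume.real (Set.Icc (0 : Fin n → ℝ) 1) = 1 := by
    rw [Measure.real, Real.volume_Icc_pi]; simp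
  have := norm_setIntegral_le_of_norm_le_const (μ := volume) (s := Set.Icc (0 : Fin n → ℝ) 1)
    (f := fun y => f.1 (L • y) * Complex.exp (-dotc (zk L μ k) (L • y))) (C := B)
    (by exact isCompact_Icc.measure_lt_top) (by
      intro y _
      rw [norm_mul, Complex.exp_neg, norm_inv, norm_expo_zk]
      rw [← div_eq_mul_inv, div_le_iff₀ (Real.exp_pos _)]
      exact hB _)
  rw [hv, mul_one] at this
  exact this

theorem cf_inv (L : ℝ) (hL : L ≠ 0) (μ : Fin n → ℝ) (f : Cinf n) (hf : QP L μ f)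
    (hs : Summable (cf L μ f)) (x : Fin n → ℝ) :
    HasSum (fun k => cf L μ f k * Complex.exp (dotc (zk L μ k) x)) (f.1 x) := by
  have hcf : ∀ k, cf L μ f k = ∫ y in Set.Icc (0 : Fin n → ℝ) 1,
      Complex.exp (∑ i, 2 * Real.pi * Complex.I * ((-k) i : ℤ) * y i) *
        (f.1 (L • y) * Complex.exp (-rdot μ (L • y))) := by
    intro k
    refine integral_congr_ae (Filter.Eventually.of_forall fun y => ?_)
    simp only
    rw [dotc_zk L hL, neg_add, Complex.exp_add, ← Finset.sum_neg_distrib]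
    simp only [Pi.neg_apply, Int.cast_neg, mul_neg, neg_mul]
    ring
  have h := fourier_inv (fun y => f.1 (L • y) * Complex.exp (-rdot μ (L • y)))
    (by
      have h1 := ccont f
      have h2 := rdot_continuous μ
      fun_prop)
    (by
      intro m y
      have e : L • (y + fun i => (m i : ℝ)) = L • y + lat L m := by
        funext i; simp [lat, mul_add]
      rw [e, hf m, rdot_add]
      push_cast
      rw [neg_add, Complex.exp_add, Complex.exp_neg ((rdot μ (lat L m) : ℝ) : ℂ)]
      field_simp [Complex.exp_ne_zero])
    (by
      refine hs.congr fun k => ?_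
      rw [hcf k]) (L⁻¹ • x)
  have h2 := h.mul_right (Complex.exp (rdot μ x))
  have e : L • L⁻¹ • x = x := by rw [smul_smul, mul_inv_cancel₀ hL, one_smul]
  have e2 : f.1 x * Complex.exp (-rdot μ x) * Complex.exp (rdot μ x) = f.1 x := by
    rw [mul_assoc, ← Complex.exp_add, neg_add_cancel, Complex.exp_zero, mul_one]
  rw [e, e2] at h2
  have e3 : ∀ k, cf L μ f k * Complex.exp (dotc (zk L μ k) x) = cf L μ f k *
      Complex.exp (∑ i, 2 * Real.pi * Complex.I * k i * (L⁻¹ • x) i) *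
        Complex.exp (rdot μ x) := by
    intro k
    rw [mul_assoc, ← Complex.exp_add]
    conv_lhs => rw [← e]
    rw [dotc_zk L hL, e]
  simp only [← hcf] at h2
  rw [show (fun k => cf L μ f k * Complex.exp (dotc (zk L μ k) x)) = _ from funext e3]
  exact h2

variable [Module (MvPolynomial (Fin n) ℂ) (Cinf n)] [DAct n]

theorem QP.psmul {L : ℝ} {μ : Fin n → ℝ} {f : Cinf n} (hf : QP L μ f) (p : PA n) :
    QP L μ (p • f) := by
  intro m x
  have h : transl (lat L m) f = (Real.exp (rdot μ (lat L m)) : ℂ) • f := by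
    apply ext'; intro x; rw [transl_val, hf m x, smul_val]
  rw [← transl_val, ← smul_transl, h, psmul_smul, smul_val]

theorem cf_X (L : ℝ) (hL : L ≠ 0) (μ : Fin n → ℝ) (f : Cinf n) (hf : QP L μ f) (k : Fin n → ℤ)
    (i : Fin n) : cf L μ ((X i : PA n) • f) k = zk L μ k i * cf L μ f k := by
  set z := zk L μ k with hz
  set h : Cinf n := CMH.cmul f (expo (-z)) with hh
  have hc : ContDiff ℝ (⊤ : ℕ∞) (fun y : Fin n → ℝ => h.1 (L • y)) :=
    (cd h).comp (contDiff_const_smul L)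
  have key := int_per _ hc i (by
    intro y
    have e : L • (y + Pi.single i 1) = L • y + lat L (Pi.single i (1 : ℤ)) := by
      funext j
      by_cases hj : j = i
      · subst hj; simp [lat, mul_add]
      · simp [lat, mul_add, hj]
    have hdz := dotc_zk L hL μ k (Pi.single i (1 : ℝ))
    have el : L • (Pi.single i (1 : ℝ) : Fin n → ℝ) = lat L (Pi.single i (1 : ℤ)) := by
      funext j
      by_cases hj : j = i
      · subst hj; simp [lat, mul_add]
      · simp [lat, mul_add, hj]
    rw [e, hh, cmul_val, cmul_val, hf, expo_val, expo_val, dotc_add]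
    have e4 : dotc (-z) (lat L (Pi.single i (1 : ℤ))) =
        - (k i * (2 * Real.pi * Complex.I)) - rdot μ (lat L (Pi.single i (1 : ℤ))) := by
      rw [dotc_neg, ← el, hdz]
      rw [Finset.sum_eq_single i (by intro b _ hb; simp [hb]) (by simp)]
      simp; ring
    rw [e4, sub_eq_add_neg, Complex.exp_add, Complex.exp_add, Complex.exp_neg (k i * _),
      Complex.exp_int_mul_two_pi_mul_I, Complex.exp_neg]
    push_cast
    field_simp [Complex.exp_ne_zero])
  have hd : ∀ y : Fin n → ℝ, fderiv ℝ (fun y : Fin n → ℝ => h.1 (L • y)) y (Pi.single i 1) =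
      L * (((X i : PA n) • f).1 (L • y) * Complex.exp (-dotc z (L • y)) -
        z i * (f.1 (L • y) * Complex.exp (-dotc z (L • y)))) := by
    intro y
    have h1 : HasFDerivAt (fun y : Fin n → ℝ => h.1 (L • y))
        ((fderiv ℝ h.1 (L • y)).comp (L • ContinuousLinearMap.id ℝ (Fin n → ℝ))) y :=
      (cdiff h (L • y)).hasFDerivAt.comp y ((hasFDerivAt_id y).const_smul L)
    rw [h1.fderiv]
    simp only [ContinuousLinearMap.comp_apply, smul_apply,
      ContinuousLinearMap.id_apply, map_smul]
    rw [← X_apply, hh, X_cmul, smul_expo]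
    simp only [add_val, cmul_val, smul_val, expo_val, eval_X, dotc_neg, Pi.neg_apply,
      Complex.real_smul]
    ring
  simp only [hd] at key
  rw [integral_const_mul, integral_sub, integral_const_mul] at key
  · have hL' : (L : ℂ) ≠ 0 := by exact_mod_cast hL
    have := (mul_eq_zero.1 key).resolve_left hL'
    exact sub_eq_zero.1 this
  · exact cf_integrable L μ _ k
  · exact (cf_integrable L μ f k).const_mul _

theorem cf_csmul (L : ℝ) (μ : Fin n → ℝ) (f : Cinf n) (k : Fin n → ℤ) (c : ℂ) :
    cf L μ (c • f) k = c * cf L μ f k := by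
  unfold cf
  rw [← integral_const_mul]
  simp only [smul_val, mul_assoc]

theorem cf_add (L : ℝ) (μ : Fin n → ℝ) (f g : Cinf n) (k : Fin n → ℤ) :
    cf L μ (f + g) k = cf L μ f k + cf L μ g k := by
  unfold cf
  rw [← integral_add (cf_integrable L μ f k) (cf_integrable L μ g k)]
  simp only [add_val, add_mul]

theorem cf_smul (L : ℝ) (hL : L ≠ 0) (μ : Fin n → ℝ) (k : Fin n → ℤ) (p : PA n) :
    ∀ f : Cinf n, QP L μ f → cf L μ (p • f) k = eval (zk L μ k) p * cf L μ f k := by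
  induction p using MvPolynomial.induction_on with
  | C c => intro f _; rw [C_smul, cf_csmul]; simp
  | add p q hp hq => intro f hf; rw [add_smul, cf_add, hp f hf, hq f hf, map_add, add_mul]
  | mul_X p i hp =>
    intro f hf
    rw [mul_smul, hp _ (hf.psmul _), cf_X L hL μ f hf, map_mul, eval_X, mul_assoc]

theorem wt_pow_le (k : Fin n → ℤ) (N : ℕ) :
    (1 + ‖k‖) ^ N ≤ 2 ^ N * (1 + ∑ i, ‖k i‖ ^ N) := by
  have h0 : ∀ a : ℝ, 0 ≤ a → (1 + a) ^ N ≤ 2 ^ N * (1 + a ^ N) := by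
    intro a ha
    have h1 := add_pow_le (zero_le_one) ha N
    rw [one_pow] at h1
    refine h1.trans ?_
    gcongr
    · norm_num
    · omega
  rcases isEmpty_or_nonempty (Fin n) with he | hne
  · have : ‖k‖ = 0 := by
      rw [norm_eq_zero]; exact Subsingleton.elim _ _
    rw [this]
    simp
    exact one_le_pow₀ (by norm_num)
  · obtain ⟨i, hi⟩ := Finite.exists_max (fun i => ‖k i‖)
    have h1 : ‖k‖ ≤ ‖k i‖ := (pi_norm_le_iff_of_nonneg (norm_nonneg _)).2 hi
    refine (h0 _ (norm_nonneg _)).trans ?_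
    gcongr
    refine (pow_le_pow_left₀ (norm_nonneg _) h1 N).trans ?_
    exact Finset.single_le_sum (f := fun i => ‖k i‖ ^ N) (fun j _ => by positivity) (Finset.mem_univ i)

theorem k_le_zk (L : ℝ) (hL : 0 < L) (μ : Fin n → ℝ) (k : Fin n → ℤ) (i : Fin n) :
    ‖k i‖ ≤ L * ‖zk L μ k i‖ := by
  have h1 : |(zk L μ k i).im| ≤ ‖zk L μ k i‖ := Complex.abs_im_le_norm _
  have : (2 * Real.pi * Complex.I * k i / L : ℂ) = ((2 * Real.pi * k i / L : ℝ) : ℂ) * Complex.I := by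
    push_cast; ring
  have h2 : (zk L μ k i).im = 2 * Real.pi * k i / L := by
    unfold zk; rw [this]; simp
  rw [h2, abs_div, abs_mul, abs_of_pos hL, abs_of_pos (by positivity : 0 < 2 * Real.pi),
    div_le_iff₀ hL] at h1
  have h3 : ‖k i‖ = |(k i : ℝ)| := by rw [Int.norm_eq_abs]
  rw [h3, mul_comm L]
  refine le_trans ?_ h1
  have := Real.pi_gt_three
  nlinarith [abs_nonneg (k i : ℝ)]

theorem cf_decay (L : ℝ) (hL : 0 < L) (μ : Fin n → ℝ) (k : Fin n → ℤ) (f : Cinf n) (hf : QP L μ f)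
    (N : ℕ) : (1 + ‖k‖) ^ N * ‖cf L μ f k‖ ≤
      2 ^ N * (‖cf L μ f k‖ + ∑ i, L ^ N * ‖cf L μ (((X i : PA n) ^ N) • f) k‖) := by
  calc _ ≤ 2 ^ N * (1 + ∑ i, ‖k i‖ ^ N) * ‖cf L μ f k‖ := by
        gcongr; exact wt_pow_le k N
    _ = 2 ^ N * (‖cf L μ f k‖ + ∑ i, ‖k i‖ ^ N * ‖cf L μ f k‖) := by
        rw [← Finset.sum_mul]; ring
    _ ≤ _ := by
        refine mul_le_mul_of_nonneg_left (add_le_add le_rfl (Finset.sum_le_sum fun i _ => ?_)) (by positivity)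
        rw [cf_smul L hL.ne' μ k _ f hf, map_pow, eval_X, norm_mul, norm_pow, ← mul_assoc, ← mul_pow]
        gcongr
        exact k_le_zk L hL μ k i

theorem wt_summable : Summable fun k : Fin n → ℤ => ((1 + ‖k‖) ^ (2 * n))⁻¹ := by
  have h1 : Summable fun m : ℤ => ((1 + ‖m‖) ^ 2)⁻¹ := by
    have h0 : Summable fun m : ℕ => (((m : ℝ) + 1) ^ 2)⁻¹ := by
      have := (summable_nat_add_iff 1).2 (Real.summable_nat_pow_inv.2 (by norm_num : 1 < 2))
      simpa using this
    refine Summable.of_nat_of_neg ?_ ?_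
    · refine h0.congr fun m => ?_
      rw [Int.norm_eq_abs]; simp [add_comm]
    · refine h0.congr fun m => ?_
      rw [Int.norm_eq_abs]; simp [add_comm]
  have h2 : ∀ n : ℕ, Summable fun k : Fin n → ℤ => ∏ i, ((1 + ‖k i‖) ^ 2)⁻¹ := by
    intro n
    induction n with
    | zero => exact Summable.of_finite
    | succ n ih =>
      have := h1.mul_of_nonneg ih (fun _ => by positivity) (fun _ => Finset.prod_nonneg fun _ _ => by positivity)
      rw [← (Fin.consEquiv (fun _ : Fin (n + 1) => ℤ)).summable_iff]
      refine this.congr fun x => ?_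
      simp [Fin.prod_univ_succ, Fin.consEquiv, mul_comm]
  refine Summable.of_nonneg_of_le (fun _ => by positivity) (fun k => ?_) (h2 n)
  rw [Finset.prod_inv_distrib, Finset.prod_pow, pow_mul', ]
  gcongr
  calc ∏ i, (1 + ‖k i‖) ≤ ∏ i : Fin n, (1 + ‖k‖) :=
        Finset.prod_le_prod (fun _ _ => by positivity) fun i _ => by
          gcongr; exact norm_le_pi_norm k i
    _ = _ := by simp

end quasi

end CMH

namespace CMH

open MvPolynomial MeasureTheory

section fam

/-- Polynomially bounded in `s`, uniformly in the index. -/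
def PB {ι : Type*} (a : ι → ℕ → ℝ) : Prop :=
  ∃ (C : ℝ) (N : ℕ), 0 ≤ C ∧ ∀ i s, a i s ≤ C * (1 + (s : ℝ)) ^ N

theorem PB.mono {ι : Type*} {a b : ι → ℕ → ℝ} (hb : PB b) (h : ∀ i s, a i s ≤ b i s) : PB a := by
  obtain ⟨C, N, hC, hN⟩ := hb
  exact ⟨C, N, hC, fun i s => (h i s).trans (hN i s)⟩

theorem PB.add {ι : Type*} {a b : ι → ℕ → ℝ} (ha : PB a) (hb : PB b) :
    PB (fun i s => a i s + b i s) := by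
  obtain ⟨C, N, hC, hN⟩ := ha
  obtain ⟨C', N', hC', hN'⟩ := hb
  refine ⟨C + C', N + N', by positivity, fun i s => ?_⟩
  have h1 : (1 : ℝ) ≤ 1 + s := by linarith [(Nat.cast_nonneg s : (0 : ℝ) ≤ s)]
  calc a i s + b i s ≤ C * (1 + (s : ℝ)) ^ N + C' * (1 + (s : ℝ)) ^ N' := add_le_add (hN i s) (hN' i s)
    _ ≤ C * (1 + (s : ℝ)) ^ (N + N') + C' * (1 + (s : ℝ)) ^ (N + N') := by
        gcongr <;> first | exact h1 | omega
    _ = _ := by ring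

theorem PB.zero {ι : Type*} : PB (fun (_ : ι) (_ : ℕ) => (0 : ℝ)) := ⟨0, 0, le_rfl, by simp⟩

theorem PB.sum {ι κ : Type*} (t : Finset κ) {a : κ → ι → ℕ → ℝ} (ha : ∀ j ∈ t, PB (a j)) :
    PB (fun i s => ∑ j ∈ t, a j i s) := by
  classical
  induction t using Finset.induction_on with
  | empty => simpa using PB.zero
  | insert j t hj ih =>
    have := (ha j (Finset.mem_insert_self _ _)).add (ih fun l hl => ha l (Finset.mem_insert_of_mem hl))
    refine this.mono fun i s => ?_
    rw [Finset.sum_insert hj]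

theorem PB.const_mul {ι : Type*} {a : ι → ℕ → ℝ} (ha : PB a) {c : ℝ} (hc : 0 ≤ c) :
    PB (fun i s => c * a i s) := by
  obtain ⟨C, N, hC, hN⟩ := ha
  refine ⟨c * C, N, by positivity, fun i s => ?_⟩
  rw [mul_assoc]; exact mul_le_mul_of_nonneg_left (hN i s) hc

theorem PB.mul {ι : Type*} {a b : ι → ℕ → ℝ} (ha : PB a) (hb : PB b) (ha0 : ∀ i s, 0 ≤ a i s)
    (hb0 : ∀ i s, 0 ≤ b i s) : PB (fun i s => a i s * b i s) := by
  obtain ⟨C, N, hC, hN⟩ := ha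
  obtain ⟨C', N', hC', hN'⟩ := hb
  refine ⟨C * C', N + N', by positivity, fun i s => ?_⟩
  calc a i s * b i s ≤ (C * (1 + (s : ℝ)) ^ N) * (C' * (1 + (s : ℝ)) ^ N') :=
        mul_le_mul (hN i s) (hN' i s) (hb0 i s) (by positivity)
    _ = _ := by ring

variable {n : ℕ} [Module (MvPolynomial (Fin n) ℂ) (Cinf n)] [DAct n]

/-- Families of quasi-periodic functions with bounds. -/
def Fam (L : ℝ) (μ : ℕ → Fin n → ℝ) (F : ℕ → Cinf n) : Prop :=
  (∀ s, QP L (μ s) (F s)) ∧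
    ∀ p : PA n, PB (fun (x : Fin n → ℝ) s => ‖(p • F s).1 x‖ * Real.exp (-rdot (μ s) x))

theorem Fam.psmul {L : ℝ} {μ : ℕ → Fin n → ℝ} {F : ℕ → Cinf n} (hF : Fam L μ F) (p : PA n) :
    Fam L μ (fun s => p • F s) :=
  ⟨fun s => (hF.1 s).psmul p, fun q => by simpa only [smul_smul] using hF.2 (q * p)⟩

theorem Fam.add {L : ℝ} {μ : ℕ → Fin n → ℝ} {F G : ℕ → Cinf n} (hF : Fam L μ F) (hG : Fam L μ G) :
    Fam L μ (fun s => F s + G s) :=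
  ⟨fun s => (hF.1 s).add (hG.1 s), fun q => ((hF.2 q).add (hG.2 q)).mono fun x s => by
    rw [smul_add, add_val, ← add_mul]
    gcongr
    exact norm_add_le _ _⟩

theorem Fam.csmul {L : ℝ} {μ : ℕ → Fin n → ℝ} {F : ℕ → Cinf n} (hF : Fam L μ F) (c : ℂ) :
    Fam L μ (fun s => c • F s) := by
  simpa only [C_smul] using hF.psmul (C c)

theorem Fam.sub {L : ℝ} {μ : ℕ → Fin n → ℝ} {F G : ℕ → Cinf n} (hF : Fam L μ F) (hG : Fam L μ G) :
    Fam L μ (fun s => F s - G s) := by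
  have := hF.add (hG.csmul (-1))
  have e : ∀ s, F s + (-1 : ℂ) • G s = F s - G s := by
    intro s; apply ext'; intro x; rw [add_val, smul_val, sub_val]; ring
  simpa only [e] using this

theorem Fam.zero {L : ℝ} {μ : ℕ → Fin n → ℝ} : Fam L μ (fun _ => (0 : Cinf n)) :=
  ⟨fun s m x => by simp, fun q => by simpa using PB.zero⟩

theorem Fam.sum {L : ℝ} {μ : ℕ → Fin n → ℝ} {ι : Type*} (t : Finset ι) {F : ι → ℕ → Cinf n}
    (hF : ∀ i ∈ t, Fam L μ (F i)) : Fam L μ (fun s => ∑ i ∈ t, F i s) := by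
  classical
  induction t using Finset.induction_on with
  | empty => simpa using Fam.zero
  | insert j t hj ih =>
    have := (hF j (Finset.mem_insert_self _ _)).add (ih fun l hl => hF l (Finset.mem_insert_of_mem hl))
    simpa only [Finset.sum_insert hj] using this

theorem Fam.act {L : ℝ} {μ : ℕ → Fin n → ℝ} {l k : ℕ} (M : Matrix (Fin l) (Fin k) (PA n))
    {F : ℕ → Fin k → Cinf n} (hF : ∀ j, Fam L μ (fun s => F s j)) :
    ∀ i, Fam L μ (fun s => CMH.act M (F s) i) := fun i =>
  Fam.sum Finset.univ fun j _ => (hF j).psmul (M i j)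

/-- Multiplication by a bounded periodic function. -/
theorem Fam.cmul {L : ℝ} {μ : ℕ → Fin n → ℝ} {F : ℕ → Cinf n} (hF : Fam L μ F) (φ : Cinf n)
    (hφ : ∀ m x, φ.1 (x + lat L m) = φ.1 x) (hb : ∀ p : PA n, ∃ B, ∀ x, ‖(p • φ).1 x‖ ≤ B) :
    Fam L μ (fun s => CMH.cmul φ (F s)) := by
  refine ⟨fun s => QP.cmul hφ (hF.1 s), fun p => ?_⟩
  induction p using MvPolynomial.induction_on generalizing φ F with
  | C c =>
    obtain ⟨B, hB⟩ := hb 1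
    have hB0 : 0 ≤ B := (norm_nonneg _).trans (hB 0)
    have := (hF.2 1).const_mul (c := ‖c‖ * B) (by positivity)
    refine this.mono fun x s => ?_
    rw [C_smul, smul_val, cmul_val, norm_mul, norm_mul, ← mul_assoc, one_smul, ← mul_assoc]
    have := hB x
    rw [one_smul] at this
    gcongr
  | add p q hp hq =>
    refine ((hp hF φ hφ hb).add (hq hF φ hφ hb)).mono fun x s => ?_
    rw [add_smul, add_val, ← add_mul]
    gcongr
    exact norm_add_le _ _
  | mul_X p i hp =>
    have h1 := hp (hF.psmul (X i)) φ hφ hb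
    have h2 := hp hF ((X i : PA n) • φ) (fun m x => by
      have : QP L 0 φ := fun m x => by simp [hφ m x, rdot]
      have := this.psmul (X i) m x
      simpa [rdot] using this) (fun q => by
        obtain ⟨B, hB⟩ := hb (q * X i)
        exact ⟨B, fun x => by rw [smul_smul]; exact hB x⟩)
    refine (h1.add h2).mono fun x s => ?_
    rw [mul_smul, X_cmul, smul_add, add_val, ← add_mul, add_comm ‖(p • CMH.cmul φ _).1 x‖]
    gcongr
    exact norm_add_le _ _

theorem Fam.cf_decay {L : ℝ} (hL : 0 < L) {μ : ℕ → Fin n → ℝ} {F : ℕ → Cinf n} (hF : Fam L μ F)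
    (N : ℕ) : PB (fun (k : Fin n → ℤ) s => (1 + ‖k‖) ^ N * ‖cf L (μ s) (F s) k‖) := by
  have h0 : ∀ p : PA n, PB (fun (k : Fin n → ℤ) s => ‖cf L (μ s) (p • F s) k‖) := by
    intro p
    obtain ⟨C, N, hC, hN⟩ := hF.2 p
    refine ⟨C, N, hC, fun k s => ?_⟩
    refine cf_bound L (μ s) _ k _ fun x => ?_
    have := hN x s
    beta_reduce at this
    rw [Real.exp_neg, ← div_eq_mul_inv, div_le_iff₀ (Real.exp_pos _)] at this
    exact this
  have h1 := h0 1
  simp only [one_smul] at h1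
  have := (h1.add (PB.sum Finset.univ fun (i : Fin n) _ =>
    (h0 (X i ^ N)).const_mul (c := L ^ N) (by positivity))).const_mul (c := 2 ^ N) (by positivity)
  exact this.mono fun k s => CMH.cf_decay L hL (μ s) k (F s) (hF.1 s) N

/-- Small divisor condition. -/
def SD (L : ℝ) (μ : ℕ → Fin n → ℝ) (b : PA n) : Prop :=
  ∃ (C : ℝ) (N : ℕ), 0 ≤ C ∧ ∀ s (k : Fin n → ℤ), eval (zk L (μ s) k) b ≠ 0 ∧
    ‖(eval (zk L (μ s) k) b)⁻¹‖ ≤ C * (1 + ‖k‖) ^ N * (1 + (s : ℝ)) ^ N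

theorem QP_expo (L : ℝ) (hL : L ≠ 0) (μ : Fin n → ℝ) (k : Fin n → ℤ) : QP L μ (expo (zk L μ k)) := by
  intro m x
  have h := dotc_zk L hL μ k (fun i => (m i : ℝ))
  have e : L • (fun i => (m i : ℝ)) = lat L m := rfl
  rw [e] at h
  rw [expo_val, expo_val, dotc_add, h, Complex.exp_add, Complex.exp_add]
  have : Complex.exp (∑ i, 2 * Real.pi * Complex.I * k i * ((m i : ℝ) : ℂ)) = 1 := by
    have e2 : (∑ i, 2 * Real.pi * Complex.I * k i * ((m i : ℝ) : ℂ)) =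
      ((∑ i, k i * m i : ℤ) : ℂ) * (2 * Real.pi * Complex.I) := by
      push_cast
      rw [Finset.sum_mul]
      exact Finset.sum_congr rfl fun i _ => by ring
    rw [e2, Complex.exp_int_mul_two_pi_mul_I]
  rw [this]
  push_cast
  ring

theorem qp_unique {L : ℝ} (hL : L ≠ 0) {μ : Fin n → ℝ} {b : PA n}
    (hb : ∀ k : Fin n → ℤ, eval (zk L μ k) b ≠ 0)
    {f : Cinf n} (hf : QP L μ f) (h : b • f = 0) : f = 0 := by
  have h0 : ∀ k, cf L μ f k = 0 := by
    intro k
    have := cf_smul L hL μ k b f hf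
    rw [h] at this
    have h2 : cf L μ (0 : Cinf n) k = 0 := by simp [cf]
    rw [h2] at this
    exact (mul_eq_zero.1 this.symm).resolve_left (hb k)
  apply ext'
  intro x
  have := cf_inv L hL μ f hf (by rw [show cf L μ f = fun _ => 0 from funext h0]; exact summable_zero) x
  simp only [h0, zero_mul] at this
  exact this.unique hasSum_zero

theorem Fam.div {L : ℝ} (hL : 0 < L) {μ : ℕ → Fin n → ℝ} {F : ℕ → Cinf n} (hF : Fam L μ F)
    {b : PA n} (hb : SD L μ b) : ∃ Y : ℕ → Cinf n, Fam L μ Y ∧ ∀ s, b • Y s = F s := by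
  obtain ⟨Cb, Nb, hCb, hb⟩ := hb
  let v : ℕ → (Fin n → ℤ) → Cinf n := fun s k =>
    ((eval (zk L (μ s) k) b)⁻¹ * cf L (μ s) (F s) k) • expo (zk L (μ s) k)
  have hv : ∀ (p : PA n) s k x, (p • v s k).1 x =
      (eval (zk L (μ s) k) b)⁻¹ * cf L (μ s) (p • F s) k * Complex.exp (dotc (zk L (μ s) k) x) := by
    intro p s k x
    simp only [v]
    rw [psmul_smul, smul_expo, smul_smul, smul_val, expo_val, cf_smul L hL.ne' _ _ _ _ (hF.1 s)]
    ring
  have hbd : ∀ p : PA n, ∃ (C : ℝ) (N : ℕ), 0 ≤ C ∧ ∀ s k x, ‖(p • v s k).1 x‖ ≤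
      C * (1 + (s : ℝ)) ^ N * Real.exp (rdot (μ s) x) * ((1 + ‖k‖) ^ (2 * n))⁻¹ := by
    intro p
    obtain ⟨C, N, hC, hN⟩ := (hF.psmul p).cf_decay hL (Nb + 2 * n)
    refine ⟨Cb * C, Nb + N, by positivity, fun s k x => ?_⟩
    rw [hv, norm_mul, norm_mul, norm_expo_zk]
    have h1 := (hb s k).2
    have h2 := hN k s
    have hk : 0 < (1 + ‖k‖) := by positivity
    have h3 : ‖cf L (μ s) (p • F s) k‖ ≤ C * (1 + (s : ℝ)) ^ N * ((1 + ‖k‖) ^ (Nb + 2 * n))⁻¹ := by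
      rw [← div_eq_mul_inv, le_div_iff₀ (by positivity), mul_comm]
      exact h2
    calc _ ≤ (Cb * (1 + ‖k‖) ^ Nb * (1 + (s : ℝ)) ^ Nb) *
          (C * (1 + (s : ℝ)) ^ N * ((1 + ‖k‖) ^ (Nb + 2 * n))⁻¹) * Real.exp (rdot (μ s) x) := by
          gcongr
      _ = _ := by
          rw [pow_add, pow_add]; field_simp
  choose C N hC hN using hbd
  have hex : ∀ s, ∃ U : Cinf n, ∀ (p : PA n) x, HasSum (fun k => (p • v s k).1 x) ((p • U).1 x) := by
    intro s
    refine sum_lemma _ fun p r => ?_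
    refine ⟨fun k => C p * (1 + (s : ℝ)) ^ (N p) * Real.exp (∑ i, |μ s i| * r) *
      ((1 + ‖k‖) ^ (2 * n))⁻¹, wt_summable.mul_left _, fun k x hx => ?_⟩
    refine (hN p s k x).trans ?_
    have := hC p
    refine mul_le_mul_of_nonneg_right (mul_le_mul_of_nonneg_left (Real.exp_le_exp.2 ?_)
      (by positivity)) (by positivity)
    unfold rdot
    refine Finset.sum_le_sum fun i _ => ?_
    refine (le_abs_self _).trans ?_
    rw [abs_mul]
    gcongr
    exact (norm_le_pi_norm x i).trans hx.le
  choose U hU using hex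
  refine ⟨U, ⟨?_, ?_⟩, ?_⟩
  · intro s m x
    have h1 := hU s 1 (x + lat L m)
    have h2 := (hU s 1 x).mul_left (Real.exp (rdot (μ s) (lat L m)) : ℂ)
    have : ∀ k, ((1 : PA n) • v s k).1 (x + lat L m) =
        (Real.exp (rdot (μ s) (lat L m)) : ℂ) * ((1 : PA n) • v s k).1 x := by
      intro k
      simp only [one_smul]
      exact ((QP_expo L hL.ne' (μ s) k).csmul _) m x
    simp only [this] at h1
    have := h1.unique h2
    simpa only [one_smul] using this
  · intro p
    refine ⟨C p * ∑' k : Fin n → ℤ, ((1 + ‖k‖) ^ (2 * n))⁻¹, N p,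
      mul_nonneg (hC p) (tsum_nonneg fun _ => by positivity), fun x s => ?_⟩
    beta_reduce
    rw [Real.exp_neg, ← div_eq_mul_inv, div_le_iff₀ (Real.exp_pos _)]
    have h1 := tsum_of_norm_bounded (wt_summable.mul_left (C p * (1 + (s : ℝ)) ^ (N p) * Real.exp (rdot (μ s) x))).hasSum
      (fun k => hN p s k x)
    rw [(hU s p x).tsum_eq, tsum_mul_left] at h1
    refine h1.trans (le_of_eq ?_)
    ring
  · intro s
    apply ext'
    intro x
    have h1 := hU s b x
    have : ∀ k, (b • v s k).1 x = cf L (μ s) (F s) k * Complex.exp (dotc (zk L (μ s) k) x) := by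
      intro k
      rw [hv, cf_smul L hL.ne' _ _ _ _ (hF.1 s), ← mul_assoc, inv_mul_cancel₀ (hb s k).1, one_mul]
    simp only [this] at h1
    refine h1.unique (cf_inv L hL.ne' (μ s) (F s) (hF.1 s) ?_ x)
    obtain ⟨C, N, hC, hN⟩ := hF.cf_decay hL (2 * n)
    refine Summable.of_norm_bounded (wt_summable.mul_left (C * (1 + (s : ℝ)) ^ N)) fun k => ?_
    rw [← div_eq_mul_inv, le_div_iff₀ (by positivity), mul_comm]
    exact hN k s

end fam

end CMH

namespace CMH

open MvPolynomial MeasureTheory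

section smalldiv

variable {n : ℕ}

/-- Restriction of a polynomial to a line. -/
def lineP (z v : Fin n → ℂ) (B : PA n) : Polynomial ℂ :=
  aeval (fun i => Polynomial.C (z i) + Polynomial.C (v i) * Polynomial.X) B

theorem lineP_eval (z v : Fin n → ℂ) (B : PA n) (t : ℂ) :
    (lineP z v B).eval t = eval (fun i => z i + v i * t) B := by
  unfold lineP
  induction B using MvPolynomial.induction_on with
  | C a => simp
  | add p q hp hq => simp only [map_add, Polynomial.eval_add, hp, hq]
  | mul_X p i hp => simp only [map_mul, Polynomial.eval_mul, hp]; simp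

theorem lin_natDegree (a b : ℂ) : (Polynomial.C a + Polynomial.C b * Polynomial.X).natDegree ≤ 1 := by
  rw [add_comm]; exact Polynomial.natDegree_linear_le

theorem mon_natDegree (z v : Fin n → ℂ) (m : Fin n →₀ ℕ) (t : Finset (Fin n)) :
    (∏ i ∈ t, (Polynomial.C (z i) + Polynomial.C (v i) * Polynomial.X) ^ m i).natDegree ≤
      ∑ i ∈ t, m i := by
  refine (Polynomial.natDegree_prod_le _ _).trans (Finset.sum_le_sum fun i _ => ?_)
  refine (Polynomial.natDegree_pow_le).trans ?_
  calc _ ≤ m i * 1 := Nat.mul_le_mul_left _ (lin_natDegree _ _)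
    _ = m i := mul_one _

theorem mon_coeff (z v : Fin n → ℂ) (m : Fin n →₀ ℕ) (t : Finset (Fin n)) :
    (∏ i ∈ t, (Polynomial.C (z i) + Polynomial.C (v i) * Polynomial.X) ^ m i).coeff (∑ i ∈ t, m i)
      = ∏ i ∈ t, v i ^ m i := by
  classical
  induction t using Finset.induction_on with
  | empty => simp
  | insert a t ha ih =>
    rw [Finset.prod_insert ha, Finset.sum_insert ha, Finset.prod_insert ha,
      Polynomial.coeff_mul_add_eq_of_natDegree_le _ (mon_natDegree z v m t), ih]
    · congr 1
      have := Polynomial.coeff_pow_of_natDegree_le (m := m a) (lin_natDegree (z a) (v a))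
      rw [mul_one] at this
      rw [this]; simp
    · refine (Polynomial.natDegree_pow_le).trans ?_
      calc _ ≤ m a * 1 := Nat.mul_le_mul_left _ (lin_natDegree _ _)
        _ = m a := mul_one _

theorem lineP_eq (z v : Fin n → ℂ) (B : PA n) : lineP z v B = ∑ m ∈ B.support,
    Polynomial.C (coeff m B) *
      ∏ i, (Polynomial.C (z i) + Polynomial.C (v i) * Polynomial.X) ^ m i := by
  unfold lineP
  rw [aeval_eq_eval₂Hom, coe_eval₂Hom, eval₂_eq']
  rfl

theorem deg_le (B : PA n) {m : Fin n →₀ ℕ} (hm : m ∈ B.support) : ∑ i, m i ≤ B.totalDegree := by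
  have := le_totalDegree hm
  rwa [Finsupp.sum_fintype _ _ (fun _ => rfl)] at this

theorem lineP_natDegree (z v : Fin n → ℂ) (B : PA n) :
    (lineP z v B).natDegree ≤ B.totalDegree := by
  rw [lineP_eq]
  refine Polynomial.natDegree_sum_le_of_forall_le _ _ fun m hm => ?_
  exact (Polynomial.natDegree_C_mul_le _ _).trans ((mon_natDegree z v m _).trans (deg_le B hm))

theorem lineP_coeff (z v : Fin n → ℂ) (B : PA n) :
    (lineP z v B).coeff B.totalDegree = eval v (homogeneousComponent B.totalDegree B) := by
  rw [lineP_eq, Polynomial.finsetSum_coeff, homogeneousComponent_apply, map_sum, Finset.sum_filter]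
  refine Finset.sum_congr rfl fun m hm => ?_
  rw [Polynomial.coeff_C_mul]
  have hdeg : m.degree = ∑ i, m i := Finsupp.degree_eq_sum m
  split_ifs with h
  · rw [← h, hdeg, mon_coeff, eval_monomial, Finsupp.prod_fintype _ _ (fun _ => pow_zero _)]
  · rw [Polynomial.coeff_eq_zero_of_natDegree_lt, mul_zero]
    exact lt_of_le_of_lt (mon_natDegree z v m _) (lt_of_le_of_ne (deg_le B hm) (by rwa [← hdeg]))

theorem exists_dir (B : PA n) (hB : B ≠ 0) : ∃ v : Fin n → ℝ,
    eval (fun i => (v i : ℂ)) (homogeneousComponent B.totalDegree B) ≠ 0 := by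
  by_contra! hcon
  have h0 : homogeneousComponent B.totalDegree B = 0 := by
    refine MvPolynomial.funext_set (fun _ => Set.range ((↑) : ℝ → ℂ))
      (fun _ => Set.infinite_range_of_injective Complex.ofReal_injective) ?_
    intro x hx
    choose v hv using fun i => hx i (Set.mem_univ i)
    have : x = fun i => (v i : ℂ) := by ext i; exact (hv i).symm
    rw [this, hcon v]; simp
  obtain ⟨m, hm, hmd⟩ := Finset.exists_mem_eq_sup B.support (support_nonempty.2 hB)
    (fun s => s.sum fun _ e => e)
  have h1 : coeff m (homogeneousComponent B.totalDegree B) = coeff m B := by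
    rw [coeff_homogeneousComponent, if_pos]
    rw [Finsupp.degree_eq_sum]
    have : B.totalDegree = m.sum fun _ e => e := hmd
    rw [this, Finsupp.sum_fintype _ _ (fun _ => rfl)]
  rw [h0] at h1
  exact (mem_support_iff.1 hm) (by rw [← h1]; simp)

theorem poly_lower (p : Polynomial ℂ) (d : ℕ) (hd : p.natDegree ≤ d) (ha : p.coeff d ≠ 0)
    (t ε : ℝ) (hε : 0 ≤ ε) (h : ∀ r ∈ p.roots, ε ≤ |t - r.re|) :
    ‖p.coeff d‖ * ε ^ d ≤ ‖p.eval (t : ℂ)‖ := by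
  have hdd : p.natDegree = d := le_antisymm hd (Polynomial.le_natDegree_of_ne_zero ha)
  have hs := IsAlgClosed.splits p
  have hc : p.roots.card = d := by rw [← hs.natDegree_eq_card_roots, hdd]
  rw [hs.eval_eq_prod_roots, norm_mul, Polynomial.leadingCoeff, hdd, ← hc]
  gcongr
  have key : ∀ R : Multiset ℂ, (∀ r ∈ R, ε ≤ |t - r.re|) →
      ε ^ R.card ≤ ‖(R.map fun r => ((t : ℂ) - r)).prod‖ := by
    intro R
    induction R using Multiset.induction_on with
    | empty => simp
    | cons r R ih =>
      intro hR
      rw [Multiset.card_cons, pow_succ', Multiset.map_cons, Multiset.prod_cons, norm_mul]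
      have h1 : ε ≤ ‖(t : ℂ) - r‖ := by
        refine (hR r (Multiset.mem_cons_self _ _)).trans ?_
        have := Complex.abs_re_le_norm ((t : ℂ) - r)
        simpa using this
      exact mul_le_mul h1 (ih fun r' hr' => hR r' (Multiset.mem_cons_of_mem hr'))
        (by positivity) (norm_nonneg _)
  exact key _ h

theorem exists_good {κ : Type*} [Countable κ] (R : κ → Finset ℂ) (d : ℕ) (hR : ∀ i, (R i).card ≤ d)
    (ε : κ → ℝ) (h0 : ∀ i, 0 ≤ ε i) (hs : Summable ε) (hlt : d * (2 * ∑' i, ε i) < 1) :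
    ∃ t : ℝ, ∀ i, ∀ r ∈ R i, ε i ≤ |t - r.re| := by
  by_contra! hcon
  have hsub : Set.Icc (0 : ℝ) 1 ⊆ ⋃ i, ⋃ r ∈ R i, Metric.ball (r.re : ℝ) (ε i) := by
    intro t _
    obtain ⟨i, r, hr, h⟩ := hcon t
    simp only [Set.mem_iUnion]
    exact ⟨i, r, hr, by rwa [Metric.mem_ball, Real.dist_eq]⟩
  have h1 : volume (Set.Icc (0 : ℝ) 1) ≤ ∑' i, ENNReal.ofReal (d * (2 * ε i)) := by
    refine (measure_mono hsub).trans ((measure_iUnion_le _).trans (ENNReal.tsum_le_tsum fun i => ?_))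
    refine (measure_biUnion_finset_le _ _).trans ?_
    simp only [Real.volume_ball]
    rw [Finset.sum_const, nsmul_eq_mul, ENNReal.ofReal_mul (p := (d : ℝ)) (by positivity), ENNReal.ofReal_natCast]
    gcongr
    exact hR i
  rw [← ENNReal.ofReal_tsum_of_nonneg (fun i => by have := h0 i; positivity)
    ((hs.mul_left 2).mul_left _), tsum_mul_left, tsum_mul_left, Real.volume_Icc] at h1
  rw [ENNReal.ofReal_le_ofReal_iff (by
    have : 0 ≤ ∑' i, ε i := tsum_nonneg h0
    positivity)] at h1
  linarith

/-- The frequencies of the family. -/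
def muS (lam : Fin n → ℝ) (j : Fin n) (σ : ℝ) (s : ℕ) : Fin n → ℝ :=
  lam + Pi.single j (s * σ)

variable [Module (MvPolynomial (Fin n) ℂ) (Cinf n)] [DAct n]

theorem exists_SD (L : ℝ) (B : PA n) (hB : B ≠ 0) (j : Fin n) (σ : ℝ) :
    ∃ lam : Fin n → ℝ, SD L (muS lam j σ) B := by
  obtain ⟨v, hv⟩ := exists_dir B hB
  set a := eval (fun i => (v i : ℂ)) (homogeneousComponent B.totalDegree B) with ha
  set d := B.totalDegree with hd
  let P : (Fin n → ℤ) × ℕ → Polynomial ℂ := fun κ =>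
    lineP (zk L (Pi.single j (κ.2 * σ)) κ.1) (fun i => (v i : ℂ)) B
  have hPd : ∀ κ, (P κ).natDegree ≤ d := fun κ => lineP_natDegree _ _ _
  have hPc : ∀ κ, (P κ).coeff d = a := fun κ => lineP_coeff _ _ _
  let w : (Fin n → ℤ) × ℕ → ℝ := fun κ => ((1 + ‖κ.1‖) ^ (2 * n))⁻¹ * ((1 + (κ.2 : ℝ)) ^ 2)⁻¹
  have hw : Summable w := by
    have hq : Summable fun s : ℕ => ((1 + (s : ℝ)) ^ 2)⁻¹ := ?_
    · have hp : ∀ k : Fin n → ℤ, 0 ≤ ((1 + ‖k‖) ^ (2 * n))⁻¹ := fun k =>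
        inv_nonneg.2 (pow_nonneg (add_nonneg zero_le_one (norm_nonneg k)) _)
      have hp2 : ∀ s : ℕ, 0 ≤ ((1 + (s : ℝ)) ^ 2)⁻¹ := fun s => by positivity
      have hs : Summable fun k : Fin n → ℤ => ((1 + ‖k‖) ^ (2 * n))⁻¹ := wt_summable (n := n)
      exact Summable.mul_of_nonneg hs hq hp hp2
    have := (summable_nat_add_iff 1).2 (Real.summable_nat_pow_inv.2 (by norm_num : 1 < 2))
    refine this.congr fun s => ?_
    push_cast; rw [add_comm]
  have hw0 : ∀ κ, 0 < w κ := fun κ => by positivity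
  set W := ∑' κ, w κ with hW
  have hW0 : 0 ≤ W := tsum_nonneg fun κ => (hw0 κ).le
  set e0 : ℝ := (d * (2 * W) + 1)⁻¹ / 2 with he0
  have he0p : 0 < e0 := by positivity
  obtain ⟨t, ht⟩ := exists_good (fun κ => (P κ).roots.toFinset) d
    (fun κ => (Multiset.toFinset_card_le _).trans ((Polynomial.card_roots' _).trans (hPd κ)))
    (fun κ => e0 * w κ) (fun κ => (mul_pos he0p (hw0 κ)).le) (hw.mul_left _) (by
      rw [tsum_mul_left, ← hW, he0]
      have : (d * (2 * ((d * (2 * W) + 1)⁻¹ / 2 * W)) : ℝ) = (d * (2 * W)) / (d * (2 * W) + 1) / 2 := by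
        field_simp
      rw [this]
      have h2 : (d * (2 * W)) / (d * (2 * W) + 1) ≤ 1 := by
        rw [div_le_one (by positivity)]; linarith
      linarith)
  refine ⟨fun i => v i * t, ‖a‖⁻¹ * (e0 ^ d)⁻¹, max (2 * n * d) (2 * d), by positivity, fun s k => ?_⟩
  have h1 : ‖a‖ * (e0 * w (k, s)) ^ d ≤ ‖(P (k, s)).eval (t : ℂ)‖ := by
    rw [← hPc (k, s)]
    refine poly_lower _ d (hPd _) (by rw [hPc]; exact hv) t _ (mul_pos he0p (hw0 _)).le ?_
    intro r hr
    exact ht (k, s) r (Multiset.mem_toFinset.2 hr)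
  have h2 : (P (k, s)).eval (t : ℂ) = eval (zk L (muS (fun i => v i * t) j σ s) k) B := by
    simp only [P]
    rw [lineP_eval]
    congr 2
    ext i
    simp only [zk, muS, Pi.add_apply]
    push_cast; ring
  rw [h2] at h1
  have ha0 : 0 < ‖a‖ := norm_pos_iff.2 hv
  have hpos : 0 < ‖a‖ * (e0 * w (k, s)) ^ d := mul_pos ha0 (pow_pos (mul_pos he0p (hw0 _)) _)
  have hpos2 := hpos.trans_le h1
  refine ⟨norm_pos_iff.1 hpos2, ?_⟩
  rw [norm_inv]
  calc _ ≤ (‖a‖ * (e0 * w (k, s)) ^ d)⁻¹ := inv_anti₀ hpos h1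
    _ = ‖a‖⁻¹ * (e0 ^ d)⁻¹ * (1 + ‖k‖) ^ (2 * n * d) * (1 + (s : ℝ)) ^ (2 * d) := by
        simp only [w, mul_pow, mul_inv, inv_pow, inv_inv, ← pow_mul]; ring
    _ ≤ _ := by
        have h3 : (1 : ℝ) ≤ 1 + ‖k‖ := by linarith [norm_nonneg k]
        have h4 : (1 : ℝ) ≤ 1 + s := by linarith [(Nat.cast_nonneg s : (0 : ℝ) ≤ s)]
        gcongr
        · exact le_max_left _ _
        · exact le_max_right _ _

theorem eval_growth (c : PA n) : ∃ (C : ℝ) (N : ℕ), 0 ≤ C ∧ ∀ (z : Fin n → ℂ),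
    ‖eval z c‖ ≤ C * (1 + ‖z‖) ^ N := by
  induction c using MvPolynomial.induction_on with
  | C a => exact ⟨‖a‖, 0, norm_nonneg _, by simp⟩
  | add p q hp hq =>
    obtain ⟨C, N, hC, h⟩ := hp
    obtain ⟨C', N', hC', h'⟩ := hq
    refine ⟨C + C', N + N', by positivity, fun z => ?_⟩
    have h1 : (1 : ℝ) ≤ 1 + ‖z‖ := by linarith [norm_nonneg z]
    rw [map_add]
    calc _ ≤ ‖eval z p‖ + ‖eval z q‖ := norm_add_le _ _
      _ ≤ C * (1 + ‖z‖) ^ N + C' * (1 + ‖z‖) ^ N' := add_le_add (h z) (h' z)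
      _ ≤ C * (1 + ‖z‖) ^ (N + N') + C' * (1 + ‖z‖) ^ (N + N') := by
          gcongr <;> first | exact h1 | omega
      _ = _ := by ring
  | mul_X p i hp =>
    obtain ⟨C, N, hC, h⟩ := hp
    refine ⟨C, N + 1, hC, fun z => ?_⟩
    rw [map_mul, norm_mul, eval_X, pow_succ, ← mul_assoc]
    refine mul_le_mul (h z) ?_ (norm_nonneg _) (by positivity)
    linarith [norm_le_pi_norm z i]

theorem zk_growth (L : ℝ) (lam : Fin n → ℝ) (j : Fin n) (σ : ℝ) : ∃ C : ℝ, 0 ≤ C ∧ ∀ s k,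
    1 + ‖zk L (muS lam j σ s) k‖ ≤ C * ((1 + ‖k‖) * (1 + (s : ℝ))) := by
  refine ⟨1 + 2 * Real.pi / |L| + ‖lam‖ + |σ|, by positivity, fun s k => ?_⟩
  have hs : (0 : ℝ) ≤ s := Nat.cast_nonneg s
  have hk := norm_nonneg k
  have h : ‖zk L (muS lam j σ s) k‖ ≤ 2 * Real.pi / |L| * ‖k‖ + ‖lam‖ + s * |σ| := by
    rw [pi_norm_le_iff_of_nonneg (by positivity)]
    intro i
    unfold zk
    have e1 : ‖(2 * Real.pi * Complex.I * k i / L : ℂ)‖ ≤ 2 * Real.pi / |L| * ‖k‖ := by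
      rw [norm_div, norm_mul, norm_mul, norm_mul, Complex.norm_I, Complex.norm_real, Complex.norm_real]
      have : ‖(k i : ℂ)‖ ≤ ‖k‖ := by
        have := norm_le_pi_norm k i
        rwa [Complex.norm_intCast, ← Int.norm_eq_abs]
      rw [Real.norm_eq_abs, Real.norm_eq_abs, abs_of_pos Real.pi_pos]
      simp only [Complex.norm_ofNat, mul_one]
      rw [mul_div_right_comm]
      gcongr
    have e2 : ‖(muS lam j σ s i : ℂ)‖ ≤ ‖lam‖ + s * |σ| := by
      rw [Complex.norm_real, muS, Pi.add_apply]
      refine (norm_add_le _ _).trans (add_le_add (norm_le_pi_norm lam i) ?_)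
      have := norm_le_pi_norm (Pi.single j ((s : ℝ) * σ) : Fin n → ℝ) i
      rw [Pi.norm_single] at this
      refine this.trans ?_
      rw [norm_mul, Real.norm_eq_abs, Real.norm_eq_abs, abs_of_nonneg hs]
    exact (norm_add_le _ _).trans (by linarith)
  have hp : 0 ≤ 2 * Real.pi / |L| := by positivity
  have hl := norm_nonneg lam
  have hσ := abs_nonneg σ
  have hks : 0 ≤ ‖k‖ * s := by positivity
  have h5 := mul_nonneg hp hks
  have h6 := mul_nonneg hp hs
  have h7 := mul_nonneg hl hks
  have h8 := mul_nonneg hl hk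
  have h9 := mul_nonneg hl hs
  have h10 := mul_nonneg hσ hks
  have h11 := mul_nonneg hσ hk
  nlinarith

theorem SD.of_dvd {L : ℝ} {lam : Fin n → ℝ} {j : Fin n} {σ : ℝ} {B b : PA n}
    (h : SD L (muS lam j σ) B) (hb : b ∣ B) : SD L (muS lam j σ) b := by
  obtain ⟨c, rfl⟩ := hb
  obtain ⟨C, N, hC, h⟩ := h
  obtain ⟨C', N', hC', h'⟩ := eval_growth c
  obtain ⟨D, hD, hz⟩ := zk_growth L lam j σ
  refine ⟨C * (C' * D ^ N'), N + N', by positivity, fun s k => ?_⟩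
  obtain ⟨h1, h2⟩ := h s k
  rw [map_mul] at h1 h2
  refine ⟨left_ne_zero_of_mul h1, ?_⟩
  have hc := right_ne_zero_of_mul h1
  set z := zk L (muS lam j σ s) k
  have : (eval z b)⁻¹ = (eval z b * eval z c)⁻¹ * eval z c := by field_simp
  rw [this, norm_mul]
  calc _ ≤ (C * (1 + ‖k‖) ^ N * (1 + (s : ℝ)) ^ N) * (C' * (D * ((1 + ‖k‖) * (1 + (s : ℝ)))) ^ N') := by
        refine mul_le_mul h2 ((h' z).trans ?_) (norm_nonneg _) (by positivity)
        gcongr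
        exact hz s k
    _ = _ := by rw [mul_pow, mul_pow, pow_add, pow_add]; ring

end smalldiv

end CMH

namespace CMH

open MvPolynomial MeasureTheory

section periodization

variable {n : ℕ} [Module (MvPolynomial (Fin n) ℂ) (Cinf n)] [DAct n]

theorem supp_psmul {K : Set (Fin n → ℝ)} (hK : IsClosed K) {g : Cinf n}
    (hg : ∀ x, x ∉ K → g.1 x = 0) (p : PA n) : ∀ x, x ∉ K → (p • g).1 x = 0 :=
  fun x hx => locality_zero p hK.isOpen_compl (fun y hy => hg y hy) x hx

/-- Closed box. -/
def cbox (n : ℕ) (c : ℝ) : Set (Fin n → ℝ) := {x | ∀ l, |x l| ≤ c}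

theorem cbox_closed (c : ℝ) : IsClosed (cbox n c) := by
  have : cbox n c = ⋂ l, {x : Fin n → ℝ | |x l| ≤ c} := by ext x; simp [cbox]
  rw [this]
  exact isClosed_iInter fun l => isClosed_le (by fun_prop) continuous_const

theorem cbox_compact (c : ℝ) : IsCompact (cbox n c) := by
  have : cbox n c = Set.Icc (fun _ => -c) (fun _ => c) := by
    ext x
    simp only [cbox, Set.mem_ofPred_eq, abs_le, Set.mem_Icc, Pi.le_def]
    exact forall_and
  rw [this]; exact isCompact_Icc

theorem exists_cell (L : ℝ) (hL : 0 < L) (x : Fin n → ℝ) :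
    ∃ m : Fin n → ℤ, ∀ l, |x l + L * m l| ≤ L / 2 := by
  refine ⟨fun l => -round (x l / L), fun l => ?_⟩
  have h := abs_sub_round (x l / L)
  have : x l + L * ((-round (x l / L) : ℤ) : ℝ) = L * (x l / L - round (x l / L)) := by
    push_cast; field_simp; ring
  rw [this, abs_mul, abs_of_pos hL]
  nlinarith

theorem exists_per (L c : ℝ) (hL : 0 < L) (μ : Fin n → ℝ) (g : Cinf n)
    (hg : ∀ x, x ∉ cbox n c → g.1 x = 0) :
    ∃ U : Cinf n, ∀ (p : PA n) (x : Fin n → ℝ) (m : Fin n → ℤ), (∀ l, |x l + L * m l| < L - c) →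
      (p • U).1 x = (Real.exp (-rdot μ (lat L m)) : ℂ) * (p • g).1 (x + lat L m) := by
  classical
  let v : (Fin n → ℤ) → Cinf n := fun m =>
    (Real.exp (-rdot μ (lat L m)) : ℂ) • transl (lat L m) g
  have hv : ∀ (p : PA n) m x, (p • v m).1 x =
      (Real.exp (-rdot μ (lat L m)) : ℂ) * (p • g).1 (x + lat L m) := by
    intro p m x
    simp only [v]
    rw [psmul_smul, smul_transl, smul_val, transl_val]
  have hsupp : ∀ p : PA n, ∀ x, x ∉ cbox n c → (p • g).1 x = 0 := fun p => supp_psmul (cbox_closed c) hg p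
  obtain ⟨U, hU⟩ := sum_lemma v (by
    intro p r
    have hB : ∀ m, ∃ B : ℝ, ∀ x : Fin n → ℝ, ‖x‖ < r → ‖(p • v m).1 x‖ ≤ B := by
      intro m
      obtain ⟨B, hB⟩ := (isCompact_closedBall (0 : Fin n → ℝ) r).exists_bound_of_continuousOn
        (ccont (p • v m)).continuousOn
      exact ⟨B, fun x hx => hB x (by simpa using hx.le)⟩
    choose B hB using hB
    let T : Set (Fin n → ℤ) := {m | ∀ l, |L * (m l : ℝ)| ≤ r + c}
    have hT : T.Finite := by
      have : T ⊆ Set.pi Set.univ (fun _ => Set.Icc (-⌈(r + c) / L⌉) ⌈(r + c) / L⌉) := by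
        intro m hm l _
        have h1 := hm l
        rw [abs_mul, abs_of_pos hL, mul_comm, ← le_div_iff₀ hL] at h1
        have h2 : |m l| ≤ ⌈(r + c) / L⌉ := by
          have : ((|m l| : ℤ) : ℝ) ≤ ⌈(r + c) / L⌉ := by
            push_cast; exact h1.trans (Int.le_ceil _)
          exact_mod_cast this
        exact abs_le.1 h2
      exact (Set.Finite.pi fun _ => Set.finite_Icc _ _).subset this
    refine ⟨fun m => if m ∈ T then B m else 0, ?_, ?_⟩
    · exact summable_of_hasFiniteSupport (hT.subset fun m hm => by
        by_contra h
        simp [h] at hm)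
    · intro m x hx
      by_cases hm : m ∈ T
      · simp only [hm, if_true]; exact hB m x hx
      · simp only [hm, if_false]
        rw [hv, hsupp, mul_zero, norm_zero]
        intro hc
        apply hm
        intro l
        have h1 := hc l
        have h2 := norm_le_pi_norm x l
        rw [Real.norm_eq_abs] at h2
        simp only [Pi.add_apply, lat] at h1
        rw [abs_le] at *
        constructor <;> linarith [h1.1, h1.2, h2.1, h2.2])
  refine ⟨U, fun p x m hm => ?_⟩
  have h1 := hU p x
  have h2 : HasSum (fun i => (p • v i).1 x) ((p • v m).1 x) := by
    refine hasSum_single m fun m' hm' => ?_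
    rw [hv, hsupp, mul_zero]
    intro hc
    apply hm'
    funext l
    have a1 := hc l
    have a2 := hm l
    simp only [Pi.add_apply, lat] at a1
    rw [abs_le] at a1
    rw [abs_lt] at a2
    have a3 : L * ((m' l - m l : ℤ) : ℝ) < L * 1 := by push_cast; linarith [a1.2, a2.1]
    have a4 : L * ((m l - m' l : ℤ) : ℝ) < L * 1 := by push_cast; linarith [a1.1, a2.2]
    have a5 := (mul_lt_mul_iff_right₀ hL).1 a3
    have a6 := (mul_lt_mul_iff_right₀ hL).1 a4
    norm_cast at a5 a6
    omega
  rw [h1.unique h2, hv]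

theorem lat_sub (L : ℝ) (m m' : Fin n → ℤ) : lat L m + lat L (m' - m) = lat L m' := by
  funext l; simp [lat]; ring

theorem per_QP {L c : ℝ} (hL : 0 < L) (hc : c < L / 2) {μ : Fin n → ℝ} {g U : Cinf n}
    (hU : ∀ (p : PA n) (x : Fin n → ℝ) (m : Fin n → ℤ), (∀ l, |x l + L * m l| < L - c) →
      (p • U).1 x = (Real.exp (-rdot μ (lat L m)) : ℂ) * (p • g).1 (x + lat L m)) : QP L μ U := by
  intro m x
  obtain ⟨m', hm'⟩ := exists_cell L hL x
  have h1 := hU 1 x m' (fun l => (hm' l).trans_lt (by linarith))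
  have h2 := hU 1 (x + lat L m) (m' - m) (fun l => by
    have : (x + lat L m) l + L * ((m' - m) l : ℤ) = x l + L * m' l := by
      simp [lat]; ring
    rw [this]
    exact (hm' l).trans_lt (by linarith))
  rw [one_smul, one_smul] at h1 h2
  rw [h1, h2, add_assoc, lat_sub, ← mul_assoc, ← Complex.ofReal_mul, ← Real.exp_add]
  congr 3
  have := rdot_add μ (lat L m) (lat L (m' - m))
  rw [lat_sub] at this
  linarith

/-- Quasi-periodic functions are bounded. -/
theorem QP.bdd {L : ℝ} (hL : 0 < L) {μ : Fin n → ℝ} {f : Cinf n} (hf : QP L μ f) :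
    ∃ B, ∀ x, ‖f.1 x‖ * Real.exp (-rdot μ x) ≤ B := by
  obtain ⟨B, hB⟩ := (cbox_compact (n := n) (L / 2)).exists_bound_of_continuousOn
    (f := fun x => f.1 x * (Real.exp (-rdot μ x) : ℂ)) (by
      have := ccont f
      have h2 := rdot_continuous μ
      exact (this.mul (Complex.continuous_ofReal.comp (Real.continuous_exp.comp h2.neg))).continuousOn)
  refine ⟨B, fun x => ?_⟩
  obtain ⟨m, hm⟩ := exists_cell L hL x
  have h := hB (x + lat L m) hm
  rw [hf m x, norm_mul, norm_mul, Complex.norm_real, Complex.norm_real, Real.norm_eq_abs,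
    Real.norm_eq_abs, Real.abs_exp, Real.abs_exp, rdot_add] at h
  refine le_trans (le_of_eq ?_) h
  rw [mul_right_comm, ← Real.exp_add, mul_comm]
  congr 2; ring

theorem rdot_muS (lam : Fin n → ℝ) (j : Fin n) (σ : ℝ) (s : ℕ) (x : Fin n → ℝ) :
    rdot (muS lam j σ s) x = rdot lam x + s * (σ * x j) := by
  simp only [rdot, muS, Pi.add_apply, add_mul, Finset.sum_add_distrib]
  congr 1
  rw [Finset.sum_eq_single j]
  · simp; ring
  · intro i _ hi; simp [hi]
  · simp

/-- Periodization as a family. -/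
theorem exists_per_fam (L c : ℝ) (hL : 0 < L) (hc : c < L / 2) (lam : Fin n → ℝ) (j : Fin n)
    (σ R : ℝ) (g : Cinf n) (hg : ∀ x, x ∉ cbox n c → g.1 x = 0)
    (hgR : ∀ x, σ * x j < R → g.1 x = 0) :
    ∃ F : ℕ → Cinf n, Fam L (muS lam j σ) F ∧ ∀ (p : PA n) s x, (∀ l, |x l| < L - c) →
      (p • F s).1 x = (Real.exp (s * R) : ℂ) * (p • g).1 x := by
  choose U hU using fun s => exists_per L c hL (muS lam j σ s) g hg
  refine ⟨fun s => (Real.exp (s * R) : ℂ) • U s,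
    ⟨fun s => (per_QP hL hc (hU s)).csmul _, fun p => ?_⟩, fun p s x hx => ?_⟩
  · obtain ⟨B, hB⟩ := (cbox_compact (n := n) (L / 2)).exists_bound_of_continuousOn
      (f := fun x => (p • g).1 x * (Real.exp (-rdot lam x) : ℂ)) (by
        have := ccont (p • g)
        have h2 := rdot_continuous lam
        exact (this.mul (Complex.continuous_ofReal.comp (Real.continuous_exp.comp h2.neg))).continuousOn)
    refine ⟨max B 0, 0, le_max_right _ _, fun x s => ?_⟩
    obtain ⟨m, hm⟩ := exists_cell L hL x
    beta_reduce
    rw [psmul_smul, smul_val, hU s p x m (fun l => (hm l).trans_lt (by linarith))]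
    set y := x + lat L m with hy
    have hR' : ∀ y : Fin n → ℝ, ¬ (R ≤ σ * y j) → (p • g).1 y = 0 := by
      intro y hy
      exact supp_psmul (K := {x | R ≤ σ * x j}) (isClosed_le continuous_const (by fun_prop))
        (fun x hx => hgR x (not_le.1 hx)) p y hy
    by_cases hyR : R ≤ σ * y j
    · have h := hB y hm
      rw [norm_mul, Complex.norm_real, Real.norm_eq_abs, Real.abs_exp] at h
      rw [norm_mul, norm_mul, Complex.norm_real, Complex.norm_real, Real.norm_eq_abs,
        Real.norm_eq_abs, Real.abs_exp, Real.abs_exp, pow_zero, mul_one]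
      refine le_trans ?_ (h.trans (le_max_left _ _))
      have e : Real.exp (s * R) * (Real.exp (-rdot (muS lam j σ s) (lat L m)) * ‖(p • g).1 y‖) *
          Real.exp (-rdot (muS lam j σ s) x) = ‖(p • g).1 y‖ *
          Real.exp (s * R + -rdot (muS lam j σ s) (lat L m) + -rdot (muS lam j σ s) x) := by
        rw [Real.exp_add, Real.exp_add]; ring
      rw [e]
      gcongr
      have h3 : rdot (muS lam j σ s) y = rdot (muS lam j σ s) x + rdot (muS lam j σ s) (lat L m) := by
        rw [hy, rdot_add]
      have h4 := rdot_muS lam j σ s y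
      have h5 : (s : ℝ) * R ≤ s * (σ * y j) := by gcongr
      linarith
    · rw [hR' y hyR]; simp
  · rw [psmul_smul, smul_val, hU s p x 0 (fun l => by simpa using hx l)]
    have : lat L (0 : Fin n → ℤ) = 0 := by funext l; simp [lat]
    rw [this, add_zero]
    simp [rdot]

end periodization

section cutoff

variable {n : ℕ} [Module (MvPolynomial (Fin n) ℂ) (Cinf n)] [DAct n]

theorem exists_psi (L : ℝ) (hL : 0 < L) (i : Fin n) (r r' : ℝ) (hr : 0 < r) (hrr : r < r')
    (hr' : r' ≤ L / 2) : ∃ ψ : Cinf n, (∀ m x, ψ.1 (x + lat L m) = ψ.1 x) ∧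
      (∀ p : PA n, ∃ B, ∀ x, ‖(p • ψ).1 x‖ ≤ B) ∧
      (∀ j, j ≠ i → (X j : PA n) • ψ = 0) ∧ (∀ x, |x i| < r → ψ.1 x = 1) ∧
      (∀ x, r' ≤ |x i| → |x i| ≤ L / 2 → ψ.1 x = 0) := by
  set α := Real.cos (2 * Real.pi * r / L) with hα
  set β := Real.cos (2 * Real.pi * r' / L) with hβ
  have hmono : ∀ a b : ℝ, 0 ≤ a → a ≤ b → b ≤ L / 2 →
      Real.cos (2 * Real.pi * b / L) ≤ Real.cos (2 * Real.pi * a / L) := by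
    intro a b ha hab hb
    have hp := Real.pi_pos
    apply Real.cos_le_cos_of_nonneg_of_le_pi
    · positivity
    · rw [div_le_iff₀ hL]; nlinarith
    · gcongr
  have hlt : β < α := by
    have hp := Real.pi_pos
    apply Real.cos_lt_cos_of_nonneg_of_le_pi
    · positivity
    · rw [div_le_iff₀ hL]; nlinarith
    · gcongr
  let H : ℝ → ℂ := fun u =>
    ((Real.smoothTransition ((Real.cos (2 * Real.pi * u / L) - β) / (α - β)) : ℝ) : ℂ)
  have hH : ContDiff ℝ (⊤ : ℕ∞) H := by
    refine Complex.ofRealCLM.contDiff.comp (Real.smoothTransition.contDiff.comp ?_)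
    fun_prop
  have hpr : ContDiff ℝ (⊤ : ℕ∞) (fun x : Fin n → ℝ => x i) := contDiff_apply ℝ ℝ i
  let ψ : Cinf n := mk (fun x => H (x i)) (hH.comp hpr)
  have hcosabs : ∀ u : ℝ, Real.cos (2 * Real.pi * u / L) = Real.cos (2 * Real.pi * |u| / L) := by
    intro u
    rcases abs_choice u with h | h <;> rw [h]
    rw [← Real.cos_neg]; congr 1; ring
  have hper : ∀ m x, ψ.1 (x + lat L m) = ψ.1 x := by
    intro m x
    simp only [ψ, mk_val, H, Pi.add_apply, lat]
    have : 2 * Real.pi * (x i + L * m i) / L = 2 * Real.pi * x i / L + m i * (2 * Real.pi) := by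
      field_simp
    rw [this, Real.cos_add_int_mul_two_pi]
  refine ⟨ψ, hper, fun p => ?_, fun j hj => ?_, fun x hx => ?_, fun x h1 h2 => ?_⟩
  · have hq : QP L 0 ψ := by
      intro m x; rw [hper]; simp [rdot]
    obtain ⟨B, hB⟩ := (hq.psmul p).bdd hL
    refine ⟨B, fun x => ?_⟩
    simpa [rdot] using hB x
  · apply ext'
    intro x
    rw [X_apply, zero_val]
    have hd : HasFDerivAt (fun x : Fin n → ℝ => H (x i))
        ((fderiv ℝ H (x i)).comp (ContinuousLinearMap.proj (R := ℝ) (φ := fun _ : Fin n => ℝ) i)) x :=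
      HasFDerivAt.comp (g := H) x ((hH.differentiable (by simp)) (x i)).hasFDerivAt
        (hasFDerivAt_apply i x)
    have : fderiv ℝ ψ.1 x = _ := hd.fderiv
    rw [this]
    simp [hj.symm]
  · simp only [ψ, mk_val, H]
    rw [Real.smoothTransition.one_of_one_le]; · simp
    rw [le_div_iff₀ (by linarith), one_mul, hcosabs]
    have := hmono |x i| r (abs_nonneg _) hx.le (by linarith)
    linarith
  · simp only [ψ, mk_val, H]
    rw [Real.smoothTransition.zero_of_nonpos]; · simp
    apply div_nonpos_of_nonpos_of_nonneg _ (by linarith)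
    rw [hcosabs]
    have := hmono r' |x i| (by linarith) h1 h2
    linarith

variable {l k : ℕ}

theorem stepT {L : ℝ} (hL : 0 < L) {μ : ℕ → Fin n → ℝ} (M : Matrix (Fin l) (Fin k) (PA n))
    (i : Fin n) (b : PA n) (Q : Matrix (Fin k) (Fin l) (PA n)) (hQ : M * Q = b • 1)
    (hb : b ∈ supported ℂ ({i}ᶜ : Set (Fin n))) (hSD : SD L μ b)
    (F : ℕ → Fin k → Cinf n) (hF : ∀ j, Fam L μ (fun s => F s j))
    (r r' : ℝ) (hr : 0 < r) (hrr : r < r') (hr' : r' ≤ L / 2) :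
    ∃ G : ℕ → Fin k → Cinf n, (∀ j, Fam L μ (fun s => G s j)) ∧
      (∀ s j x, |x i| < r → (G s j).1 x = (F s j).1 x) ∧
      (∀ s a x, (act M (F s) a).1 x = 0 → (act M (G s) a).1 x = 0) ∧
      (∀ s a x, r' ≤ |x i| → |x i| ≤ L / 2 → (act M (G s) a).1 x = 0) := by
  obtain ⟨ψ, hper, hbd, hfree, hone, hzero⟩ := exists_psi L hL i r r' hr hrr hr'
  choose Y hY hYb using fun j => (hF j).div hL hSD
  let Yv : ℕ → Fin k → Cinf n := fun s j => Y j s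
  let D : ℕ → Fin l → Cinf n := fun s a =>
    act M (fun j => cmul ψ (Yv s j)) a - cmul ψ (act M (Yv s) a)
  let G : ℕ → Fin k → Cinf n := fun s j => cmul ψ (F s j) - act Q (D s) j
  have hbY : ∀ s, b • Yv s = F s := fun s => funext fun j => hYb j s
  have hMG : ∀ s a, act M (G s) a = cmul ψ (act M (F s) a) := by
    intro s a
    have e1 : G s = (fun j => cmul ψ (F s j)) - act Q (D s) := rfl
    rw [e1, act_sub, act_act, hQ, act_scalar, Pi.sub_apply, Pi.smul_apply]
    have e2 : b • D s a = act M (fun j => cmul ψ (F s j)) a - cmul ψ (act M (F s) a) := by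
      simp only [D]
      rw [smul_sub]
      congr 1
      · have : b • act M (fun j => cmul ψ (Yv s j)) = act M (b • fun j => cmul ψ (Yv s j)) :=
          (act_psmul _ _ _).symm
        have h2 := congrFun this a
        rw [Pi.smul_apply] at h2
        rw [h2]
        congr 1
        funext j
        rw [Pi.smul_apply, free_cmul i hb ψ hfree, ← hYb j s]
      · rw [free_cmul i hb ψ hfree]
        congr 1
        rw [← hbY s, act_psmul]; rfl
    rw [e2, sub_sub_cancel]
  have hYf : ∀ j, Fam L μ (fun s => Yv s j) := hY
  have hD : ∀ a, Fam L μ (fun s => D s a) := fun a =>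
    (Fam.act M (F := fun s j => cmul ψ (Yv s j)) (fun j => (hYf j).cmul ψ hper hbd) a).sub
      ((Fam.act M hYf a).cmul ψ hper hbd)
  refine ⟨G, fun j => ((hF j).cmul ψ hper hbd).sub (Fam.act Q hD j), ?_, ?_, ?_⟩
  · intro s j x hx
    have hV : IsOpen {x : Fin n → ℝ | |x i| < r} := isOpen_lt (by fun_prop) continuous_const
    have hD0 : ∀ x ∈ {x : Fin n → ℝ | |x i| < r}, ∀ a, (D s a).1 x = ((0 : Fin l → Cinf n) a).1 x := by
      intro x hx a
      have h1 := act_local M hV (f := fun j => cmul ψ (Yv s j)) (g := Yv s)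
        (fun y hy j => by rw [cmul_val, hone y hy, one_mul]) x hx a
      simp only [D, sub_val, cmul_val]
      rw [h1, hone x hx]; simp
    have h2 := act_local Q hV hD0 x hx j
    simp only [G, sub_val, cmul_val]
    rw [h2, act_zero, hone x hx]; simp
  · intro s a x h
    rw [hMG, cmul_val, h, mul_zero]
  · intro s a x h1 h2
    rw [hMG, cmul_val, hzero x h1 h2, zero_mul]

/-- Algebraic data extracted from the height condition. -/
def AlgData (M : Matrix (Fin l) (Fin k) (PA n)) : Type :=
  {p : (Fin n → PA n) × (Fin n → Matrix (Fin k) (Fin l) (PA n)) //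
    (∀ i, M * p.2 i = p.1 i • (1 : Matrix (Fin l) (Fin l) (PA n))) ∧ (∀ i, p.1 i ≠ 0) ∧
    ∀ i, p.1 i ∈ supported ℂ ({i}ᶜ : Set (Fin n))}

/-- The polynomials. -/
def AlgData.b {M : Matrix (Fin l) (Fin k) (PA n)} (A : AlgData M) : Fin n → PA n := A.1.1

/-- The matrices. -/
def AlgData.Q {M : Matrix (Fin l) (Fin k) (PA n)} (A : AlgData M) :
    Fin n → Matrix (Fin k) (Fin l) (PA n) := A.1.2

theorem AlgData.hQ {M : Matrix (Fin l) (Fin k) (PA n)} (A : AlgData M) (i : Fin n) :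
    M * A.Q i = A.b i • (1 : Matrix (Fin l) (Fin l) (PA n)) := A.2.1 i

theorem AlgData.hb0 {M : Matrix (Fin l) (Fin k) (PA n)} (A : AlgData M) (i : Fin n) :
    A.b i ≠ 0 := A.2.2.1 i

theorem AlgData.hb {M : Matrix (Fin l) (Fin k) (PA n)} (A : AlgData M) (i : Fin n) :
    A.b i ∈ supported ℂ ({i}ᶜ : Set (Fin n)) := A.2.2.2 i

theorem stepAll {L : ℝ} (hL : 0 < L) {μ : ℕ → Fin n → ℝ} (M : Matrix (Fin l) (Fin k) (PA n))
    (A : AlgData M) (hSD : ∀ i, SD L μ (A.b i))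
    (F : ℕ → Fin k → Cinf n) (hF : ∀ j, Fam L μ (fun s => F s j))
    (r r' : Fin n → ℝ) (hr : ∀ i, 0 < r i) (hrr : ∀ i, r i < r' i) (hr' : ∀ i, r' i ≤ L / 2)
    (t : Finset (Fin n)) :
    ∃ G : ℕ → Fin k → Cinf n, (∀ j, Fam L μ (fun s => G s j)) ∧
      (∀ s j x, (∀ i ∈ t, |x i| < r i) → (G s j).1 x = (F s j).1 x) ∧
      (∀ s a x, (act M (F s) a).1 x = 0 → (act M (G s) a).1 x = 0) ∧
      (∀ s a x, (∃ i ∈ t, r' i ≤ |x i| ∧ |x i| ≤ L / 2) → (act M (G s) a).1 x = 0) := by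
  classical
  induction t using Finset.induction_on with
  | empty => exact ⟨F, hF, fun _ _ _ _ => rfl, fun _ _ _ h => h, by simp⟩
  | insert i t hi ih =>
    obtain ⟨G, hG, h1, h2, h3⟩ := ih
    obtain ⟨G', hG', h1', h2', h3'⟩ := stepT hL M i (A.b i) (A.Q i) (A.hQ i) (A.hb i) (hSD i) G hG
      (r i) (r' i) (hr i) (hrr i) (hr' i)
    refine ⟨G', hG', fun s j x hx => ?_, fun s a x h => h2' s a x (h2 s a x h), ?_⟩
    · rw [h1' s j x (hx i (Finset.mem_insert_self _ _)),
        h1 s j x (fun i' hi' => hx i' (Finset.mem_insert_of_mem hi'))]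
    · rintro s a x ⟨i', hi', hx⟩
      rcases Finset.mem_insert.1 hi' with rfl | hi'
      · exact h3' s a x hx.1 hx.2
      · exact h2' s a x (h3 s a x ⟨i', hi', hx⟩)

/-- Lemma S+. -/
theorem lemmaS {L c : ℝ} (hL : 0 < L) (hc : c < L / 2) (M : Matrix (Fin l) (Fin k) (PA n))
    (A : AlgData M) (q : PA n) (hq : q ≠ 0)
    (j : Fin n) (σ R : ℝ) (g : Fin k → Cinf n) (hg : ∀ a x, x ∉ cbox n c → (g a).1 x = 0)
    (hgR : ∀ a x, σ * x j < R → (g a).1 x = 0)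
    (r r' : Fin n → ℝ) (hr : ∀ i, 0 < r i) (hrr : ∀ i, r i < r' i) (hr' : ∀ i, r' i ≤ L / 2)
    (hMg : ∀ a x, (∀ i, |x i| < r' i) → (act M g a).1 x = 0) :
    ∃ (lam : Fin n → ℝ) (v : ℕ → Fin k → Cinf n), (∀ s, act M (v s) = 0) ∧
      (∀ s a x, (∀ i, |x i| < r i) → (q • v s a).1 x = (g a).1 x) ∧
      (∀ (p : PA n) a, ∃ (C : ℝ) (N : ℕ), 0 ≤ C ∧ ∀ s x, ‖(p • v s a).1 x‖ ≤
        C * (1 + (s : ℝ)) ^ N * Real.exp (rdot lam x + s * (σ * x j - R))) := by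
  obtain ⟨lam, hSD⟩ := exists_SD L (q * ∏ i, A.b i)
    (mul_ne_zero hq (Finset.prod_ne_zero_iff.2 fun i _ => A.hb0 i)) j σ
  have hSDq := hSD.of_dvd (Dvd.intro _ rfl : q ∣ _)
  have hSDb : ∀ i, SD L (muS lam j σ) (A.b i) := fun i =>
    hSD.of_dvd (Dvd.dvd.mul_left (Finset.dvd_prod_of_mem A.b (Finset.mem_univ i)) q)
  choose F hF hFg using fun a => exists_per_fam L c hL hc lam j σ R (g a) (hg a) (hgR a)
  obtain ⟨G, hG, h1, h2, h3⟩ := stepAll hL M A hSDb (fun s a => F a s) hF r r' hr hrr hr' Finset.univ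
  have hMF : ∀ s a x, (∀ i, |x i| < r' i) → (act M (fun a => F a s) a).1 x = 0 := by
    intro s a x hx
    have hx' : ∀ i, |x i| < L - c := fun i => by linarith [hx i, hr' i]
    have : (act M (fun a => F a s) a).1 x = (Real.exp (s * R) : ℂ) * (act M g a).1 x := by
      simp only [act, sum_val, Finset.mul_sum]
      exact Finset.sum_congr rfl fun b _ => hFg b _ s x hx'
    rw [this, hMg a x hx, mul_zero]
  have hMG : ∀ s, act M (G s) = 0 := by
    intro s
    funext a
    apply ext'
    intro x
    have hcell : ∀ y : Fin n → ℝ, (∀ i, |y i| ≤ L / 2) → (act M (G s) a).1 y = 0 := by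
      intro y hy
      by_cases h : ∃ i, r' i ≤ |y i|
      · obtain ⟨i, hi⟩ := h
        exact h3 s a y ⟨i, Finset.mem_univ _, hi, hy i⟩
      · push Not at h
        exact h2 s a y (hMF s a y h)
    obtain ⟨m, hm⟩ := exists_cell L hL x
    have h4 := (Fam.act M hG a).1 s m x
    rw [hcell (x + lat L m) hm] at h4
    have h5 : (Real.exp (rdot (muS lam j σ s) (lat L m)) : ℂ) ≠ 0 := by
      exact_mod_cast (Real.exp_pos _).ne'
    simpa using (mul_eq_zero.1 h4.symm).resolve_left h5
  choose V hV hVq using fun a => (hG a).div hL hSDq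
  have hMV : ∀ s, act M (fun a => V a s) = 0 := by
    intro s
    funext a
    obtain ⟨_, _, _, hne⟩ := hSDq
    refine qp_unique hL.ne' (fun k => (hne s k).1)
      ((Fam.act M (F := fun s a => V a s) hV a).1 s) ?_
    have := congrFun (act_psmul M q (fun a => V a s)) a
    rw [Pi.smul_apply] at this
    rw [← this]
    have e : (q • fun a => V a s) = G s := funext fun b => hVq b s
    rw [e, hMG]; rfl
  refine ⟨lam, fun s => (Real.exp (-(s * R)) : ℂ) • fun a => V a s, fun s => ?_, ?_, ?_⟩
  · rw [act_csmul, hMV, smul_zero]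
  · intro s a x hx
    beta_reduce
    rw [Pi.smul_apply, psmul_smul, hVq, smul_val, h1 s a x (fun i _ => hx i)]
    have := hFg a 1 s x (fun i => by linarith [hx i, hrr i, hr' i])
    rw [one_smul, one_smul] at this
    rw [this, ← mul_assoc, ← Complex.ofReal_mul, ← Real.exp_add]
    simp
  · intro p a
    obtain ⟨C, N, hC, h⟩ := (hV a).2 p
    refine ⟨C, N, hC, fun s x => ?_⟩
    have h4 := h x s
    beta_reduce at h4 ⊢
    rw [Real.exp_neg, ← div_eq_mul_inv, div_le_iff₀ (Real.exp_pos _), rdot_muS] at h4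
    rw [Pi.smul_apply, psmul_smul, smul_val, norm_mul, Complex.norm_real, Real.norm_eq_abs,
      Real.abs_exp]
    calc _ ≤ Real.exp (-(s * R)) * (C * (1 + (s : ℝ)) ^ N * Real.exp (rdot lam x + s * (σ * x j))) := by
          gcongr
      _ = C * (1 + (s : ℝ)) ^ N * (Real.exp (-(s * R)) * Real.exp (rdot lam x + s * (σ * x j))) := by ring
      _ = _ := by
          rw [← Real.exp_add]; congr 2; ring

end cutoff

end CMH

namespace CMH

open MvPolynomial MeasureTheory Filter Topology

section extension

variable {n : ℕ}

theorem exists_chi (c : ℝ) : ∃ χ : Cinf n, (∀ x ∈ cbox n c, χ.1 x = 1) ∧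
    (∀ x, x ∉ cbox n (c + 1) → χ.1 x = 0) := by
  refine ⟨mk (fun x => ∏ l, ((Real.smoothTransition (c + 1 - x l) : ℂ) *
    (Real.smoothTransition (c + 1 + x l) : ℂ))) ?_, fun x hx => ?_, fun x hx => ?_⟩
  · refine contDiff_prod fun l _ => ContDiff.mul ?_ ?_
    · refine Complex.ofRealCLM.contDiff.comp (Real.smoothTransition.contDiff.comp ?_)
      fun_prop
    · refine Complex.ofRealCLM.contDiff.comp (Real.smoothTransition.contDiff.comp ?_)
      fun_prop
  · rw [mk_val]
    refine Finset.prod_eq_one fun l _ => ?_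
    have := abs_le.1 (hx l)
    rw [Real.smoothTransition.one_of_one_le (by linarith [this.1, this.2]),
      Real.smoothTransition.one_of_one_le (by linarith [this.1, this.2])]
    simp
  · simp only [cbox, Set.mem_ofPred_eq, not_forall, not_le] at hx
    obtain ⟨l, hl⟩ := hx
    rw [mk_val]
    refine Finset.prod_eq_zero (Finset.mem_univ l) ?_
    rcases lt_abs.1 hl with h | h
    · rw [Real.smoothTransition.zero_of_nonpos (by linarith)]; simp
    · rw [Real.smoothTransition.zero_of_nonpos (x := c + 1 + x l) (by linarith)]; simp

theorem exists_tau (j : Fin n) (σ ρ δ : ℝ) (hδ : 0 < δ) : ∃ τ : Cinf n,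
    (∀ x, ρ ≤ σ * x j → τ.1 x = 1) ∧ (∀ x, σ * x j ≤ ρ - δ / 2 → τ.1 x = 0) := by
  have hcd : ContDiff ℝ (⊤ : ℕ∞)
      (fun x : Fin n → ℝ => (Real.smoothTransition ((σ * x j - (ρ - δ / 2)) / (δ / 2)) : ℂ)) := by
    refine Complex.ofRealCLM.contDiff.comp (Real.smoothTransition.contDiff.comp ?_)
    fun_prop
  refine ⟨mk _ hcd, fun x hx => ?_, fun x hx => ?_⟩
  · rw [mk_val, Real.smoothTransition.one_of_one_le]; · simp
    rw [le_div_iff₀ (by positivity)]; linarith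
  · rw [mk_val, Real.smoothTransition.zero_of_nonpos]; · simp
    exact div_nonpos_of_nonpos_of_nonneg (by linarith) (by positivity)

/-- Open box. -/
def obox (r : Fin n → ℝ) : Set (Fin n → ℝ) := {x | ∀ l, |x l| < r l}

theorem obox_open (r : Fin n → ℝ) : IsOpen (obox r) := by
  have : obox r = ⋂ l, {x : Fin n → ℝ | |x l| < r l} := by ext x; simp [obox]
  rw [this]
  exact isOpen_iInter_of_finite fun l => isOpen_lt (by fun_prop) continuous_const

variable [Module (MvPolynomial (Fin n) ℂ) (Cinf n)] [DAct n] {l k : ℕ}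

theorem pow_exp_tendsto (C δ : ℝ) (hδ : 0 < δ) (N : ℕ) :
    Tendsto (fun s : ℕ => C * (1 + (s : ℝ)) ^ N * Real.exp (-(s * δ))) atTop (𝓝 0) := by
  have h1 := Real.tendsto_pow_mul_exp_neg_atTop_nhds_zero N
  have h2 : Tendsto (fun s : ℕ => (1 + (s : ℝ)) * δ) atTop atTop :=
    (tendsto_atTop_add_const_left _ _ tendsto_natCast_atTop_atTop).atTop_mul_const hδ
  have h3 := (h1.comp h2).const_mul (C * (δ ^ N)⁻¹ * Real.exp δ)
  rw [mul_zero] at h3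
  refine h3.congr fun s => ?_
  simp only [Function.comp]
  have : Real.exp (-((1 + (s : ℝ)) * δ)) = Real.exp (-δ) * Real.exp (-(s * δ)) := by
    rw [← Real.exp_add]; congr 1; ring
  rw [this, mul_pow]
  have h5 : Real.exp δ * Real.exp (-δ) = 1 := by rw [← Real.exp_add]; simp
  have h6 : (δ ^ N)⁻¹ * δ ^ N = 1 := inv_mul_cancel₀ (by positivity)
  calc _ = C * (1 + (s : ℝ)) ^ N * Real.exp (-(s * δ)) * ((δ ^ N)⁻¹ * δ ^ N) *
        (Real.exp δ * Real.exp (-δ)) := by ring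
    _ = _ := by rw [h5, h6]; ring

theorem halfStep (M : Matrix (Fin l) (Fin k) (PA n)) (A : AlgData M) (q : PA n) (hq : q ≠ 0)
    (h : Fin k → Cinf n) (hh : act M h = 0) (j : Fin n) (r : Fin n → ℝ) (δ T ε : ℝ) (hδ : 0 < δ)
    (hT : 0 < T) (hε : 0 < ε) (hr : ∀ i, δ < r i) (h0 : ∀ a, ∀ x ∈ obox r, (h a).1 x = 0)
    (S : Finset (PA n)) (σ : ℝ) (hσ : |σ| = 1) :
    ∃ v : Fin k → Cinf n, act M v = 0 ∧
      (∀ a x, x ∈ obox (Function.update (fun i => r i - δ) j T) → r j ≤ σ * x j →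
        (q • v a).1 x = (h a).1 x) ∧
      (∀ a x, x ∈ obox (Function.update (fun i => r i - δ) j T) → σ * x j < r j →
        (q • v a).1 x = 0) ∧
      ∀ p ∈ S, ∀ a, ∀ x ∈ obox (fun i => r i - δ), ‖(p • v a).1 x‖ ≤ ε := by
  classical
  set c0 : ℝ := T + 1 + ∑ i, |r i| with hc0
  have hrc : ∀ i, r i ≤ c0 := fun i => by
    have := Finset.single_le_sum (f := fun i => |r i|) (fun i _ => abs_nonneg _) (Finset.mem_univ i)
    have := le_abs_self (r i)
    linarith
  have hTc : T + 1 ≤ c0 := by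
    have : 0 ≤ ∑ i, |r i| := Finset.sum_nonneg fun i _ => abs_nonneg _
    linarith
  have hsx : ∀ t : ℝ, |σ * t| = |t| := fun t => by rw [abs_mul, hσ, one_mul]
  obtain ⟨χ, hχ1, hχ0⟩ := exists_chi (n := n) c0
  obtain ⟨τ, hτ1, hτ0⟩ := exists_tau j σ (r j) δ hδ
  set r' : Fin n → ℝ := Function.update r j (T + 1) with hr'
  set r2 : Fin n → ℝ := Function.update (fun i => r i - δ) j T with hr2
  have hin : ∀ x, x ∈ obox r' → x ∈ cbox n c0 := by
    intro x hx i
    have := hx i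
    by_cases hij : i = j
    · subst hij; simp [hr'] at this; linarith
    · simp [hr', hij] at this; linarith [hrc i]
  let g : Fin k → Cinf n := fun a => cmul χ (cmul τ (h a))
  -- facts on the tube
  have hlow : ∀ a x, x ∈ obox r' → σ * x j < r j → (g a).1 x = 0 := by
    intro a x hx hxj
    simp only [g, cmul_val]
    by_cases hx2 : x ∈ obox r
    · rw [h0 a x hx2]; simp
    · have hxj2 : r j ≤ |x j| := by
        by_contra hcon
        apply hx2
        intro i
        by_cases hij : i = j
        · subst hij; exact not_le.1 hcon
        · have := hx i; simpa [hr', hij] using this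
      rw [← hsx] at hxj2
      rcases le_abs.1 hxj2 with h5 | h5
      · linarith
      · rw [hτ0 x (by linarith [hr j])]; simp
  have hhigh : ∀ a x, x ∈ obox r' → r j - δ / 4 < σ * x j → (g a).1 x = (h a).1 x := by
    intro a x hx hxj
    by_cases hx2 : r j ≤ σ * x j
    · simp only [g, cmul_val]
      rw [hτ1 x hx2, hχ1 x (hin x hx)]; simp
    · rw [hlow a x hx (not_le.1 hx2), h0 a x]
      intro i
      by_cases hij : i = j
      · subst hij
        rw [← hsx, abs_lt]
        exact ⟨by linarith [hr i], not_le.1 hx2⟩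
      · have := hx i; simpa [hr', hij] using this
  have hMg : ∀ a x, (∀ i, |x i| < r' i) → (act M g a).1 x = 0 := by
    intro a x hx
    by_cases hx2 : σ * x j < r j
    · have hV : IsOpen (obox r' ∩ {x | σ * x j < r j}) :=
        (obox_open r').inter (isOpen_lt (by fun_prop) continuous_const)
      have := act_local M hV (f := g) (g := 0) (fun y hy b => by
        rw [hlow b y hy.1 hy.2]; simp) x ⟨hx, hx2⟩ a
      rw [this, act_zero]; simp
    · have hV : IsOpen (obox r' ∩ {x | r j - δ / 4 < σ * x j}) :=
        (obox_open r').inter (isOpen_lt continuous_const (by fun_prop))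
      have := act_local M hV (f := g) (g := h) (fun y hy b => hhigh b y hy.1 hy.2) x
        ⟨hx, by simp only [Set.mem_ofPred_eq]; linarith⟩ a
      rw [this, hh]; simp
  obtain ⟨lam, v, hv1, hv2, hv3⟩ := lemmaS (L := 2 * (c0 + 1) + 1) (c := c0 + 1)
    (by linarith) (by linarith) M A q hq j σ (r j - δ / 2) g
    (fun a x hx => by simp only [g, cmul_val]; rw [hχ0 x hx, zero_mul])
    (fun a x hx => by simp only [g, cmul_val]; rw [hτ0 x hx.le]; simp)
    r2 r' (fun i => by
      by_cases hij : i = j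
      · subst hij; simpa [hr2] using hT
      · simpa [hr2, hij] using hr i)
    (fun i => by
      by_cases hij : i = j
      · subst hij; simp [hr2, hr']
      · simpa [hr2, hr', hij] using hδ)
    (fun i => by
      by_cases hij : i = j
      · subst hij; simp [hr']; linarith
      · simp [hr', hij]; linarith [hrc i]) hMg
  have hsub : obox r2 ⊆ obox r' := by
    intro x hx i
    have := hx i
    by_cases hij : i = j
    · subst hij; simp [hr2, hr'] at *; linarith
    · simp [hr2, hr', hij] at *; linarith
  have hsmall : ∀ p ∈ S, ∀ᶠ s in atTop, ∀ a, ∀ x ∈ obox (fun i => r i - δ),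
      ‖(p • v s a).1 x‖ ≤ ε := by
    intro p _
    rw [eventually_all]
    intro a
    obtain ⟨C, N, hC, hb⟩ := hv3 p a
    obtain ⟨B, hB⟩ := (cbox_compact (n := n) c0).exists_bound_of_continuousOn
      (f := rdot lam) (rdot_continuous lam).continuousOn
    have ht := pow_exp_tendsto (C * Real.exp B) (δ / 2) (by positivity) N
    filter_upwards [ht.eventually (gt_mem_nhds hε)] with s hs x hx
    refine (hb s x).trans (le_trans ?_ hs.le)
    have hx0 : x ∈ cbox n c0 := fun i => by
      have h5 := hx i
      simp only at h5
      linarith [hrc i]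
    have h6 := (le_abs_self _).trans (hB x hx0)
    have h7 : σ * x j < r j - δ := by
      refine lt_of_le_of_lt (le_abs_self _) ?_
      rw [hsx]; exact hx j
    calc _ ≤ C * (1 + (s : ℝ)) ^ N * Real.exp (B + -(s * (δ / 2))) := by
          gcongr
          have : (s : ℝ) * (σ * x j - (r j - δ / 2)) ≤ s * (-(δ / 2)) := by
            gcongr; linarith
          linarith
      _ = _ := by rw [Real.exp_add]; ring
  obtain ⟨s, hs⟩ := ((eventually_all_finset S).2 hsmall).exists
  refine ⟨v s, hv1 s, fun a x hx hxj => ?_, fun a x hx hxj => ?_, fun p hp a x hx => hs p hp a x hx⟩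
  · rw [hv2 s a x hx, hhigh a x (hsub hx) (by linarith)]
  · rw [hv2 s a x hx, hlow a x (hsub hx) hxj]

theorem stepJ (M : Matrix (Fin l) (Fin k) (PA n)) (A : AlgData M) (q : PA n) (hq : q ≠ 0)
    (f : Fin k → Cinf n) (hf : act M f = 0) (j : Fin n) (r : Fin n → ℝ) (δ T ε : ℝ) (hδ : 0 < δ)
    (hT : 0 < T) (hε : 0 < ε) (hr : ∀ i, δ < r i)
    (S : Finset (PA n)) (u : Fin k → Cinf n) (hu : act M u = 0)
    (huf : ∀ a, ∀ x ∈ obox r, (q • u a).1 x = (f a).1 x) :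
    ∃ u' : Fin k → Cinf n, act M u' = 0 ∧
      (∀ a, ∀ x ∈ obox (Function.update (fun i => r i - δ) j T), (q • u' a).1 x = (f a).1 x) ∧
      ∀ p ∈ S, ∀ a, ∀ x ∈ obox (fun i => r i - δ), ‖(p • (u' a - u a)).1 x‖ ≤ ε := by
  have hh : act M (f - q • u) = 0 := by rw [act_sub, act_psmul, hf, hu]; simp
  have h0 : ∀ a, ∀ x ∈ obox r, ((f - q • u) a).1 x = 0 := by
    intro a x hx
    rw [Pi.sub_apply, Pi.smul_apply, sub_val, huf a x hx, sub_self]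
  obtain ⟨v, hv1, hv2, hv3, hv4⟩ := halfStep M A q hq (f - q • u) hh j r δ T (ε / 2) hδ hT
    (by positivity) hr h0 S 1 (by simp)
  obtain ⟨w, hw1, hw2, hw3, hw4⟩ := halfStep M A q hq (f - q • u) hh j r δ T (ε / 2) hδ hT
    (by positivity) hr h0 S (-1) (by simp)
  refine ⟨u + v + w, by rw [act_add, act_add, hu, hv1, hw1]; simp, fun a x hx => ?_,
    fun p hp a x hx => ?_⟩
  · rw [Pi.add_apply, Pi.add_apply, smul_add, smul_add, add_val, add_val]
    have e : ((f - q • u) a).1 x = (f a).1 x - (q • u a).1 x := by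
      rw [Pi.sub_apply, Pi.smul_apply, sub_val]
    have hrj := hr j
    rcases lt_or_ge (1 * x j) (r j) with h1 | h1
    · rcases lt_or_ge (-1 * x j) (r j) with h2 | h2
      · rw [hv3 a x hx h1, hw3 a x hx h2, add_zero, add_zero]
        apply huf
        intro i
        by_cases hij : i = j
        · subst hij; rw [abs_lt]; constructor <;> linarith
        · have := hx i
          simp [hij] at this
          linarith
      · rw [hv3 a x hx h1, hw2 a x hx h2, e]; ring
    · rw [hv2 a x hx h1, hw3 a x hx (by linarith), e]; ring
  · have e : (u + v + w) a - u a = v a + w a := by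
      simp only [Pi.add_apply]; abel
    rw [e, smul_add, add_val]
    refine (norm_add_le _ _).trans ?_
    linarith [hv4 p hp a x hx, hw4 p hp a x hx]

theorem extCube (M : Matrix (Fin l) (Fin k) (PA n)) (A : AlgData M) (q : PA n) (hq : q ≠ 0)
    (f : Fin k → Cinf n) (hf : act M f = 0) (N : ℝ) (hN : 2 ≤ N) (ε : ℝ) (hε : 0 < ε)
    (S : Finset (PA n)) (u : Fin k → Cinf n) (hu : act M u = 0)
    (huf : ∀ a, ∀ x ∈ obox (fun _ => N), (q • u a).1 x = (f a).1 x) (t : Finset (Fin n)) :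
    ∃ u' : Fin k → Cinf n, act M u' = 0 ∧
      (∀ a, ∀ x ∈ obox (fun i => (if i ∈ t then N + 2 else N) - t.card * (1 / ((n : ℝ) + 1))),
        (q • u' a).1 x = (f a).1 x) ∧
      ∀ p ∈ S, ∀ a, ∀ x ∈ obox (fun _ => N - 1), ‖(p • (u' a - u a)).1 x‖ ≤ t.card * ε := by
  classical
  induction t using Finset.induction_on with
  | empty => exact ⟨u, hu, by simpa using huf, by simp⟩
  | insert j t hj ih =>
    obtain ⟨u1, h1, h2, h3⟩ := ih
    set δ : ℝ := 1 / ((n : ℝ) + 1) with hδ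
    have hδ0 : 0 < δ := by positivity
    have hcard : ((insert j t).card : ℝ) * δ < 1 := by
      have : (insert j t).card ≤ n := by simpa using Finset.card_le_univ (insert j t)
      have h5 : ((insert j t).card : ℝ) ≤ n := by exact_mod_cast this
      rw [hδ, mul_one_div, div_lt_one (by positivity)]; linarith
    rw [Finset.card_insert_of_notMem hj] at hcard ⊢
    push_cast at hcard ⊢
    have hrow : ∀ i, N - t.card * δ ≤ (if i ∈ t then N + 2 else N) - t.card * δ := by
      intro i; split_ifs <;> linarith
    have htδ : 0 ≤ t.card * δ := by positivity
    obtain ⟨u2, g1, g2, g3⟩ := stepJ M A q hq f hf j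
      (fun i => (if i ∈ t then N + 2 else N) - t.card * δ) δ (N + 2) ε hδ0 (by linarith) hε
      (fun i => by linarith [hrow i]) S u1 h1 h2
    refine ⟨u2, g1, fun a x hx => g2 a x fun i => ?_, fun p hp a x hx => ?_⟩
    · have := hx i
      by_cases hij : i = j
      · subst hij
        simp at this ⊢
        linarith
      · simp [hij] at this ⊢
        linarith
    · have e : u2 a - u a = (u2 a - u1 a) + (u1 a - u a) := by abel
      rw [e, smul_add, add_val]
      refine (norm_add_le _ _).trans ?_
      have a1 := g3 p hp a x (fun i => by
        have h6 := hx i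
        have := hrow i
        simp only at h6 ⊢
        linarith)
      have a2 := h3 p hp a x hx
      linarith

theorem extCube' (M : Matrix (Fin l) (Fin k) (PA n)) (A : AlgData M) (q : PA n) (hq : q ≠ 0)
    (f : Fin k → Cinf n) (hf : act M f = 0) (N : ℝ) (hN : 2 ≤ N) (ε : ℝ) (hε : 0 < ε)
    (S : Finset (PA n)) (u : Fin k → Cinf n) (hu : act M u = 0)
    (huf : ∀ a, ∀ x ∈ obox (fun _ => N), (q • u a).1 x = (f a).1 x) :
    ∃ u' : Fin k → Cinf n, act M u' = 0 ∧
      (∀ a, ∀ x ∈ obox (fun _ => N + 1), (q • u' a).1 x = (f a).1 x) ∧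
      ∀ p ∈ S, ∀ a, ∀ x ∈ obox (fun _ => N - 1), ‖(p • (u' a - u a)).1 x‖ ≤ ε := by
  obtain ⟨u', h1, h2, h3⟩ := extCube M A q hq f hf N hN (ε / (n + 1)) (by positivity) S u hu huf
    Finset.univ
  refine ⟨u', h1, fun a x hx => h2 a x fun i => ?_, fun p hp a x hx => (h3 p hp a x hx).trans ?_⟩
  · have h5 := hx i
    have : (n : ℝ) * (1 / ((n : ℝ) + 1)) < 1 := by
      rw [mul_one_div, div_lt_one (by positivity)]; linarith
    simp at h5 ⊢
    simp at this
    linarith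
  · simp only [Finset.card_univ, Fintype.card_fin]
    rw [mul_div_assoc', div_le_iff₀ (by positivity)]
    nlinarith

theorem initCube (M : Matrix (Fin l) (Fin k) (PA n)) (A : AlgData M) (q : PA n) (hq : q ≠ 0)
    (f : Fin k → Cinf n) (hf : act M f = 0) (j : Fin n) :
    ∃ u : Fin k → Cinf n, act M u = 0 ∧
      (∀ a, ∀ x ∈ obox (fun _ => 2), (q • u a).1 x = (f a).1 x) := by
  obtain ⟨χ, hχ1, hχ0⟩ := exists_chi (n := n) 3
  have hin : ∀ x : Fin n → ℝ, x ∈ obox (fun _ => (3 : ℝ)) → x ∈ cbox n 3 := fun x hx i => (hx i).le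
  obtain ⟨lam, v, h1, h2, -⟩ := lemmaS (L := 10) (c := 3 + 1) (by norm_num) (by norm_num) M A q hq j 1
    (-5) (fun a => cmul χ (f a)) (fun a x hx => by rw [cmul_val, hχ0 x hx, zero_mul])
    (fun a x hx => by
      rw [cmul_val, hχ0 x, zero_mul]
      intro h
      have := abs_le.1 (h j)
      linarith [this.1]) (fun _ => 2) (fun _ => 3) (by norm_num) (by norm_num) (by norm_num)
    (fun a x hx => by
      have := act_local M (obox_open (fun _ => 3)) (f := fun a => cmul χ (f a)) (g := f)
        (fun y hy b => by rw [cmul_val, hχ1 y (hin y hy), one_mul]) x hx a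
      rw [this, hf]; simp)
  refine ⟨v 0, h1 0, fun a x hx => ?_⟩
  rw [h2 0 a x hx, cmul_val, hχ1 x (hin x fun i => (hx i).trans (by norm_num)), one_mul]

theorem goalG (M : Matrix (Fin l) (Fin k) (PA n)) (A : AlgData M) (q : PA n) (hq : q ≠ 0)
    (f : Fin k → Cinf n) (hf : act M f = 0) (j : Fin n) :
    ∃ u : Fin k → Cinf n, act M u = 0 ∧ q • u = f := by
  classical
  obtain ⟨e, he⟩ := exists_surjective_nat (Fin n →₀ ℕ)
  let S : ℕ → Finset (PA n) := fun N => (Finset.range N).image fun i => monomial (e i) 1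
  let good : ℕ → (Fin k → Cinf n) → Prop := fun N u => act M u = 0 ∧
    ∀ a, ∀ x ∈ obox (fun _ => (N : ℝ) + 2), (q • u a).1 x = (f a).1 x
  have hstep : ∀ N (u : {u // good N u}), ∃ u' : {u // good (N + 1) u},
      ∀ p ∈ S N, ∀ a, ∀ x ∈ obox (fun _ => (N : ℝ) + 1),
        ‖(p • (u'.1 a - u.1 a)).1 x‖ ≤ (1 / 2) ^ N := by
    intro N u
    obtain ⟨u', h1, h2, h3⟩ := extCube' M A q hq f hf ((N : ℝ) + 2) (by linarith [(Nat.cast_nonneg N : (0 : ℝ) ≤ N)])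
      ((1 / 2) ^ N) (by positivity) (S N) u.1 u.2.1 u.2.2
    refine ⟨⟨u', h1, fun a x hx => h2 a x fun i => ?_⟩, fun p hp a x hx => h3 p hp a x fun i => ?_⟩
    · have := hx i
      simp at this ⊢; linarith
    · have := hx i
      simp at this ⊢; linarith
  choose nxt hnxt using hstep
  obtain ⟨u0, hu0, hu0f⟩ := initCube M A q hq f hf j
  let us : (N : ℕ) → {u // good N u} := fun N => Nat.rec (motive := fun N => {u // good N u})
    ⟨u0, hu0, by simpa using hu0f⟩ (fun N u => nxt N u) N
  have hus : ∀ N, us (N + 1) = nxt N (us N) := fun N => rfl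
  have hdiff : ∀ N, ∀ p ∈ S N, ∀ a, ∀ x ∈ obox (fun _ => (N : ℝ) + 1),
        ‖(p • ((us (N + 1)).1 a - (us N).1 a)).1 x‖ ≤ (1 / 2) ^ N := fun N => by
    rw [hus]; exact hnxt N (us N)
  have hlim : ∀ a, ∃ ua : Cinf n, ∀ (p : PA n) x,
      Tendsto (fun N => (p • (us N).1 a).1 x) atTop (𝓝 ((p • ua).1 x)) := by
    intro a
    obtain ⟨U, hU⟩ := sum_lemma (fun N => (us (N + 1)).1 a - (us N).1 a) (by
      intro p r
      have hB : ∀ N, ∃ B : ℝ, ∀ x : Fin n → ℝ, ‖x‖ < r →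
          ‖(p • ((us (N + 1)).1 a - (us N).1 a)).1 x‖ ≤ B := by
        intro N
        obtain ⟨B, hB⟩ := (isCompact_closedBall (0 : Fin n → ℝ) r).exists_bound_of_continuousOn
          (ccont (p • ((us (N + 1)).1 a - (us N).1 a))).continuousOn
        exact ⟨B, fun x hx => hB x (by simpa using hx.le)⟩
      choose B hB using hB
      choose d hd using he
      obtain ⟨N1, hN1r, hN1⟩ : ∃ N1 : ℕ, r ≤ N1 ∧ ∀ m ∈ p.support, d m < N1 := by
        obtain ⟨Na, hNa⟩ := exists_nat_ge r
        refine ⟨max Na (p.support.sup d + 1), hNa.trans (by exact_mod_cast le_max_left _ _), ?_⟩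
        intro m hm
        exact lt_of_lt_of_le (Nat.lt_succ_of_le (Finset.le_sup hm)) (le_max_right _ _)
      set K : ℝ := ∑ m ∈ p.support, ‖coeff m p‖ with hK
      refine ⟨fun N => K * (1 / 2) ^ N + (if N < N1 then |B N| else 0), ?_, ?_⟩
      · refine (Summable.mul_left _ (summable_geometric_of_lt_one (by norm_num) (by norm_num))).add ?_
        exact summable_of_ne_finset_zero (s := Finset.range N1) fun N hN => by
          rw [if_neg (by simpa using hN)]
      · intro N x hx
        have hK0 : 0 ≤ K * (1 / 2) ^ N := by
          have : 0 ≤ K := Finset.sum_nonneg fun _ _ => norm_nonneg _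
          positivity
        beta_reduce
        by_cases hN : N < N1
        · rw [if_pos hN]
          exact (hB N x hx).trans ((le_abs_self _).trans (by linarith))
        · rw [if_neg hN, add_zero]
          push Not at hN
          set w := (us (N + 1)).1 a - (us N).1 a with hw
          have hp : (p • w).1 x = ∑ m ∈ p.support, coeff m p * ((monomial m (1 : ℂ) : PA n) • w).1 x := by
            conv_lhs => rw [p.as_sum, Finset.sum_smul, sum_val]
            refine Finset.sum_congr rfl fun m _ => ?_
            have : monomial m (coeff m p) = C (coeff m p) * monomial m (1 : ℂ) := by
              rw [C_mul_monomial, mul_one]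
            rw [this, mul_smul, C_smul, smul_val]
          rw [hp, hK, Finset.sum_mul]
          refine (norm_sum_le _ _).trans (Finset.sum_le_sum fun m hm => ?_)
          rw [norm_mul]
          gcongr
          refine hdiff N _ ?_ a x fun i => ?_
          · refine Finset.mem_image.2 ⟨d m, Finset.mem_range.2 ((hN1 m hm).trans_le hN), ?_⟩
            rw [hd]
          · have h1 := norm_le_pi_norm x i
            rw [Real.norm_eq_abs] at h1
            have h2 : (N1 : ℝ) ≤ N := by exact_mod_cast hN
            linarith)
    refine ⟨(us 0).1 a + U, fun p x => ?_⟩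
    have h1 := (hU p x).tendsto_sum_nat.const_add ((p • (us 0).1 a).1 x)
    rw [smul_add, add_val]
    refine h1.congr fun N => ?_
    have : ∀ i, (p • ((us (i + 1)).1 a - (us i).1 a)).1 x =
        (p • (us (i + 1)).1 a).1 x - (p • (us i).1 a).1 x := fun i => by rw [smul_sub, sub_val]
    simp only [this]
    rw [Finset.sum_range_sub (fun i => (p • (us i).1 a).1 x)]; ring
  choose u hu using hlim
  refine ⟨u, ?_, ?_⟩
  · funext i
    apply ext'
    intro x
    have h1 : Tendsto (fun N => (act M (us N).1 i).1 x) atTop (𝓝 ((act M u i).1 x)) := by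
      simp only [act, sum_val]
      exact tendsto_finsetSum _ fun a _ => hu a (M i a) x
    have h2 : ∀ N, (act M (us N).1 i).1 x = 0 := fun N => by rw [(us N).2.1]; simp
    simp only [h2] at h1
    simpa using tendsto_nhds_unique h1 tendsto_const_nhds
  · funext a
    apply ext'
    intro x
    refine tendsto_nhds_unique (hu a q x) ?_
    refine tendsto_const_nhds.congr' ?_
    obtain ⟨N0, hN0⟩ := exists_nat_gt ‖x‖
    filter_upwards [eventually_ge_atTop N0] with N hN
    refine ((us N).2.2 a x fun i => ?_).symm
    have h1 := norm_le_pi_norm x i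
    rw [Real.norm_eq_abs] at h1
    have h2 : (N0 : ℝ) ≤ N := by exact_mod_cast hN
    linarith

theorem controllable_of_algData (M : Matrix (Fin l) (Fin k) (PA n)) (A : AlgData M) (j : Fin n) :
    IsControllable (system M) := by
  intro U₁ U₂ hU f₁ hf₁ f₂ hf₂
  rw [mem_system] at hf₁ hf₂
  set q := A.b j with hq
  obtain ⟨u, hu, huf⟩ := goalG M A q (A.hb0 j) (f₁ - f₂) (by rw [act_sub, hf₁, hf₂, sub_zero]) j
  obtain ⟨χ, hχ1, hχ0⟩ : ∃ χ : Cinf n, (∀ᶠ x in 𝓝ˢ (closure U₁), χ.1 x = 1) ∧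
      (∀ᶠ x in 𝓝ˢ (closure U₂), χ.1 x = 0) := by
    obtain ⟨h, h0, h1, -⟩ := exists_contMDiffMap_zero_one_nhds_of_isClosed (modelWithCornersSelf ℝ (Fin n → ℝ))
      (M := Fin n → ℝ) (n := (⊤ : ℕ∞)) (s := closure U₂) (t := closure U₁) isClosed_closure isClosed_closure
      (Set.disjoint_iff_inter_eq_empty.2 (by rw [Set.inter_comm]; exact hU))
    have hc : ContDiff ℝ (⊤ : ℕ∞) (fun x => h x) := contMDiff_iff_contDiff.1 h.contMDiff
    have hc' : ContDiff ℝ (⊤ : ℕ∞) (fun x => (h x : ℂ)) := Complex.ofRealCLM.contDiff.comp hc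
    refine ⟨mk _ hc', ?_, ?_⟩
    · filter_upwards [h1] with x hx; simp [hx]
    · filter_upwards [h0] with x hx; simp [hx]
  obtain ⟨V₁, hV₁, hUV₁, h1⟩ := mem_nhdsSet_iff_exists.1 hχ1
  obtain ⟨V₂, hV₂, hUV₂, h2⟩ := mem_nhdsSet_iff_exists.1 hχ0
  let Rq : (Fin k → Cinf n) → Fin k → Cinf n := fun w => q • w - act (A.Q j * M) w
  have hRM : ∀ w, act M (Rq w) = 0 := by
    intro w
    simp only [Rq]
    rw [act_sub, act_act, ← Matrix.mul_assoc, A.hQ j, act_psmul, Matrix.smul_mul, Matrix.one_mul]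
    rw [sub_eq_zero]
    funext i
    simp only [act, Pi.smul_apply, Finset.smul_sum, smul_smul, Matrix.smul_apply, smul_eq_mul, hq]
  have hRu : Rq u = f₁ - f₂ := by
    simp only [Rq]
    rw [← act_act, hu, act_zero, sub_zero, huf]
  have hRloc : ∀ (V : Set (Fin n → ℝ)), IsOpen V → ∀ w w' : Fin k → Cinf n,
      (∀ x ∈ V, ∀ a, (w a).1 x = (w' a).1 x) → ∀ x ∈ V, ∀ a, (Rq w a).1 x = (Rq w' a).1 x := by
    intro V hV w w' h x hx a
    simp only [Rq, Pi.sub_apply, Pi.smul_apply, sub_val]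
    rw [act_local _ hV h x hx a, locality q hV (fun y hy => h y hy a) x hx]
  have hR0 : Rq 0 = 0 := by simp only [Rq]; rw [act_zero]; simp
  refine ⟨f₂ + Rq (fun a => cmul χ (u a)), mem_system.2 (by rw [act_add, hf₂, hRM, add_zero]),
    V₁, V₂, hV₁, hV₂, subset_closure.trans hUV₁, subset_closure.trans hUV₂, ?_, ?_⟩
  · intro x hx a
    have := hRloc V₁ hV₁ (fun a => cmul χ (u a)) u (fun y hy b => by
      rw [cmul_val, show χ.1 y = 1 from h1 hy, one_mul]) x hx a
    rw [Pi.add_apply, add_val, this, hRu, Pi.sub_apply, sub_val]; ring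
  · intro x hx a
    have := hRloc V₂ hV₂ (fun a => cmul χ (u a)) 0 (fun y hy b => by
      rw [cmul_val, show χ.1 y = 0 from h2 hy, zero_mul]; simp) x hx a
    rw [Pi.add_apply, add_val, this, hR0]; simp

end extension

end CMH

namespace CMH

open MvPolynomial

section alg1

lemma exists_right_of_minor {R : Type*} [CommRing R] {l k : ℕ} (M : Matrix (Fin l) (Fin k) R)
    {b : R} (hb : b ∈ minorsIdeal M) :
    ∃ Q : Matrix (Fin k) (Fin l) R, M * Q = b • (1 : Matrix (Fin l) (Fin l) R) := by
  unfold minorsIdeal at hb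
  induction hb using Submodule.span_induction with
  | mem x hx =>
    obtain ⟨g, rfl⟩ := hx
    refine ⟨(Matrix.of fun i j => if i = g j then (1 : R) else 0) * (M.submatrix id g).adjugate, ?_⟩
    rw [← Matrix.mul_assoc]
    have : M * (Matrix.of fun i j => if i = g j then (1 : R) else 0) = M.submatrix id g := by
      ext i j
      simp [Matrix.mul_apply]
    rw [this, Matrix.mul_adjugate]
  | zero => exact ⟨0, by simp⟩
  | add x y _ _ hx hy =>
    obtain ⟨Q, hQ⟩ := hx
    obtain ⟨Q', hQ'⟩ := hy
    exact ⟨Q + Q', by rw [Matrix.mul_add, hQ, hQ', add_smul]⟩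
  | smul a x _ hx =>
    obtain ⟨Q, hQ⟩ := hx
    exact ⟨a • Q, by rw [Matrix.mul_smul, hQ, smul_smul, smul_eq_mul]⟩

open Polynomial in
lemma poly_prime_eq {B : Type*} [CommRing B] [IsDomain B] (p q : Ideal B[X]) [hp : p.IsPrime]
    [hq : q.IsPrime] (hpc : ∀ b, Polynomial.C b ∈ p → b = 0) (hqp : q ≤ p) (hq0 : q ≠ ⊥) :
    q = p := by
  classical
  have key : ∀ (J : Ideal B[X]), J ≠ ⊥ → ∃ m ∈ J, m ≠ 0 ∧ ∀ h ∈ J, h ≠ 0 → m.natDegree ≤ h.natDegree := by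
    intro J hJ
    obtain ⟨x, hx, hx0⟩ := Submodule.exists_mem_ne_zero_of_ne_bot hJ
    have hex : ∃ d, ∃ m ∈ J, m ≠ 0 ∧ m.natDegree = d := ⟨_, x, hx, hx0, rfl⟩
    obtain ⟨m, hm, hm0, hmd⟩ := Nat.find_spec hex
    refine ⟨m, hm, hm0, fun h hh hh0 => ?_⟩
    rw [hmd]
    exact Nat.find_min' hex ⟨h, hh, hh0, rfl⟩
  have hp0 : p ≠ ⊥ := fun h => hq0 (le_bot_iff.1 (h ▸ hqp))
  obtain ⟨m, hm, hm0, hmin⟩ := key p hp0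
  obtain ⟨f, hf, hf0, hfmin⟩ := key q hq0
  have hmdeg : 0 < m.natDegree := by
    by_contra h0
    have h0 : m.natDegree = 0 := by omega
    obtain ⟨b, rfl⟩ := Polynomial.natDegree_eq_zero.1 h0
    exact hm0 (by rw [hpc b hm, Polynomial.C_0])
  set c := m.leadingCoeff with hc
  have hc0 : c ≠ 0 := by simpa [hc] using hm0
  have hcp : Polynomial.C c ∉ p := fun h => hc0 (hpc c h)
  have div : ∀ d, ∀ h ∈ p, h.natDegree ≤ d → ∃ N : ℕ, ∃ a, Polynomial.C c ^ N * h = a * m := by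
    intro d
    induction d using Nat.strong_induction_on with
    | _ d ih =>
      intro h hh hd
      by_cases hh0 : h = 0
      · exact ⟨0, 0, by simp [hh0]⟩
      have hle := hmin h hh hh0
      have hlt := Polynomial.natDegree_cancelLeads_lt_of_natDegree_le_natDegree hle
        (lt_of_lt_of_le hmdeg hle)
      have hmem : m.cancelLeads h ∈ p := by
        unfold Polynomial.cancelLeads
        exact p.sub_mem (p.mul_mem_left _ hh) (p.mul_mem_left _ hm)
      obtain ⟨N, a, hNa⟩ := ih _ (lt_of_lt_of_le hlt hd) _ hmem le_rfl
      unfold Polynomial.cancelLeads at hNa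
      rw [Nat.sub_eq_zero_of_le hle, pow_zero, mul_one] at hNa
      refine ⟨N + 1, a + Polynomial.C c ^ N * (Polynomial.C h.leadingCoeff * Polynomial.X ^ (h.natDegree - m.natDegree)), ?_⟩
      rw [add_mul, ← hNa, pow_succ]
      ring
  have hcq : ∀ N : ℕ, Polynomial.C c ^ N ∉ q := fun N h => hcp (hqp (hq.mem_of_pow_mem N h))
  have hmq : m ∈ q := by
    obtain ⟨N, a, h⟩ := div _ f (hqp hf) le_rfl
    have : a * m ∈ q := h ▸ q.mul_mem_left _ hf
    rcases hq.mem_or_mem this with ha | hm'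
    · exfalso
      have hne : Polynomial.C c ^ N * f ≠ 0 := mul_ne_zero (pow_ne_zero _ (by simpa using hc0)) hf0
      have ha0 : a ≠ 0 := by
        rintro rfl
        rw [zero_mul] at h
        exact hne h
      have h1 : (Polynomial.C c ^ N * f).natDegree = f.natDegree := by
        rw [← Polynomial.C_pow, Polynomial.natDegree_C_mul (pow_ne_zero _ hc0)]
      rw [h, Polynomial.natDegree_mul ha0 hm0] at h1
      have := hfmin a ha ha0
      omega
    · exact hm'
  refine le_antisymm hqp fun h hh => ?_
  obtain ⟨N, a, hN⟩ := div _ h hh le_rfl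
  have : Polynomial.C c ^ N * h ∈ q := hN ▸ q.mul_mem_left _ hmq
  exact (hq.mem_or_mem this).resolve_left (hcq N)

/-- `ℂ[x]` as a polynomial ring in the variable `x_i`. -/
def eqv {n : ℕ} (i : Fin n) : PA n ≃ₐ[ℂ] Polynomial (MvPolynomial {j : Fin n // j ≠ i} ℂ) :=
  (renameEquiv ℂ (Equiv.optionSubtypeNe i).symm).trans (optionEquivLeft ℂ {j // j ≠ i})

lemma eqv_rename {n : ℕ} (i : Fin n) (b : MvPolynomial {j : Fin n // j ≠ i} ℂ) :
    eqv i (rename Subtype.val b) = Polynomial.C b := by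
  have : ((eqv i).toAlgHom.comp (rename Subtype.val)) =
      (IsScalarTower.toAlgHom ℂ (MvPolynomial {j : Fin n // j ≠ i} ℂ) (Polynomial (MvPolynomial {j : Fin n // j ≠ i} ℂ))) := by
    ext j : 1
    simp [eqv, Equiv.optionSubtypeNe_symm_of_ne j.2, optionEquivLeft_X_some]
  exact DFunLike.congr_fun this b

lemma pa_prime_eq {n : ℕ} (i : Fin n) (p q : Ideal (PA n)) [hp : p.IsPrime]
    [hq : q.IsPrime] (hpc : ∀ b ∈ supported ℂ ({i}ᶜ : Set (Fin n)), b ∈ p → b = 0)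
    (hqp : q ≤ p) (hq0 : q ≠ ⊥) : q = p := by
  let φ : Polynomial (MvPolynomial {j : Fin n // j ≠ i} ℂ) →+* PA n := (eqv i).symm.toRingEquiv.toRingHom
  have hφ : Function.Surjective φ := (eqv i).symm.surjective
  have hφi : Function.Injective φ := (eqv i).symm.injective
  have h := poly_prime_eq (p.comap φ) (q.comap φ) ?_ (Ideal.comap_mono hqp) ?_
  · exact Ideal.comap_injective_of_surjective φ hφ h
  · intro b hb
    have h1 : φ (Polynomial.C b) = rename Subtype.val b := by
      rw [← eqv_rename]
      exact (eqv i).symm_apply_apply _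
    rw [Ideal.mem_comap, h1] at hb
    have := hpc _ ?_ hb
    · exact rename_injective _ Subtype.val_injective (by rw [this, map_zero])
    · rw [supported_eq_range_rename]
      exact ⟨b, rfl⟩
  · intro h
    apply hq0
    rw [← Ideal.map_comap_of_surjective φ hφ q, h, Ideal.map_bot]

lemma exists_elim {n : ℕ} (i : Fin n) (I : Ideal (PA n)) (hI : I ≠ ⊥) (hh : 2 ≤ idealHeight I) :
    ∃ b ∈ I, b ≠ 0 ∧ b ∈ supported ℂ ({i}ᶜ : Set (Fin n)) := by
  by_contra hcon
  push Not at hcon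
  let S : Submonoid (PA n) :=
    { carrier := {b | b ≠ 0 ∧ b ∈ supported ℂ ({i}ᶜ : Set (Fin n))}
      mul_mem' := fun ha hb => ⟨mul_ne_zero ha.1 hb.1, mul_mem ha.2 hb.2⟩
      one_mem' := ⟨one_ne_zero, one_mem _⟩ }
  obtain ⟨p, hp, hIp, hpS⟩ := Ideal.exists_le_prime_disjoint I S
    (Set.disjoint_left.2 fun b hb hbS => hcon b hb hbS.1 hbS.2)
  have hpc : ∀ b ∈ supported ℂ ({i}ᶜ : Set (Fin n)), b ∈ p → b = 0 := by
    intro b hb hbp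
    by_contra h0
    exact Set.disjoint_left.1 hpS hbp ⟨h0, hb⟩
  obtain ⟨p0, hp0, hp0p⟩ := Ideal.exists_minimalPrimes_le hIp
  have hp0' : p0.IsPrime := hp0.1.1
  have h2 : 2 ≤ Order.height (⟨p0, hp0'⟩ : PrimeSpectrum (PA n)) :=
    hh.trans (iInf_le _ (⟨⟨p0, hp0'⟩, hp0⟩ : {q : PrimeSpectrum (PA n) // q.asIdeal ∈ I.minimalPrimes}))
  obtain ⟨s, hs1, hs2⟩ := Order.exists_series_of_le_height _ (n := 2) h2
  have hlen : s.length = 2 := hs2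
  have h01 : s ⟨0, by omega⟩ < s ⟨1, by omega⟩ := s.strictMono (by simp [Fin.lt_def])
  have h12 : s ⟨1, by omega⟩ < s.last := s.strictMono (by simp [Fin.lt_def, hlen])
  rw [hs1] at h12
  have hq := pa_prime_eq i p (s ⟨1, by omega⟩).asIdeal (hq := (s ⟨1, by omega⟩).2) hpc
    (le_trans (show (s ⟨1, by omega⟩).asIdeal ≤ p0 from h12.le) hp0p) ?_
  · have : p0 ≤ (s ⟨1, by omega⟩).asIdeal := hq ▸ hp0p
    exact absurd h12 (not_lt_of_ge this)
  · intro hb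
    have : s ⟨1, by omega⟩ ≤ s ⟨0, by omega⟩ := by
      show (s ⟨1, by omega⟩).asIdeal ≤ (s ⟨0, by omega⟩).asIdeal
      rw [hb]; exact bot_le
    exact absurd h01 (not_lt_of_ge this)

lemma exists_algData {n l k : ℕ} (M : Matrix (Fin l) (Fin k) (PA n)) (hM : minorsIdeal M ≠ ⊥)
    (hh : 2 ≤ idealHeight (minorsIdeal M)) : Nonempty (AlgData M) := by
  choose b hbI hb0 hbs using fun i => exists_elim i (minorsIdeal M) hM hh
  choose Q hQ using fun i => exists_right_of_minor M (hbI i)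
  exact ⟨⟨(b, Q), hQ, hb0, hbs⟩⟩

end alg1

end CMH

namespace CMH

open MvPolynomial

section alg2

lemma exists_minor_of_rank {K : Type*} [Field K] {l k : ℕ} (A : Matrix (Fin l) (Fin k) K)
    (h : A.rank = l) : ∃ g : Fin l ↪ Fin k, (A.submatrix id g).det ≠ 0 := by
  rw [Matrix.rank_eq_finrank_span_cols] at h
  have hex := Submodule.exists_fun_fin_finrank_span_eq K (Set.range A.col)
  rw [h] at hex
  obtain ⟨f, hf, -, hli⟩ := hex
  choose g hg using hf
  have hfg : f = fun i => A.col (g i) := funext fun i => (hg i).symm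
  rw [hfg] at hli
  have hinj : Function.Injective g := by
    intro a b hab
    exact hli.injective (by simp [hab])
  refine ⟨⟨g, hinj⟩, ?_⟩
  have h2 : LinearIndependent K (Matrix.transpose (A.submatrix id g)).row := hli
  have h3 := Matrix.linearIndependent_rows_iff_isUnit.1 h2
  rw [Matrix.isUnit_iff_isUnit_det, Matrix.det_transpose] at h3
  exact h3.ne_zero

lemma exists_row_rel {R : Type*} [CommRing R] [IsDomain R] {l k : ℕ} (π : R) (hπ : Prime π)
    (N : Matrix (Fin l) (Fin k) R) (hN : ∀ g : Fin l ↪ Fin k, π ∣ (N.submatrix id g).det) :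
    ∃ (lam : Fin l → R) (i0 : Fin l) (r : Fin k → R), ¬ π ∣ lam i0 ∧
      ∀ j, ∑ i, lam i * N i j = π * r j := by
  have hP : (Ideal.span {π}).IsPrime := (Ideal.span_singleton_prime hπ.ne_zero).2 hπ
  let D := R ⧸ Ideal.span {π}
  let K := FractionRing D
  let φ : R →+* K := (algebraMap D K).comp (Ideal.Quotient.mk _)
  have hφ : ∀ x, φ x = 0 ↔ π ∣ x := by
    intro x
    rw [← Ideal.mem_span_singleton, ← Ideal.Quotient.eq_zero_iff_mem]
    exact map_eq_zero_iff (algebraMap D K) (IsFractionRing.injective D K)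
  have hnot : ¬ LinearIndependent K (N.map φ).row := by
    intro hli
    have hr := hli.rank_matrix
    rw [Fintype.card_fin] at hr
    obtain ⟨g, hg⟩ := exists_minor_of_rank _ hr
    apply hg
    have := (hφ _).2 (hN g)
    rw [RingHom.map_det] at this
    exact this
  rw [← LinearIndependent.iff_fractionRing D K, Fintype.not_linearIndependent_iff] at hnot
  obtain ⟨a, ha, i0, hi0⟩ := hnot
  choose lam hlam using fun i => Ideal.Quotient.mk_surjective (a i)
  have hd : ∀ j, π ∣ ∑ i, lam i * N i j := by
    intro j
    rw [← hφ, map_sum]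
    have := congrFun ha j
    rw [Finset.sum_apply] at this
    rw [← show _ = (0 : K) from this]
    refine Finset.sum_congr rfl fun i _ => ?_
    rw [map_mul, Pi.smul_apply, Algebra.smul_def, ← hlam]
    rfl
  choose r hr using hd
  refine ⟨lam, i0, r, ?_, hr⟩
  intro hdv
  apply hi0
  rw [← hlam, Ideal.Quotient.eq_zero_iff_mem, Ideal.mem_span_singleton]
  exact hdv

lemma exists_saturate {R : Type*} [CommRing R] [IsDomain R] {l k : ℕ} (π : R) (hπ : Prime π)
    (g : Fin l ↪ Fin k) (v : ℕ) :
    ∀ M : Matrix (Fin l) (Fin k) R, ¬ π ^ (v + 1) ∣ (M.submatrix id g).det →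
    ∃ (e : ℕ) (N : Matrix (Fin l) (Fin l) R) (M' : Matrix (Fin l) (Fin k) R),
      π ^ e • M' = N * M ∧ ∃ g' : Fin l ↪ Fin k, ¬ π ∣ (M'.submatrix id g').det := by
  induction v with
  | zero =>
    intro M h
    exact ⟨0, 1, M, by simp, g, by simpa using h⟩
  | succ v ih =>
    intro M h
    by_cases hd : ∃ g' : Fin l ↪ Fin k, ¬ π ∣ (M.submatrix id g').det
    · exact ⟨0, 1, M, by simp, hd⟩
    push Not at hd
    obtain ⟨lam, i0, r, hi0, hr⟩ := exists_row_rel π hπ M hd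
    have hdet : π * ((M.updateRow i0 r).submatrix id g).det = lam i0 * (M.submatrix id g).det := by
      have h1 : (M.updateRow i0 r).submatrix id g = (M.submatrix id g).updateRow i0 (r ∘ g) := by
        ext i j
        by_cases hi : i = i0
        · subst hi; simp
        · simp [Matrix.updateRow_ne hi]
      rw [h1, ← Matrix.det_updateRow_smul, ← smul_eq_mul (lam i0), ← Matrix.det_updateRow_sum]
      congr 2
      ext j
      simp [Finset.sum_apply, ← hr]
    obtain ⟨e, N, M', hNM, hg'⟩ := ih (M.updateRow i0 r) (by
      intro hdv
      apply h
      apply hπ.pow_dvd_of_dvd_mul_left _ hi0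
      rw [← hdet, pow_succ' π (v + 1)]
      exact mul_dvd_mul_left _ hdv)
    refine ⟨e + 1, N * (π • (1 : Matrix (Fin l) (Fin l) R)).updateRow i0 lam, M', ?_, hg'⟩
    have h2 : (π • (1 : Matrix (Fin l) (Fin l) R)).updateRow i0 lam * M = π • M.updateRow i0 r := by
      ext i j
      by_cases hi : i = i0
      · subst hi
        simp [Matrix.mul_apply, hr]
      · rw [Matrix.mul_apply]
        simp [Matrix.updateRow_ne hi, Matrix.one_apply]
    rw [Matrix.mul_assoc, h2, Matrix.mul_smul, ← hNM, smul_smul, pow_succ']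

lemma exists_kernel_vec {K : Type*} [Field K] {l k : ℕ} (A A' : Matrix (Fin l) (Fin k) K)
    (hA : ∀ g : Fin l ↪ Fin k, (A.submatrix id g).det = 0)
    (g : Fin l ↪ Fin k) (hA' : (A'.submatrix id g).det ≠ 0) :
    ∃ c : Fin k → K, A.mulVec c = 0 ∧ A'.mulVec c ≠ 0 := by
  by_contra hcon
  push Not at hcon
  have h1 : l ≤ A'.rank := by
    have := Matrix.rank_submatrix_le A' id g
    rwa [Matrix.rank_of_det_ne_zero hA', Fintype.card_fin] at this
  have h2 : A.rank ≤ l := A.rank_le_height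
  have h3 : A.rank ≠ l := fun h => by
    obtain ⟨g, hg⟩ := exists_minor_of_rank A h
    exact hg (hA g)
  have h4 : LinearMap.ker A.mulVecLin ≤ LinearMap.ker A'.mulVecLin := fun c hc => hcon c hc
  have h5 := Submodule.finrank_mono h4
  have h6 := A.mulVecLin.finrank_range_add_finrank_ker
  have h7 := A'.mulVecLin.finrank_range_add_finrank_ker
  have h8 : A.rank = Module.finrank K (LinearMap.range A.mulVecLin) := rfl
  have h9 : A'.rank = Module.finrank K (LinearMap.range A'.mulVecLin) := rfl
  omega

lemma exists_common_prime {n : ℕ} (I : Ideal (PA n)) (hI : I ≠ ⊥) (hh : ¬ 2 ≤ idealHeight I) :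
    ∃ π : PA n, Prime π ∧ ∀ x ∈ I, π ∣ x := by
  rw [not_le, idealHeight, iInf_lt_iff] at hh
  obtain ⟨⟨p, hp⟩, hlt⟩ := hh
  have hp0 : p.asIdeal ≠ ⊥ := fun h => hI (le_bot_iff.1 (h ▸ hp.1.2))
  obtain ⟨π, hπp, hπ⟩ := p.2.exists_mem_prime_of_ne_bot hp0
  refine ⟨π, hπ, fun x hx => ?_⟩
  have hP : (Ideal.span {π}).IsPrime := (Ideal.span_singleton_prime hπ.ne_zero).2 hπ
  let q : PrimeSpectrum (PA n) := ⟨Ideal.span {π}, hP⟩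
  let z : PrimeSpectrum (PA n) := ⟨⊥, Ideal.isPrime_bot⟩
  have hqp : q ≤ p := (Ideal.span_singleton_le_iff_mem _).2 hπp
  have hzq : z < q := by
    refine lt_of_le_of_ne (show (⊥ : Ideal (PA n)) ≤ _ from bot_le) fun h => ?_
    have : (⊥ : Ideal (PA n)) = Ideal.span {π} := congrArg PrimeSpectrum.asIdeal h
    exact hπ.ne_zero (Ideal.span_singleton_eq_bot.1 this.symm)
  have hqe : q = p := by
    by_contra hne
    have h1 := Order.height_add_one_le (lt_of_le_of_ne hqp hne)
    have h2 := Order.height_add_one_le hzq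
    have h3 : (2 : ℕ∞) ≤ Order.height p := by
      calc (2 : ℕ∞) = 0 + 1 + 1 := by norm_num
        _ ≤ Order.height z + 1 + 1 := by gcongr; exact zero_le
        _ ≤ Order.height q + 1 := by gcongr
        _ ≤ _ := h1
    exact absurd hlt (not_lt_of_ge h3)
  have : x ∈ q.asIdeal := hqe ▸ hp.1.2 hx
  exact Ideal.mem_span_singleton.1 this

lemma exists_zero {n : ℕ} (π d : PA n) (hπ : Prime π) (hd : ¬ π ∣ d) :
    ∃ z : Fin n → ℂ, eval z π = 0 ∧ eval z d ≠ 0 := by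
  by_contra hcon
  push Not at hcon
  have hP : (Ideal.span {π}).IsPrime := (Ideal.span_singleton_prime hπ.ne_zero).2 hπ
  apply hd
  rw [← Ideal.mem_span_singleton, ← MvPolynomial.IsPrime.vanishingIdeal_zeroLocus (K := ℂ) (Ideal.span {π}),
    mem_vanishingIdeal_iff]
  intro z hz
  have h1 := mem_zeroLocus_iff.1 hz π (Ideal.mem_span_singleton_self π)
  rw [aeval_eq_eval] at h1 ⊢
  exact hcon z h1

end alg2

section necessity

variable {n : ℕ} [Module (MvPolynomial (Fin n) ℂ) (Cinf n)] [DAct n]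

lemma eq_zero_of_compact (b : PA n) (hb : b ≠ 0) (j : Fin n) (g : Cinf n)
    (hg : ∀ x, x ∉ cbox n 1 → g.1 x = 0) (h : b • g = 0) : g.1 0 = 0 := by
  obtain ⟨lam, C, N, -, hS⟩ := exists_SD (n := n) 4 b hb j 0
  obtain ⟨U, hU⟩ := exists_per 4 1 (by norm_num) (muS lam j 0 0) g hg
  have hQ := per_QP (by norm_num) (by norm_num) hU
  have hbU : b • U = 0 := by
    apply ext'
    intro x
    obtain ⟨m, hm⟩ := exists_cell 4 (by norm_num) x
    rw [hU b x m (fun l => lt_of_le_of_lt (hm l) (by norm_num)), h]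
    simp
  have hU0 := qp_unique (by norm_num) (fun k => (hS 0 k).1) hQ hbU
  have := hU 1 0 0 (by intro l; norm_num)
  rw [hU0, one_smul] at this
  have hl : (0 : Fin n → ℝ) + lat 4 (0 : Fin n → ℤ) = 0 := by
    ext l; simp [lat]
  rw [hl] at this
  simp at this
  exact this

theorem height_of_controllable {l k : ℕ} (M : Matrix (Fin l) (Fin k) (PA n))
    (hM : minorsIdeal M ≠ ⊥) (j : Fin n) (hc : IsControllable (system M)) :
    2 ≤ idealHeight (minorsIdeal M) := by
  by_contra hh
  obtain ⟨π, hπ, hdiv⟩ := exists_common_prime _ hM hh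
  have hg : ∃ g : Fin l ↪ Fin k, (M.submatrix id g).det ≠ 0 := by
    by_contra hcon
    push Not at hcon
    apply hM
    rw [minorsIdeal, Ideal.span_eq_bot]
    rintro x ⟨g, rfl⟩
    exact hcon g
  obtain ⟨g, hg⟩ := hg
  obtain ⟨v, hv⟩ := FiniteMultiplicity.of_prime_left hπ hg
  obtain ⟨e, N, M', hNM, g', hg'⟩ := exists_saturate π hπ g v M hv
  obtain ⟨z, hz, hz'⟩ := exists_zero π _ hπ hg'
  obtain ⟨c, hc0, hc1⟩ := exists_kernel_vec (M.map (eval z)) (M'.map (eval z)) (by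
      intro g
      obtain ⟨a, ha⟩ := hdiv _ (Ideal.subset_span ⟨g, rfl⟩)
      have := congrArg (eval z) ha
      rw [map_mul, hz, zero_mul, RingHom.map_det] at this
      exact this) g' (by
      rw [RingHom.map_det] at hz'
      exact hz')
  let f : Fin k → Cinf n := fun i => c i • expo z
  have hact : ∀ (T : Matrix (Fin l) (Fin k) (PA n)) (i : Fin l),
      act T f i = ((T.map (eval z)).mulVec c i) • expo z := by
    intro T i
    simp only [act, f, Matrix.mulVec, dotProduct, Finset.sum_smul]
    refine Finset.sum_congr rfl fun q _ => ?_
    rw [psmul_smul, smul_expo, smul_smul, Matrix.map_apply, mul_comm]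
  have hf : f ∈ system M := by
    rw [mem_system]
    funext i
    rw [hact, hc0]
    simp
  have h0 : (0 : Fin k → Cinf n) ∈ system M := by
    rw [mem_system, act_zero]
  let U₂ : Set (Fin n → ℝ) := {x | ∃ l, 1 ≤ |x l|}
  have hU₂ : IsClosed U₂ := by
    have : U₂ = ⋃ l : Fin n, {x | 1 ≤ |x l|} := by
      ext x; simp [U₂]
    rw [this]
    exact isClosed_iUnion_of_finite fun l =>
      isClosed_le continuous_const (continuous_abs.comp (continuous_apply l))
  obtain ⟨F, hF, V₁, V₂, hV₁, hV₂, hs1, hs2, he1, he2⟩ := hc {0} U₂ (by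
    rw [closure_singleton, hU₂.closure_eq]
    ext x
    simp only [Set.mem_inter_iff, Set.mem_singleton_iff, Set.mem_empty_iff_false, iff_false, not_and]
    rintro rfl ⟨l, hl⟩
    norm_num at hl) f hf 0 h0
  obtain ⟨i, hi⟩ := Function.ne_iff.1 hc1
  have hsup : ∀ x, x ∉ cbox n 1 → (act M' F i).1 x = 0 := by
    intro x hx
    have hx2 : x ∈ U₂ := by
      by_contra hcon
      apply hx
      intro l
      by_contra hl
      exact hcon ⟨l, (not_le.1 hl).le⟩
    have := act_local M' hV₂ he2 x (hs2 hx2) i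
    rw [this, act_zero]
    rfl
  have hkill : π ^ e • act M' F i = 0 := by
    have h1 : act (π ^ e • M') F = 0 := by
      rw [hNM, ← act_act, mem_system.1 hF, act_zero]
    have h2 := congrFun h1 i
    rw [← show _ = (0 : Cinf n) from h2]
    simp only [act, Finset.smul_sum, Matrix.smul_apply, smul_smul, smul_eq_mul]
  have hz0 := eq_zero_of_compact (π ^ e) (pow_ne_zero _ hπ.ne_zero) j _ hsup hkill
  have h1 := act_local M' hV₁ he1 0 (hs1 rfl) i
  rw [hz0, hact, smul_val, expo_val] at h1
  rcases mul_eq_zero.1 h1.symm with h | h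
  · exact hi h
  · exact Complex.exp_ne_zero _ h

end necessity

end CMH

/-- **Theorem 1.3** (Shankar). Suppose the ideal `𝔦_ℓ` of `ℓ × ℓ` minors of the matrix
`M = P(∂)` is nonzero (so that `ℓ ≤ k`).  Then the distributed system `ℬ(P)` is controllable
if and only if the codimension of the variety of `𝔦_ℓ`, i.e. the height of `𝔦_ℓ`, is at
least `2`. -/
theorem controllable_iff_minors_height (n k ℓ : ℕ) (hn : 0 < n) (hk : 0 < k) (hl : 0 < ℓ)
    (hlk : ℓ ≤ k)
    [Module (MvPolynomial (Fin n) ℂ) (Cinf n)]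
    (hX : ∀ (i : Fin n) (f : Cinf n),
      (((MvPolynomial.X i : MvPolynomial (Fin n) ℂ) • f : Cinf n) : (Fin n → ℝ) → ℂ) =
        fun x => fderiv ℝ (f : (Fin n → ℝ) → ℂ) x (Pi.single i 1))
    (hC : ∀ (c : ℂ) (f : Cinf n),
      ((MvPolynomial.C c : MvPolynomial (Fin n) ℂ) • f : Cinf n) = c • f)
    (M : Matrix (Fin ℓ) (Fin k) (MvPolynomial (Fin n) ℂ))
    (hM : minorsIdeal M ≠ ⊥) :
    IsControllable (system M) ↔ 2 ≤ idealHeight (minorsIdeal M) := by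
  have : CMH.DAct n := ⟨hX, hC⟩
  constructor
  · exact fun h => CMH.height_of_controllable M hM ⟨0, hn⟩ h
  · intro h
    obtain ⟨A⟩ := CMH.exists_algData M hM h
    exact CMH.controllable_of_algData M A ⟨0, hn⟩
end
end

section
/- Suppose ℓ < k. For every d ≥ 0, the set of matrices P(∂) in M_{ℓ,k}(d) for which the ideal 𝔦_ℓ of ℓ×ℓ minors of P(∂) is nonzero and has height at least 2 contains a nonempty Zariski-open subset of M_{ℓ,k}(d); that is, there exists a nonzero polynomial F in N = ℓ·k·(n+d choose n) variables such that for every ℓ×k matrix of degree at most d whose coefficient vector is not a zero of F, the ideal generated by its ℓ×ℓ minors is nonzero of height at least 2 (the unit ideal having height ⊤ by convention). -/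
noncomputable section

/-- The coefficient of the monomial `m` (of degree at most `d`) in the `(i, j)` entry of the
matrix `M`: the coordinates of `M ∈ M_{ℓ,k}(d)` under the identification of `M_{ℓ,k}(d)` with
the affine space `ℂ^N`, `N = ℓ·k·(n+d choose n)`. -/
def matrixCoeffs {n ℓ k d : ℕ} (M : Matrix (Fin ℓ) (Fin k) (MvPolynomial (Fin n) ℂ)) :
    Fin ℓ × Fin k × {m : Fin n →₀ ℕ // m.degree ≤ d} → ℂ :=
  fun v => MvPolynomial.coeff v.2.2.1 (M v.1 v.2.1)

namespace GMH

open MvPolynomial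

/-- restriction to the first coordinate axis -/
def phi {n : ℕ} (z : Fin n) : MvPolynomial (Fin n) ℂ →ₐ[ℂ] Polynomial ℂ :=
  aeval (fun i => if i = z then Polynomial.X else 0)

lemma phi_monomial {n : ℕ} (z : Fin n) (m : Fin n →₀ ℕ) (a : ℂ) :
    phi z (monomial m a) = if m = Finsupp.single z (m z) then Polynomial.monomial (m z) a else 0 := by
  rw [phi, aeval_monomial]
  split_ifs with h
  · rw [h, Finsupp.prod_single_index (by simp)]
    simp [Polynomial.C_mul_X_pow_eq_monomial]
  · have : ∃ i, i ≠ z ∧ m i ≠ 0 := by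
      by_contra! hc
      apply h
      ext i
      by_cases hi : i = z
      · subst hi; simp
      · rw [hc i hi, Finsupp.single_eq_of_ne hi]
    obtain ⟨i, hi, hm⟩ := this
    rw [Finsupp.prod, Finset.prod_eq_zero (i := i) (by simpa using hm) (by simp [hi, hm]), mul_zero]

lemma phi_coeff {n : ℕ} (z : Fin n) (p : MvPolynomial (Fin n) ℂ) (e : ℕ) :
    (phi z p).coeff e = p.coeff (Finsupp.single z e) := by
  induction p using MvPolynomial.induction_on' with
  | monomial m a =>
    rw [phi_monomial, coeff_monomial]
    by_cases h : m = Finsupp.single z e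
    · subst h; simp
    · rw [if_neg h]
      split_ifs with h2
      · rw [Polynomial.coeff_monomial, if_neg]
        rintro rfl; exact h h2
      · simp
  | add p q hp hq => simp [hp, hq]

lemma phi_natDegree {n : ℕ} (z : Fin n) (p : MvPolynomial (Fin n) ℂ) :
    (phi z p).natDegree ≤ p.totalDegree := by
  rw [Polynomial.natDegree_le_iff_coeff_eq_zero]
  intro N hN
  rw [phi_coeff]
  apply coeff_eq_zero_of_totalDegree_lt
  rw [← Finsupp.degree_apply, Finsupp.degree_single]
  exact hN

lemma totalDegree_det_le {n ℓ d : ℕ} (M : Matrix (Fin ℓ) (Fin ℓ) (MvPolynomial (Fin n) ℂ))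
    (h : ∀ i j, (M i j).totalDegree ≤ d) : M.det.totalDegree ≤ ℓ * d := by
  rw [Matrix.det_apply']
  refine totalDegree_finsetSum_le fun s _ => ?_
  have h1 : (∏ i, M (s i) i).totalDegree ≤ ℓ * d := by
    refine (totalDegree_finsetProd _ _).trans ?_
    refine (Finset.sum_le_sum (fun i _ => h (s i) i)).trans ?_
    simp
  rcases Int.units_eq_one_or (Equiv.Perm.sign s) with hs | hs <;> simp [hs, h1]

/-- generic univariate matrix -/
def U {n : ℕ} (ℓ k d : ℕ) (z : Fin n) : Matrix (Fin ℓ) (Fin k)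
    (Polynomial (MvPolynomial (Fin ℓ × Fin k × {m : Fin n →₀ ℕ // m.degree ≤ d}) ℂ)) :=
  fun i j => ∑ e : Fin (d + 1), Polynomial.monomial e.1
    (X (i, j, ⟨Finsupp.single z e.1, by rw [Finsupp.degree_single]; omega⟩))

lemma U_spec {n ℓ k d : ℕ} (z : Fin n) (M : Matrix (Fin ℓ) (Fin k) (MvPolynomial (Fin n) ℂ))
    (h : ∀ i j, (M i j).totalDegree ≤ d) (i j) :
    (U ℓ k d z i j).map (eval (matrixCoeffs (d := d) M)) = phi z (M i j) := by
  ext e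
  rw [phi_coeff, U, Polynomial.map_sum, Polynomial.finsetSum_coeff]
  simp only [Polynomial.map_monomial, eval_X, matrixCoeffs, Polynomial.coeff_monomial]
  by_cases he : e < d + 1
  · rw [Finset.sum_eq_single ⟨e, he⟩]
    · simp
    · intro b _ hb
      rw [if_neg]; intro hbe; apply hb; ext; exact hbe
    · simp
  · rw [Finset.sum_eq_zero]
    · symm
      apply coeff_eq_zero_of_totalDegree_lt
      rw [← Finsupp.degree_apply, Finsupp.degree_single]
      have := h i j
      omega
    · intro b _
      rw [if_neg]; have := b.2; omega

lemma U_det {n ℓ k d : ℕ} (z : Fin n) (M : Matrix (Fin ℓ) (Fin k) (MvPolynomial (Fin n) ℂ))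
    (h : ∀ i j, (M i j).totalDegree ≤ d) (g : Fin ℓ → Fin k) :
    ((U ℓ k d z).submatrix id g).det.map (eval (matrixCoeffs (d := d) M))
      = phi z (M.submatrix id g).det := by
  rw [← Polynomial.coe_mapRingHom, RingHom.map_det, AlgHom.map_det]
  congr 1
  ext1 i j
  exact U_spec z M h i (g j)

/-- the polynomial -/
def FF {n : ℕ} (ℓ k d : ℕ) (z : Fin n) (g₁ g₂ : Fin ℓ → Fin k) :
    MvPolynomial (Fin ℓ × Fin k × {m : Fin n →₀ ℕ // m.degree ≤ d}) ℂ :=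
  ((U ℓ k d z).submatrix id g₁).det.coeff (ℓ * d) *
  ((U ℓ k d z).submatrix id g₂).det.coeff (ℓ * d) *
  Polynomial.resultant ((U ℓ k d z).submatrix id g₁).det ((U ℓ k d z).submatrix id g₂).det
    (ℓ * d) (ℓ * d)

lemma FF_eval {n ℓ k d : ℕ} (z : Fin n) (M : Matrix (Fin ℓ) (Fin k) (MvPolynomial (Fin n) ℂ))
    (h : ∀ i j, (M i j).totalDegree ≤ d) (g₁ g₂ : Fin ℓ → Fin k) :
    eval (matrixCoeffs (d := d) M) (FF ℓ k d z g₁ g₂) =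
      (phi z (M.submatrix id g₁).det).coeff (ℓ * d) *
      (phi z (M.submatrix id g₂).det).coeff (ℓ * d) *
      Polynomial.resultant (phi z (M.submatrix id g₁).det) (phi z (M.submatrix id g₂).det)
        (ℓ * d) (ℓ * d) := by
  rw [FF, map_mul, map_mul, ← Polynomial.resultant_map_map, U_det z M h, U_det z M h,
    ← U_det z M h, ← U_det z M h, Polynomial.coeff_map, Polynomial.coeff_map]

/-- witness -/
def W {n : ℕ} (ℓ k d : ℕ) (z : Fin n) : Matrix (Fin ℓ) (Fin k) (MvPolynomial (Fin n) ℂ) :=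
  fun i j => if j.1 = i.1 then X z ^ d else if j.1 = i.1 + 1 then (X z + 1) ^ d else 0

lemma W_deg {n ℓ k d : ℕ} (z : Fin n) (i j) : (W ℓ k d z i j).totalDegree ≤ d := by
  unfold W
  split_ifs
  · simp
  · refine (totalDegree_pow _ _).trans ?_
    have : (X z + 1 : MvPolynomial (Fin n) ℂ).totalDegree ≤ 1 :=
      (totalDegree_add _ _).trans (by simp)
    nlinarith
  · simp

lemma W_det1 {n ℓ k d : ℕ} (z : Fin n) (g : Fin ℓ → Fin k) (hg : ∀ i, (g i).1 = i.1) :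
    ((W ℓ k d z).submatrix id g).det = X z ^ (ℓ * d) := by
  rw [Matrix.det_of_isUpperTriangular]
  · simp [W, hg, ← pow_mul, mul_comm]
  · intro i j hij
    have : j.1 < i.1 := hij
    simp only [Matrix.submatrix_apply, W, hg, id]
    rw [if_neg (by omega), if_neg (by omega)]

lemma W_det2 {n ℓ k d : ℕ} (z : Fin n) (g : Fin ℓ → Fin k) (hg : ∀ i, (g i).1 = i.1 + 1) :
    ((W ℓ k d z).submatrix id g).det = (X z + 1) ^ (ℓ * d) := by
  rw [Matrix.det_of_isLowerTriangular]
  · simp [W, hg, ← pow_mul, mul_comm]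
  · intro i j hij
    have : i.1 < j.1 := hij
    simp only [Matrix.submatrix_apply, W, hg, id]
    rw [if_neg (by omega), if_neg (by omega)]

lemma FF_ne_zero {n ℓ k d : ℕ} (z : Fin n) (g₁ g₂ : Fin ℓ → Fin k)
    (h1 : ∀ i, (g₁ i).1 = i.1) (h2 : ∀ i, (g₂ i).1 = i.1 + 1) :
    FF ℓ k d z g₁ g₂ ≠ 0 := by
  intro h0
  have h := FF_eval z (W ℓ k d z) (W_deg z) g₁ g₂
  rw [h0, map_zero, W_det1 z g₁ h1, W_det2 z g₂ h2] at h
  have e1 : phi z (X z ^ (ℓ * d)) = Polynomial.X ^ (ℓ * d) := by simp [phi]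
  have e2 : phi z ((X z + 1) ^ (ℓ * d)) = (Polynomial.X + Polynomial.C 1) ^ (ℓ * d) := by
    simp [phi]
  rw [e1, e2] at h
  have d2 : ((Polynomial.X + Polynomial.C 1 : Polynomial ℂ) ^ (ℓ * d)).natDegree = ℓ * d := by
    rw [Polynomial.natDegree_pow, Polynomial.natDegree_X_add_C, mul_one]
  have c2 : ((Polynomial.X + Polynomial.C 1 : Polynomial ℂ) ^ (ℓ * d)).coeff (ℓ * d) = 1 := by
    have := ((Polynomial.monic_X_add_C (1 : ℂ)).pow (ℓ * d)).coeff_natDegree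
    rwa [d2] at this
  have hc : IsCoprime (Polynomial.X ^ (ℓ * d) : Polynomial ℂ)
      ((Polynomial.X + Polynomial.C 1) ^ (ℓ * d)) :=
    IsCoprime.pow ⟨-1, 1, by simp⟩
  have hr := Polynomial.resultant_ne_zero _ _ hc
  rw [d2, Polynomial.natDegree_X_pow] at hr
  rw [c2, Polynomial.coeff_X_pow_self, one_mul, one_mul] at h
  exact hr h.symm

lemma two_le_height {n : ℕ} (I : Ideal (MvPolynomial (Fin n) ℂ))
    (f g : MvPolynomial (Fin n) ℂ) (hf : f ∈ I) (hg : g ∈ I) (hf0 : f ≠ 0)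
    (h : ∀ q, Prime q → q ∣ f → q ∣ g → False) : 2 ≤ idealHeight I := by
  refine le_iInf fun ⟨p, hp⟩ => ?_
  have hpI : I ≤ p.asIdeal := hp.1.2
  obtain ⟨q, hqp, hq⟩ : ∃ q, q ∣ f ∧ Prime q ∧ q ∈ p.asIdeal := by
    obtain ⟨s, hs, u, hu⟩ := UniqueFactorizationMonoid.exists_prime_factors f hf0
    have h1 : s.prod ∈ p.asIdeal := by
      have h2 : s.prod * u ∈ p.asIdeal := hu ▸ hpI hf
      exact (p.isPrime.mem_or_mem h2).resolve_right
        fun h3 => p.isPrime.ne_top (Ideal.eq_top_of_isUnit_mem _ h3 u.isUnit)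
    obtain ⟨q, hqs, hqp⟩ := p.isPrime.multiset_prod_mem_iff_exists_mem s |>.1 h1
    exact ⟨q, (Multiset.dvd_prod hqs).trans (Dvd.intro _ hu), hs q hqs, hqp⟩
  obtain ⟨hq, hqm⟩ := hq
  have hP : (Ideal.span {q}).IsPrime := (Ideal.span_singleton_prime hq.ne_zero).2 hq
  let b : PrimeSpectrum (MvPolynomial (Fin n) ℂ) := ⟨⊥, Ideal.isPrime_bot⟩
  let c : PrimeSpectrum (MvPolynomial (Fin n) ℂ) := ⟨Ideal.span {q}, hP⟩
  have hbc : b < c := by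
    change (⊥ : Ideal _) < Ideal.span {q}
    rw [bot_lt_iff_ne_bot, Ne, Ideal.span_singleton_eq_bot]
    exact hq.ne_zero
  have hcp : c < p := by
    change Ideal.span {q} < p.asIdeal
    refine lt_of_le_of_ne ((Ideal.span_singleton_le_iff_mem _).2 hqm) ?_
    intro he
    have : g ∈ Ideal.span {q} := he ▸ hpI hg
    exact h q hq hqp (Ideal.mem_span_singleton.1 this)
  have h1 := Order.height_add_one_le hbc
  have h2 := Order.height_add_one_le hcp
  calc (2 : ℕ∞) = 0 + 1 + 1 := by norm_num
    _ ≤ Order.height b + 1 + 1 := by gcongr; exact zero_le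
    _ ≤ Order.height c + 1 := by gcongr
    _ ≤ _ := h2

lemma no_common {n D : ℕ} (z : Fin n) (f g : MvPolynomial (Fin n) ℂ)
    (hfD : f.totalDegree ≤ D) (hgD : g.totalDegree ≤ D)
    (hf : (phi z f).coeff D ≠ 0) (hg : (phi z g).coeff D ≠ 0)
    (hr : Polynomial.resultant (phi z f) (phi z g) D D ≠ 0)
    (q : MvPolynomial (Fin n) ℂ) (hq : Prime q) (h1 : q ∣ f) (h2 : q ∣ g) : False := by
  have df : (phi z f).natDegree = D :=
    le_antisymm ((phi_natDegree z f).trans hfD) (Polynomial.le_natDegree_of_ne_zero hf)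
  have dg : (phi z g).natDegree = D :=
    le_antisymm ((phi_natDegree z g).trans hgD) (Polynomial.le_natDegree_of_ne_zero hg)
  have f0 : phi z f ≠ 0 := by intro h; simp [h] at hf
  have hc : IsCoprime (phi z f) (phi z g) := by
    by_contra hc
    apply hr
    have := (Polynomial.resultant_eq_zero_iff (f := phi z f) (g := phi z g)).2 ⟨Or.inl f0, hc⟩
    rwa [df, dg] at this
  have hu : IsUnit (phi z q) := hc.isUnit_of_dvd' (map_dvd _ h1) (map_dvd _ h2)
  obtain ⟨r, rfl⟩ := h1
  have r0 : r ≠ 0 := by rintro rfl; simp at f0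
  rw [totalDegree_mul_of_isDomain hq.ne_zero r0] at hfD
  rw [map_mul] at df f0
  rw [Polynomial.natDegree_mul (left_ne_zero_of_mul f0) (right_ne_zero_of_mul f0),
    Polynomial.natDegree_eq_zero_of_isUnit hu] at df
  have := phi_natDegree z r
  have hq0 : q.totalDegree = 0 := by omega
  rw [totalDegree_eq_zero_iff_eq_C] at hq0
  apply hq.not_isUnit
  rw [hq0]
  refine IsUnit.map C (isUnit_iff_ne_zero.2 fun h => hq.ne_zero ?_)
  rw [hq0, h, C_0]

end GMH

/-- In the strictly underdetermined case `ℓ < k`, generically the ideal of maximal minors is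
nonzero of height at least `2`: the set of matrices in `M_{ℓ,k}(d)` whose ideal `𝔦_ℓ` of
`ℓ × ℓ` minors is nonzero and has height at least `2` contains a nonempty Zariski-open subset;
i.e. there is a nonzero polynomial `F` in the `N = ℓ·k·(n+d choose n)` coefficient variables
such that for every `ℓ × k` matrix of degree at most `d` whose coefficient vector does not
annihilate `F`, the ideal of its `ℓ × ℓ` minors is nonzero of height at least `2`. -/
theorem generic_minors_height (n k ℓ d : ℕ) (hn : 0 < n) (hl : 0 < ℓ) (hlk : ℓ < k) :
    ∃ F : MvPolynomial (Fin ℓ × Fin k × {m : Fin n →₀ ℕ // m.degree ≤ d}) ℂ,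
      F ≠ 0 ∧
      ∀ M : Matrix (Fin ℓ) (Fin k) (MvPolynomial (Fin n) ℂ),
        (∀ i j, (M i j).totalDegree ≤ d) →
        MvPolynomial.eval (matrixCoeffs (d := d) M) F ≠ 0 →
        minorsIdeal M ≠ ⊥ ∧ 2 ≤ idealHeight (minorsIdeal M) := by
  let z : Fin n := ⟨0, hn⟩
  let g₁ : Fin ℓ ↪ Fin k := ⟨fun i => ⟨i.1, by omega⟩, fun a b h => by
    ext; simpa using h⟩
  let g₂ : Fin ℓ ↪ Fin k := ⟨fun i => ⟨i.1 + 1, by omega⟩, fun a b h => by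
    ext; simpa using h⟩
  refine ⟨GMH.FF ℓ k d z g₁ g₂, GMH.FF_ne_zero z g₁ g₂ (fun _ => rfl) (fun _ => rfl), ?_⟩
  intro M hM hF
  rw [GMH.FF_eval z M hM] at hF
  have hr := right_ne_zero_of_mul hF
  have hf := left_ne_zero_of_mul (left_ne_zero_of_mul hF)
  have hg := right_ne_zero_of_mul (left_ne_zero_of_mul hF)
  have m1 : (M.submatrix id g₁).det ∈ minorsIdeal M := Ideal.subset_span ⟨g₁, rfl⟩
  have m2 : (M.submatrix id g₂).det ∈ minorsIdeal M := Ideal.subset_span ⟨g₂, rfl⟩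
  have f0 : (M.submatrix id g₁).det ≠ 0 := by
    intro h; rw [h] at hf; simp at hf
  refine ⟨fun hb => f0 ?_, GMH.two_le_height _ _ _ m1 m2 f0 ?_⟩
  · rw [hb] at m1; simpa using m1
  · exact GMH.no_common z _ _ (GMH.totalDegree_det_le _ fun i j => hM _ _)
      (GMH.totalDegree_det_le _ fun i j => hM _ _) hf hg hr
end
end

section
/- (Malgrange–Palamodov) The space C^∞ = C^∞(ℝⁿ, ℂ) of smooth complex-valued functions on ℝⁿ, regarded as a module over the polynomial ring A = ℂ[∂₁,…,∂ₙ] acting by partial differentiation, is a cogenerator: for every finitely generated A-module M and every nonzero element m ∈ M, there exists an A-module homomorphism φ : M → C^∞ with φ(m) ≠ 0; in particular, if Hom_A(M, C^∞) = 0 then M = 0. -/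
noncomputable section

open NormedSpace in
lemma aux_exp {𝔸 : Type*} [NormedRing 𝔸] [NormedAlgebra ℝ 𝔸] [CompleteSpace 𝔸] {n : ℕ}
    (T : Fin n → 𝔸) (hT : ∀ i j, Commute (T i) (T j)) :
    ContDiff ℝ (⊤ : ℕ∞) (fun x : Fin n → ℝ => exp (∑ i, x i • T i)) ∧
    ∀ (x : Fin n → ℝ) (i : Fin n),
      fderiv ℝ (fun x : Fin n → ℝ => exp (∑ i, x i • T i)) x (Pi.single i 1)
        = exp (∑ i, x i • T i) * T i := by
  let : NormedAlgebra ℚ 𝔸 := NormedAlgebra.restrictScalars ℚ ℝ 𝔸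
  have hexp : ContDiff ℝ (⊤ : ℕ∞) (exp : 𝔸 → 𝔸) :=
    contDiff_iff_contDiffAt.2 fun x => (exp_analytic (𝕂 := ℝ) x).contDiffAt
  have hc : ContDiff ℝ (⊤ : ℕ∞) (fun x : Fin n → ℝ => exp (∑ i, x i • T i)) := by
    apply hexp.comp
    fun_prop
  refine ⟨hc, fun x i => ?_⟩
  have hd : DifferentiableAt ℝ (fun x : Fin n → ℝ => exp (∑ i, x i • T i)) x :=
    (hc.differentiable (by simp)).differentiableAt
  rw [← hd.lineDeriv_eq_fderiv]
  apply HasLineDerivAt.lineDeriv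
  unfold HasLineDerivAt
  have h1 : (fun t : ℝ => exp (∑ j, (x + t • (Pi.single i 1 : Fin n → ℝ)) j • T j))
      = fun t : ℝ => exp (∑ j, x j • T j) * exp (t • T i) := by
    funext t
    rw [← exp_add_of_commute]
    · congr 1
      simp [add_smul, Finset.sum_add_distrib, Pi.single_apply]
    · apply Commute.smul_right
      apply Commute.symm
      apply Commute.sum_right
      intro j _
      exact (hT i j).smul_right _
  rw [h1]
  have := (hasDerivAt_exp_smul_const (𝕂 := ℝ) (T i) (0 : ℝ)).const_mul (exp (∑ j, x j • T j))
  simpa using this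

lemma aux_linear (n : ℕ)
    [Module (MvPolynomial (Fin n) ℂ) (Cinf n)]
    (hX : ∀ (i : Fin n) (f : Cinf n),
      (((MvPolynomial.X i : MvPolynomial (Fin n) ℂ) • f : Cinf n) : (Fin n → ℝ) → ℂ) =
        fun x => fderiv ℝ (f : (Fin n → ℝ) → ℂ) x (Pi.single i 1))
    (hC : ∀ (c : ℂ) (f : Cinf n),
      ((MvPolynomial.C c : MvPolynomial (Fin n) ℂ) • f : Cinf n) = c • f)
    (N : Type*) [AddCommGroup N] [Module (MvPolynomial (Fin n) ℂ) N]
    [Module ℂ N] [IsScalarTower ℂ (MvPolynomial (Fin n) ℂ) N] [Module.Finite ℂ N]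
    (v : N) (hv : v ≠ 0) :
    ∃ φ : N →ₗ[MvPolynomial (Fin n) ℂ] Cinf n, φ v ≠ 0 := by
  obtain ⟨l, hl⟩ : ∃ l : N →ₗ[ℂ] ℂ, l v ≠ 0 := by
    by_contra! h
    exact hv ((Module.forall_dual_apply_eq_zero_iff ℂ v).1 h)
  let e := (Module.finBasis ℂ N).equivFun
  let E := Fin (Module.finrank ℂ N) → ℂ
  let T : Fin n → (E →L[ℂ] E) := fun i => LinearMap.toContinuousLinearMap
    (e.conj (Algebra.lsmul ℂ ℂ N (MvPolynomial.X i : MvPolynomial (Fin n) ℂ)))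
  have hTe : ∀ i w, T i (e w) = e ((MvPolynomial.X i : MvPolynomial (Fin n) ℂ) • w) := by
    intro i w
    simp [T, LinearEquiv.conj_apply]
  have hT : ∀ i j, Commute (T i) (T j) := by
    intro i j
    ext1 y
    obtain ⟨w, rfl⟩ := e.surjective y
    change T i (T j (e w)) = T j (T i (e w))
    rw [hTe, hTe, hTe, hTe, smul_comm]
  let : NormedAlgebra ℝ (E →L[ℂ] E) := NormedAlgebra.restrictScalars ℝ ℂ _
  obtain ⟨hsm, hder⟩ := aux_exp T hT
  set F : (Fin n → ℝ) → (E →L[ℂ] E) := fun x => NormedSpace.exp (∑ i, x i • T i) with hF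
  let L : E →L[ℂ] ℂ := LinearMap.toContinuousLinearMap (l ∘ₗ e.symm.toLinearMap)
  have hLe : ∀ w, L (e w) = l w := by intro w; simp [L]
  let ev : E → ((E →L[ℂ] E) →L[ℝ] ℂ) := fun y =>
    LinearMap.toContinuousLinearMap
    { toFun := fun S => L (S y)
      map_add' := by intro a b; simp
      map_smul' := by
        intro a b
        change L (((a : ℂ) • b) y) = _
        simp }
  have hev : ∀ y S, ev y S = L (S y) := fun y S => rfl
  have hsm' : ∀ w : N, ContDiff ℝ (⊤ : ℕ∞) (fun x => L (F x (e w))) := fun w =>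
    (ev (e w)).contDiff.comp hsm
  let ψ : N →ₗ[ℂ] Cinf n :=
    { toFun := fun w => ⟨fun x => L (F x (e w)), hsm' w⟩
      map_add' := by
        intro a b
        ext x
        simp
      map_smul' := by
        intro a b
        ext x
        simp }
  have hψ : ∀ w x, (ψ w : (Fin n → ℝ) → ℂ) x = L (F x (e w)) := fun w x => rfl
  have hψX : ∀ (i : Fin n) (w : N), ψ ((MvPolynomial.X i : MvPolynomial (Fin n) ℂ) • w)
      = (MvPolynomial.X i : MvPolynomial (Fin n) ℂ) • ψ w := by
    intro i w
    apply Subtype.ext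
    rw [hX]
    funext x
    have hd : DifferentiableAt ℝ F x := (hsm.differentiable (by simp)).differentiableAt
    have h2 : HasFDerivAt (fun x => L (F x (e w))) ((ev (e w)).comp (fderiv ℝ F x)) x :=
      (ev (e w)).hasFDerivAt.comp x hd.hasFDerivAt
    change _ = fderiv ℝ (fun x => L (F x (e w))) x _
    rw [h2.fderiv, ContinuousLinearMap.comp_apply, hder, hev, hψ, ← hTe]
    rfl
  have hψA : ∀ (p : MvPolynomial (Fin n) ℂ) (w : N), ψ (p • w) = p • ψ w := by
    intro p
    induction p using MvPolynomial.induction_on with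
    | C c =>
      intro w
      rw [hC, ← MvPolynomial.algebraMap_eq, algebraMap_smul, map_smul]
    | add p q hp hq =>
      intro w
      rw [add_smul, add_smul, map_add, hp, hq]
    | mul_X p i hp =>
      intro w
      rw [mul_smul, mul_smul, hp, hψX]
  refine ⟨{ toFun := ψ, map_add' := ψ.map_add, map_smul' := hψA }, fun h => hl ?_⟩
  have h0 : (ψ v : (Fin n → ℝ) → ℂ) 0 = 0 := by
    have : ψ v = 0 := h
    rw [this]
    rfl
  rw [hψ] at h0
  rw [← hLe]
  have hs : ∑ i, (0 : Fin n → ℝ) i • T i = 0 :=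
    Finset.sum_eq_zero fun i _ => zero_smul ℝ (T i)
  have hF0 : F 0 = 1 := by
    rw [hF]
    change NormedSpace.exp (∑ i, (0 : Fin n → ℝ) i • T i) = 1
    rw [hs, NormedSpace.exp_zero]
  rw [hF0] at h0
  exact h0

lemma aux_finite (n : ℕ) (I : Ideal (MvPolynomial (Fin n) ℂ)) [hI : I.IsMaximal] (k : ℕ) :
    Module.Finite ℂ (MvPolynomial (Fin n) ℂ ⧸ I ^ k) := by
  rw [Module.finite_iff_krullDimLE_zero, Ideal.krullDimLE_zero_quotient_iff_forall_minimalPrimes_isMaximal]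
  intro J hJ
  have hp : J.IsPrime := hJ.1.1
  have hle : I ≤ J := Ideal.IsPrime.le_of_pow_le hJ.1.2
  rwa [← hI.eq_of_le hp.ne_top hle]

/-- **Malgrange–Palamodov**: `C^∞(ℝⁿ, ℂ)`, as a module over `A = ℂ[∂₁, …, ∂ₙ]` acting by
partial differentiation, is a cogenerator: every nonzero element of any finitely generated
`A`-module is detected by some homomorphism into `C^∞`. -/
theorem smooth_functions_cogenerator (n : ℕ) (hn : 0 < n)
    [Module (MvPolynomial (Fin n) ℂ) (Cinf n)]
    (hX : ∀ (i : Fin n) (f : Cinf n),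
      (((MvPolynomial.X i : MvPolynomial (Fin n) ℂ) • f : Cinf n) : (Fin n → ℝ) → ℂ) =
        fun x => fderiv ℝ (f : (Fin n → ℝ) → ℂ) x (Pi.single i 1))
    (hC : ∀ (c : ℂ) (f : Cinf n),
      ((MvPolynomial.C c : MvPolynomial (Fin n) ℂ) • f : Cinf n) = c • f)
    (M : Type*) [AddCommGroup M] [Module (MvPolynomial (Fin n) ℂ) M]
    [Module.Finite (MvPolynomial (Fin n) ℂ) M]
    (m : M) (hm : m ≠ 0) :
    ∃ φ : M →ₗ[MvPolynomial (Fin n) ℂ] Cinf n, φ m ≠ 0 := by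
  have hne : LinearMap.ker (LinearMap.toSpanSingleton (MvPolynomial (Fin n) ℂ) M m) ≠ ⊤ := by
    intro h
    apply hm
    have : (1 : MvPolynomial (Fin n) ℂ) ∈
      LinearMap.ker (LinearMap.toSpanSingleton (MvPolynomial (Fin n) ℂ) M m) := h ▸ trivial
    simpa using this
  obtain ⟨I, hI, hle⟩ := Ideal.exists_le_maximal _ hne
  have hnot : m ∉ (⨅ i : ℕ, I ^ i • ⊤ : Submodule (MvPolynomial (Fin n) ℂ) M) := by
    rw [Ideal.mem_iInf_smul_pow_eq_bot_iff]
    rintro ⟨r, hr⟩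
    apply hI.ne_top
    rw [Ideal.eq_top_iff_one]
    have h1 : (1 - r : MvPolynomial (Fin n) ℂ) ∈ I := by
      apply hle
      simp [sub_smul, hr]
    have := I.add_mem h1 r.2
    simpa using this
  obtain ⟨k, hk⟩ : ∃ k : ℕ, m ∉ (I ^ k • ⊤ : Submodule (MvPolynomial (Fin n) ℂ) M) := by
    by_contra! h
    exact hnot ((Submodule.mem_iInf _).2 h)
  let N := M ⧸ (I ^ k • ⊤ : Submodule (MvPolynomial (Fin n) ℂ) M)
  let _ : Module ℂ N := Module.compHom N (algebraMap ℂ (MvPolynomial (Fin n) ℂ))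
  have : IsScalarTower ℂ (MvPolynomial (Fin n) ℂ) N := by
    apply IsScalarTower.of_algebraMap_smul
    intro r x
    rfl
  have : IsScalarTower ℂ (MvPolynomial (Fin n) ℂ ⧸ I ^ k) N := by
    refine ⟨fun a q y => ?_⟩
    obtain ⟨p, rfl⟩ := Ideal.Quotient.mk_surjective q
    change (a • p) • y = a • (p • y)
    exact smul_assoc a p y
  have := aux_finite n I k
  have : Module.Finite ℂ N := Module.Finite.trans (MvPolynomial (Fin n) ℂ ⧸ I ^ k) N
  obtain ⟨φ, hφ⟩ := aux_linear n hX hC N (Submodule.Quotient.mk m)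
    (fun h => hk ((Submodule.Quotient.mk_eq_zero _).1 h))
  exact ⟨φ ∘ₗ Submodule.mkQ _, hφ⟩
end
end
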